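/- Let 𝒜 be a finite alphabet of positive integers with δ_𝒜 > 1 − 5/312. Then 100% of integers satisfy Zaremba's conjecture for 𝒜: #𝔇_𝒜(N) = N·(1 + o(1)) as N → ∞, i.e. #𝔇_𝒜(N)/N → 1. -/

import Mathlib

open Filter

/-- Value of the finite continued fraction `[a₁,…,a_k] = 1/(a₁+1/(a₂+⋯+1/a_k))`. -/
def cfVal : List ℕ → ℚ
  | [] => 0
  | a :: l => 1 / ((a : ℚ) + cfVal l)

/-- `q ∈ 𝔯_𝒜`: `q` is a rational in `(0,1)` admitting a continued fraction expansion with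
all partial quotients in the alphabet `𝒜`. -/
def memR (A : Set ℕ) (q : ℚ) : Prop :=
  0 < q ∧ q < 1 ∧ ∃ l : List ℕ, l ≠ [] ∧ (∀ a ∈ l, a ∈ A) ∧ cfVal l = q

/-- `d ∈ 𝔇_𝒜`: `d ≥ 1` is the denominator of a reduced fraction `b/d ∈ 𝔯_𝒜`. -/
def memD (A : Set ℕ) (d : ℕ) : Prop :=
  1 ≤ d ∧ ∃ b : ℕ, Nat.Coprime b d ∧ memR A ((b : ℚ) / d)

/-- `#𝔇_𝒜(N)`, the number of `d ∈ 𝔇_𝒜` with `d ≤ N`. -/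
noncomputable def Dcount (A : Set ℕ) (N : ℕ) : ℕ :=
  Set.ncard {d : ℕ | d ≤ N ∧ memD A d}

/-- The Cantor set `𝔠_𝒜` of irrationals in `[0,1]` all of whose continued fraction partial
quotients lie in `𝒜` (equivalently, limits of the convergents `[a₁,…,a_k]` with all `a_j ∈ 𝒜`). -/
def cantorCF (A : Set ℕ) : Set ℝ :=
  {x | Irrational x ∧ 0 ≤ x ∧ x ≤ 1 ∧
    ∃ a : ℕ → ℕ, (∀ n, a n ∈ A) ∧
      Tendsto (fun k => ((cfVal (List.ofFn fun i : Fin k => a i) : ℚ) : ℝ)) atTop (nhds x)}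

/-- `δ_𝒜`, the Hausdorff dimension of `𝔠_𝒜` (as a real number). -/
noncomputable def hdim (A : Set ℕ) : ℝ := (dimH (cantorCF A)).toReal


namespace ZD
abbrev PA (A : Finset ℕ) : Prop := ∀ a ∈ A, 0 < a
notation "k49" => (49/25 : ℝ)
notation "nhf" => (-(1/2) : ℝ)
open scoped Pointwise
open Finset
abbrev aa := Matrix (Fin 2) (Fin 2) Int
def gen (a : Nat) : aa := !![0, 1; 1, (a : Int)]
def G (A : Finset Nat) : Finset aa := A.image gen
structure Good (g : aa) : Prop where
  h0 : 0 <= g 0 0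
  h1 : g 0 0 <= g 0 1
  h2 : g 0 1 <= g 1 1
  h3 : g 0 0 <= g 1 0
  h4 : g 1 0 <= g 1 1
  hd : (g 0 0 * g 1 1 - g 0 1 * g 1 0) ^ 2 = 1
lemma et (g h : aa) : (g * h) 0 0 = g 0 0 * h 0 0 + g 0 1 * h 1 0 := by
  simp [Matrix.mul_apply, Fin.sum_univ_two]
lemma dg (g h : aa) : (g * h) 0 1 = g 0 0 * h 0 1 + g 0 1 * h 1 1 := by
  simp [Matrix.mul_apply, Fin.sum_univ_two]
lemma cw (g h : aa) : (g * h) 1 0 = g 1 0 * h 0 0 + g 1 1 * h 1 0 := by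
  simp [Matrix.mul_apply, Fin.sum_univ_two]
lemma ao (g h : aa) : (g * h) 1 1 = g 1 0 * h 0 1 + g 1 1 * h 1 1 := by
  simp [Matrix.mul_apply, Fin.sum_univ_two]
@[simp] lemma dt (a : Nat) : gen a 0 0 = 0 := rfl
@[simp] lemma dh (a : Nat) : gen a 0 1 = 1 := rfl
@[simp] lemma du (a : Nat) : gen a 1 0 = 1 := rfl
@[simp] lemma di (a : Nat) : gen a 1 1 = a := rfl
lemma ext2 {g h : aa} (eu : g 0 0 = h 0 0) (kb : g 0 1 = h 0 1) (kc : g 1 0 = h 1 0)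
    (ke : g 1 1 = h 1 1) : g = h := by
  ext i j; fin_cases i <;> fin_cases j <;> assumption
lemma Good.p01 {g : aa} (hg : Good g) : 1 <= g 0 1 := by
  rcases hg with ⟨h0, h1, h2, h3, h4, hd⟩
  by_contra h
  have ab : g 0 1 = 0 := by omega
  have ac : g 0 0 = 0 := by omega
  rw [ab, ac] at hd; norm_num at hd
lemma Good.p10 {g : aa} (hg : Good g) : 1 <= g 1 0 := by
  rcases hg with ⟨h0, h1, h2, h3, h4, hd⟩
  by_contra h
  have ab : g 1 0 = 0 := by omega
  have ac : g 0 0 = 0 := by omega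
  rw [ab, ac] at hd; norm_num at hd
lemma Good.p11 {g : aa} (hg : Good g) : 1 <= g 1 1 := hg.p10.trans hg.h4
lemma Good.transpose {g : aa} (hg : Good g) : Good g.transpose := by
  rcases hg with ⟨h0, h1, h2, h3, h4, hd⟩
  refine ⟨h0, h3, h4, h1, h2, ?_⟩
  simp only [Matrix.transpose_apply]; rw [<- hd]; ring
lemma Good.mul {g h : aa} (hg : Good g) (hh : Good h) : Good (g * h) := by
  have bp := hg.p01; have br := hg.p10; have cy := hh.p01; have ec := hh.p10
  rcases hg with ⟨h0, h1, h2, h3, h4, hd⟩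
  rcases hh with ⟨an, ed, ee, lk, gc, kd⟩
  refine ⟨?_, ?_, ?_, ?_, ?_, ?_⟩
  . rw [et]; have := mul_nonneg h0 an; nlinarith
  . rw [et, dg]; nlinarith
  . rw [dg, ao]; nlinarith
  . rw [et, cw]; nlinarith
  . rw [cw, ao]; nlinarith
  . rw [et, dg, cw, ao]
    have : (((g 0 0 * g 1 1 - g 0 1 * g 1 0)) * (h 0 0 * h 1 1 - h 0 1 * h 1 0)) ^ 2 = 1 := by
      rw [mul_pow, hd, kd]; norm_num
    rw [<- this]; ring
lemma good_gen {a : Nat} (ha : 0 < a) : Good (gen a) := by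
  refine ⟨?_, ?_, ?_, ?_, ?_, ?_⟩ <;> simp <;> omega
lemma good_pow {A : Finset Nat} (hA : PA A) {n : Nat} {g : aa} (hn : 1 <= n)
    (hg : g ∈ G A ^ n) : Good g := by
  induction n, hn using Nat.le_induction generalizing g with
  | base =>
    rw [pow_one, G, mem_image] at hg
    obtain ⟨a, ha, rfl⟩ := hg; exact good_gen (hA a ha)
  | succ n hn ih =>
    rw [pow_succ, Finset.mem_mul] at hg
    obtain ⟨x, hx, y, hy, rfl⟩ := hg
    rw [G, mem_image] at hy
    obtain ⟨a, ha, rfl⟩ := hy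
    exact (ih hx).mul (good_gen (hA a ha))
lemma peel {A : Finset Nat} (hA : PA A) {n : Nat} {g h : aa}
    (hg : g ∈ G A ^ n) (hh : h ∈ G A ^ n) {a b : Nat}
    (ab : (g * gen a) 1 0 = (h * gen b) 1 0) (ac : (g * gen a) 1 1 = (h * gen b) 1 1) :
    a = b ∧ g 1 0 = h 1 0 ∧ g 1 1 = h 1 1 := by
  simp only [cw, ao, dt, dh, du, di, mul_zero, mul_one, zero_add] at ab ac
  rcases Nat.eq_zero_or_pos n with rfl | hn
  . simp only [pow_zero, Finset.mem_one] at hg hh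
    subst hg; subst hh
    simp at ac; exact ⟨ac, rfl, rfl⟩
  . have hg' := good_pow hA hn hg
    have hh' := good_pow hA hn hh
    have bp := hg'.p10; have br := hh'.p10; have cy := hg'.h4; have ec := hh'.h4
    rw [<- ab] at ac ec
    have hq : 0 < g 1 1 := by omega
    have key : (a : Int) = b := by
      rcases lt_trichotomy (a : Int) b with h | h | h
      . exfalso; have : (a : Int) + 1 <= b := h
        nlinarith
      . exact h
      . exfalso; have : (b : Int) + 1 <= a := h
        nlinarith
    refine ⟨mod_cast key, ?_, ab⟩
    rw [key] at ac; nlinarith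
lemma row2_inj {A : Finset Nat} (hA : PA A) {n : Nat} {g h : aa}
    (hg : g ∈ G A ^ n) (hh : h ∈ G A ^ n) (ab : g 1 0 = h 1 0) (ac : g 1 1 = h 1 1) : g = h := by
  induction n generalizing g h with
  | zero =>
    simp only [pow_zero, Finset.mem_one] at hg hh
    rw [hg, hh]
  | succ n ih =>
    rw [pow_succ, Finset.mem_mul] at hg hh
    obtain ⟨x, hx, y, hy, rfl⟩ := hg
    obtain ⟨x', hx', y', hy', rfl⟩ := hh
    rw [G, mem_image] at hy hy'
    obtain ⟨a, ha, rfl⟩ := hy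
    obtain ⟨b, hb, rfl⟩ := hy'
    obtain ⟨ew, dk, gd⟩ := peel hA hx hx' ab ac
    rw [ew, ih hx hx' dk gd]
lemma factor_inj {A : Finset Nat} (hA : PA A) {n m : Nat} {g h g' h' : aa}
    (hg : g ∈ G A ^ n) (hh : h ∈ G A ^ n) (hg' : g' ∈ G A ^ m) (hh' : h' ∈ G A ^ m)
    (e : g * g' = h * h') : g = h ∧ g' = h' := by
  induction m generalizing g' h' with
  | zero =>
    simp only [pow_zero, Finset.mem_one] at hg' hh'
    subst hg'; subst hh'; simpa using e
  | succ m ih =>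
    rw [pow_succ, Finset.mem_mul] at hg' hh'
    obtain ⟨x, hx, y, hy, rfl⟩ := hg'
    obtain ⟨x', hx', y', hy', rfl⟩ := hh'
    rw [G, mem_image] at hy hy'
    obtain ⟨a, ha, rfl⟩ := hy
    obtain ⟨b, hb, rfl⟩ := hy'
    rw [<- mul_assoc, <- mul_assoc] at e
    have dl : g * x ∈ G A ^ (n + m) := by rw [pow_add]; exact mul_mem_mul hg hx
    have cm : h * x' ∈ G A ^ (n + m) := by rw [pow_add]; exact mul_mem_mul hh hx'
    obtain ⟨ew, dk, gd⟩ := peel hA dl cm (by rw [e]) (by rw [e])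
    have := ih hx hx' (row2_inj hA dl cm dk gd)
    exact ⟨this.1, by rw [this.2, ew]⟩
lemma transpose_mem {A : Finset Nat} {n : Nat} {g : aa} (hg : g ∈ G A ^ n) :
    g.transpose ∈ G A ^ n := by
  induction n generalizing g with
  | zero => simp only [pow_zero, Finset.mem_one] at *; simp [hg]
  | succ n ih =>
    rw [pow_succ, Finset.mem_mul] at hg
    obtain ⟨x, hx, y, hy, rfl⟩ := hg
    rw [Matrix.transpose_mul, pow_succ']
    refine mul_mem_mul ?_ (ih hx)
    rw [G, mem_image] at hy ⊢
    obtain ⟨a, ha, rfl⟩ := hy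
    refine ⟨a, ha, ?_⟩
    apply ext2 <;> rfl
lemma growth {A : Finset Nat} (hA : PA A) (n : Nat) :
    ∀ g ∈ G A ^ n, (2 : Int) ^ n <= (2 * g 1 1) ^ 2 ∧ 1 <= g 1 1 := by
  induction n using Nat.strong_induction_on with
  | _ n ih =>
    match n, ih with
    | 0, _ => intro g hg; simp only [pow_zero, Finset.mem_one] at hg; subst hg; simp
    | 1, _ =>
      intro g hg
      have := (good_pow hA le_rfl hg).p11
      exact ⟨by nlinarith, this⟩
    | n + 2, ih =>
      intro g hg
      have hG := good_pow hA (by omega) hg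
      refine ⟨?_, hG.p11⟩
      rw [pow_succ, Finset.mem_mul] at hg
      obtain ⟨x, hx, y, hy, rfl⟩ := hg
      have hxG := good_pow hA (by omega) hx
      rw [pow_succ, Finset.mem_mul] at hx
      obtain ⟨z, hz, w, hw, rfl⟩ := hx
      rw [G, mem_image] at hy hw
      obtain ⟨a, ha, rfl⟩ := hy
      obtain ⟨b, hb, rfl⟩ := hw
      obtain ⟨ef, dm⟩ := ih n (by omega) z hz
      have z10 : 0 <= z 1 0 := by
        rcases Nat.eq_zero_or_pos n with rfl | hn
        . simp only [pow_zero, Finset.mem_one] at hz; subst hz; simp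
        . have := (good_pow hA hn hz).p10; omega
      have ha' : (1 : Int) <= a := mod_cast hA a ha
      have hb' : (1 : Int) <= b := mod_cast hA b hb
      simp only [cw, ao, dt, dh, du, di, mul_zero, mul_one, zero_add] at *
      have ed : z 1 1 <= z 1 0 + z 1 1 * b := by nlinarith
      have ee : 2 * z 1 1 <= z 1 1 + (z 1 0 + z 1 1 * b) * a := by nlinarith
      have : (2 * (2 * z 1 1)) ^ 2 <= (2 * (z 1 1 + (z 1 0 + z 1 1 * b) * a)) ^ 2 := by
        apply pow_le_pow_left₀ <;> linarith
      rw [pow_add]; nlinarith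
def wmat : List Nat -> aa
  | [] => 1
  | a :: l => gen a * wmat l
lemma wmat_append (l l' : List Nat) : wmat (l ++ l') = wmat l * wmat l' := by
  induction l with
  | nil => simp [wmat]
  | cons a l ih => simp [wmat, ih, mul_assoc]
lemma wmat_mem {A : Finset Nat} {l : List Nat} (h : ∀ a ∈ l, a ∈ A) : wmat l ∈ G A ^ l.length := by
  induction l with
  | nil => simp [wmat]
  | cons a l ih =>
    rw [List.length_cons, pow_succ']
    refine mul_mem_mul ?_ (ih fun b hb => h b (by simp [hb]))
    exact mem_image_of_mem _ (h a (by simp))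
lemma mem_wmat {A : Finset Nat} {n : Nat} {g : aa} (hg : g ∈ G A ^ n) :
    ∃ l : List Nat, l.length = n ∧ (∀ a ∈ l, a ∈ A) ∧ wmat l = g := by
  induction n generalizing g with
  | zero => simp only [pow_zero, Finset.mem_one] at hg; exact ⟨[], rfl, by simp, by rw [hg]; rfl⟩
  | succ n ih =>
    rw [pow_succ', Finset.mem_mul] at hg
    obtain ⟨x, hx, y, hy, rfl⟩ := hg
    rw [G, mem_image] at hx
    obtain ⟨a, ha, rfl⟩ := hx
    obtain ⟨l, h1, h2, h3⟩ := ih hy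
    refine ⟨a :: l, by simp [h1], ?_, by simp [wmat, h3]⟩
    intro b hb
    rcases List.mem_cons.1 hb with rfl | hb
    . exact ha
    . exact h2 b hb
lemma wmat_pos {l : List Nat} (h : ∀ a ∈ l, 0 < a) : 0 <= wmat l 0 1 ∧ 1 <= wmat l 1 1 := by
  induction l with
  | nil => simp [wmat]
  | cons a l ih =>
    have := ih fun b hb => h b (by simp [hb])
    have ha : (1 : Int) <= a := mod_cast h a (by simp)
    simp only [wmat, dg, ao, dt, dh, du, di]
    constructor <;> nlinarith
lemma cfVal_eq {l : List Nat} (h : ∀ a ∈ l, 0 < a) :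
    cfVal l = (wmat l 0 1 : Rat) / (wmat l 1 1 : Rat) := by
  induction l with
  | nil => simp [wmat, cfVal]
  | cons a l ih =>
    have hl : ∀ b ∈ l, 0 < b := fun b hb => h b (by simp [hb])
    rw [cfVal, ih hl]
    obtain ⟨bt, ba⟩ := wmat_pos hl
    have p1' : (0 : Rat) < (wmat l 1 1 : Rat) := mod_cast ba
    simp only [wmat, dg, ao, dt, dh, du, di]
    push_cast
    have : (a : Rat) + (wmat l 0 1 : Rat) / (wmat l 1 1 : Rat)
        = (wmat l 0 1 + a * wmat l 1 1) / (wmat l 1 1 : Rat) := by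
      field_simp; ring
    rw [this]
    simp
lemma memD_of {A : Finset Nat} (hA : PA A) {n : Nat} {g : aa} (hn : 2 <= n)
    (hg : g ∈ G A ^ n) {d : Nat} (hd : g 1 1 = d) : memD (A : Set Nat) d := by
  have hG := good_pow hA (by omega) hg
  obtain ⟨l, h1, h2, h3⟩ := mem_wmat hg
  have hcf := cfVal_eq (l := l) fun a ha => hA a (h2 a ha)
  rw [h3] at hcf
  have p01 := hG.p01
  have p11 := hG.p11
  have lt : g 0 1 < g 1 1 := by
    obtain ⟨m, rfl⟩ : ∃ m, n = 1 + (m + 1) := ⟨n - 2, by omega⟩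
    rw [pow_add, Finset.mem_mul] at hg
    obtain ⟨x, hx, y, hy, rfl⟩ := hg
    have hy' := good_pow hA (by omega) hy
    rw [pow_one, G, mem_image] at hx
    obtain ⟨a, ha, rfl⟩ := hx
    have ha : (1 : Int) <= a := mod_cast hA a ha
    simp only [dg, ao, dt, dh, du, di]
    have := hy'.p01; have := hy'.p11
    nlinarith
  obtain ⟨b, hb⟩ : ∃ b : Nat, g 0 1 = b := ⟨(g 0 1).toNat, by omega⟩
  refine ⟨by omega, b, ?_, ?_⟩
  . rw [Nat.coprime_iff_isRelPrime, <- Nat.coprime_iff_isRelPrime, <- Nat.isCoprime_iff_coprime, <- hb, <- hd]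
    have hdd := hG.hd
    refine ⟨(g 0 0 * g 1 1 - g 0 1 * g 1 0) * (- g 1 0), (g 0 0 * g 1 1 - g 0 1 * g 1 0) * g 0 0, ?_⟩
    rw [<- hdd]; ring
  . have e : (b : Rat) / d = (g 0 1 : Rat) / (g 1 1 : Rat) := by rw [hb, hd]; simp
    have q01 : (0 : Rat) < g 0 1 := mod_cast p01
    have q11 : (0 : Rat) < g 1 1 := mod_cast p11
    refine ⟨?_, ?_, l, ?_, fun a ha => mod_cast h2 a ha, ?_⟩
    . rw [e]; positivity
    . rw [e, div_lt_one q11]; exact_mod_cast lt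
    . rintro rfl; simp at h1; omega
    . rw [hcf, e]
end ZD
namespace ZD
open scoped Pointwise
open Finset
open MeasureTheory ENNReal
lemma ofFn_eq (a : Nat -> Nat) (k : Nat) : (List.ofFn fun i : Fin k => a i) = (List.range k).map a := by
  apply List.ext_getElem <;> simp
lemma wmat_le {l : List Nat} (h : ∀ a ∈ l, 0 < a) : wmat l 0 1 <= wmat l 1 1 := by
  cases l with
  | nil => simp [wmat]
  | cons a l =>
    have := wmat_pos (l := l) fun b hb => h b (by simp [hb])
    have ha : (1 : Int) <= a := mod_cast h a (by simp)
    simp only [wmat, dg, ao, dt, dh, du, di]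
    nlinarith
lemma approx {A : Finset Nat} (hA : PA A) {x : Real} {a : Nat -> Nat}
    (ha : ∀ n, a n ∈ A)
    (hx : Tendsto (fun k => ((cfVal (List.ofFn fun i : Fin k => a i) : Rat) : Real)) atTop (nhds x))
    {k : Nat} (hk : 1 <= k) :
    |x - (wmat ((List.range k).map a) 0 1 : Real) / (wmat ((List.range k).map a) 1 1 : Real)|
      <= 1 / (wmat ((List.range k).map a) 1 1 : Real) ^ 2 := by
  set g := wmat ((List.range k).map a) with hg
  have hmem : g ∈ G A ^ k := by
    have := wmat_mem (A := A) (l := (List.range k).map a) (by simp; intro b _; exact ha b)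
    simpa using this
  have hG := good_pow hA hk hmem
  have hcl : IsClosed {y : Real | |y - (g 0 1 : Real) / (g 1 1 : Real)| <= 1 / (g 1 1 : Real) ^ 2} :=
    isClosed_le (by fun_prop) (by fun_prop)
  refine hcl.mem_of_tendsto hx ?_
  filter_upwards [eventually_ge_atTop k] with k' hk'
  obtain ⟨m, rfl⟩ := Nat.exists_eq_add_of_le hk'
  have hpos : ∀ b ∈ (List.range (k + m)).map a, 0 < b := by
    simp; intro b _; exact hA _ (ha b)
  have hpos2 : ∀ b ∈ ((List.range m).map (k + ·)).map a, 0 < b := by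
    simp; intro b _; exact hA _ (ha _)
  show |((cfVal (List.ofFn fun i : Fin (k+m) => a i) : Rat) : Real) - (g 0 1 : Real) / (g 1 1 : Real)| <= 1 / (g 1 1 : Real) ^ 2
  rw [ofFn_eq, cfVal_eq hpos, List.range_add, List.map_append, wmat_append, <- hg]
  have cn := wmat_pos hpos2
  have dn := wmat_le hpos2
  set h := wmat (((List.range m).map (k + ·)).map a)
  rw [dg, ao]
  push_cast
  have bg : (1:Real) <= g 1 1 := mod_cast hG.p11
  have dv : (1:Real) <= g 1 0 := mod_cast hG.p10
  have gf : (0:Real) <= h 0 1 := mod_cast cn.1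
  have c4 : (1:Real) <= h 1 1 := mod_cast cn.2
  have c5 : (h 0 1:Real) <= h 1 1 := mod_cast dn
  have hdet : |((g 0 0 : Real) * g 1 1 - g 0 1 * g 1 0)| = 1 := by
    have := hG.hd
    have : ((g 0 0 : Real) * g 1 1 - g 0 1 * g 1 0) ^ 2 = 1 := mod_cast this
    exact (sq_eq_sq₀ (abs_nonneg _) zero_le_one).1 (by rw [sq_abs, this]; norm_num)
  have hden : (g 1 1 : Real) * h 1 1 <= g 1 0 * h 0 1 + g 1 1 * h 1 1 := by nlinarith
  have hden0 : (0:Real) < g 1 0 * h 0 1 + g 1 1 * h 1 1 := by nlinarith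
  have e : ((g 0 0 : Real) * h 0 1 + g 0 1 * h 1 1) / (g 1 0 * h 0 1 + g 1 1 * h 1 1)
      - (g 0 1 : Real) / g 1 1 = ((g 0 0 : Real) * g 1 1 - g 0 1 * g 1 0) * h 0 1 /
        ((g 1 0 * h 0 1 + g 1 1 * h 1 1) * g 1 1) := by
    rw [div_sub_div _ _ hden0.ne' (by linarith)]
    congr 1; ring
  rw [e, abs_div, abs_mul, hdet, abs_of_nonneg gf, abs_of_pos (by positivity), one_mul,
    div_le_div_iff₀ (by positivity) (by positivity)]
  nlinarith [mul_nonneg gf (by linarith : (0:Real) <= g 1 1), mul_le_mul_of_nonneg_right hden (by linarith : (0:Real) <= g 1 1)]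
lemma dim_le {A : Finset Nat} (hA : PA A) {s : Real} (hs : 0 < s) (Cst : Real)
    (E : Nat -> Finset aa)
    (hE : ∀ n, ∀ g ∈ E n, (n : Real) + 1 <= g 1 1)
    (hcov : ∀ n, ∀ a : Nat -> Nat, (∀ m, a m ∈ A) -> ∃ k, 1 <= k ∧ wmat ((List.range k).map a) ∈ E n)
    (hsum : ∀ n, ∑ g ∈ E n, (g 1 1 : Real) ^ (-(2 * s)) <= Cst) :
    hdim (A : Set Nat) <= s := by
  have hdiam : ∀ n, ∀ g ∈ E n, Metric.ediam (Metric.closedBall ((g 0 1 : Real) / (g 1 1 : Real)) (1 / (g 1 1 : Real) ^ 2))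
      = ENNReal.ofReal (2 * (1 / (g 1 1 : Real) ^ 2)) := by
    intro n g hg
    rw [Real.closedBall_eq_Icc, Real.ediam_Icc]; congr 1; ring
  have key : μH[s] (cantorCF (A : Set Nat)) <=
      liminf (fun n => ∑ g : E n, Metric.ediam (Metric.closedBall ((g.1 0 1 : Real) / (g.1 1 1 : Real)) (1 / (g.1 1 1 : Real) ^ 2)) ^ s) atTop := by
    refine Measure.hausdorffMeasure_le_liminf_sum s _ (fun n : Nat => ENNReal.ofReal (2 / ((n : Real) + 1))) ?_ _ ?_ ?_
    . rw [<- ENNReal.ofReal_zero]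
      apply ENNReal.tendsto_ofReal
      have := tendsto_one_div_add_atTop_nhds_zero_nat (𝕜 := Real)
      simpa [div_eq_mul_inv] using this.const_mul 2
    . refine Eventually.of_forall fun n g => ?_
      rw [hdiam n g.1 g.2]
      apply ENNReal.ofReal_le_ofReal
      have h1 := hE n g.1 g.2
      have h0 : (0:Real) < n + 1 := by positivity
      rw [mul_one_div, div_le_div_iff₀ (by nlinarith [sq_nonneg (g.1 1 1 : Real)]) h0]
      have : (1:Real) <= n + 1 := by simp
      nlinarith
    . refine Eventually.of_forall fun n => ?_
      rintro x ⟨_, _, _, a, ha, hx⟩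
      obtain ⟨k, hk, hm⟩ := hcov n a (fun m => mod_cast ha m)
      rw [Set.mem_iUnion]
      refine ⟨⟨_, hm⟩, ?_⟩
      rw [Metric.mem_closedBall, Real.dist_eq]
      exact approx hA (fun m => mod_cast ha m) hx hk
  have bound : ∀ n, ∑ g : E n, Metric.ediam (Metric.closedBall ((g.1 0 1 : Real) / (g.1 1 1 : Real)) (1 / (g.1 1 1 : Real) ^ 2)) ^ s
      <= ENNReal.ofReal (2 ^ s * Cst) := by
    intro n
    have ab : ∀ g : E n, Metric.ediam (Metric.closedBall ((g.1 0 1 : Real) / (g.1 1 1 : Real)) (1 / (g.1 1 1 : Real) ^ 2)) ^ s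
        = ENNReal.ofReal (2 ^ s * (g.1 1 1 : Real) ^ (-(2 * s))) := by
      intro g
      have h1 := hE n g.1 g.2
      have h0 : (0:Real) < g.1 1 1 := by
        have : (0:Real) <= n := by positivity
        linarith
      rw [hdiam n g.1 g.2, ENNReal.ofReal_rpow_of_pos (by positivity)]
      congr 1
      rw [Real.mul_rpow (by norm_num) (by positivity)]
      congr 1
      rw [one_div, <- Real.rpow_natCast, <- Real.rpow_neg h0.le, <- Real.rpow_mul h0.le]
      congr 1; push_cast; ring
    rw [sum_congr rfl fun g _ => ab g, <- ENNReal.ofReal_sum_of_nonneg]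
    . apply ENNReal.ofReal_le_ofReal
      rw [<- mul_sum]
      apply mul_le_mul_of_nonneg_left _ (by positivity)
      have := hsum n
      rw [<- sum_coe_sort] at this
      exact this
    . intro g _
      have h1 := hE n g.1 g.2
      have h0 : (0:Real) < g.1 1 1 := by
        have : (0:Real) <= n := by positivity
        linarith
      positivity
  have fin : μH[s] (cantorCF (A : Set Nat)) <= ENNReal.ofReal (2 ^ s * Cst) := by
    refine key.trans ?_
    refine (liminf_le_liminf (Eventually.of_forall bound)).trans ?_
    simp
  have h3 := dimH_le_of_hausdorffMeasure_ne_top (s := cantorCF (A : Set Nat)) (d := ⟨s, hs.le⟩)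
    (ne_top_of_le_ne_top ENNReal.ofReal_ne_top fin)
  have h4 := ENNReal.toReal_mono ENNReal.coe_ne_top h3
  exact h4
lemma wr_succ (a : Nat -> Nat) (k : Nat) : wmat ((List.range (k+1)).map a) =
    wmat ((List.range k).map a) * gen (a k) := by
  rw [List.range_succ, List.map_append, wmat_append]; simp [wmat]
lemma wr_mem {A : Finset Nat} {a : Nat -> Nat} (ha : ∀ n, a n ∈ A) (k : Nat) :
    wmat ((List.range k).map a) ∈ G A ^ k := by
  have := wmat_mem (A := A) (l := (List.range k).map a) (by simp; intro b _; exact ha b)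
  simpa using this
def cand (A : Finset Nat) (C M n : Nat) : Finset aa :=
  (G A ^ n).filter fun g => (M : Int) <= g 1 1 ∧ g 1 1 <= C * M
lemma count_lower {A : Finset Nat} (hA : PA A) {C : Nat} (hC : ∀ a ∈ A, a + 1 <= C)
    {s : Real} (hs : 0 < s) (hdimA : s < hdim (A : Set Nat)) :
    ∃ gg : Nat, ∀ M : Nat, gg <= M -> (M : Real) ^ (2 * s) <=
      ∑ n ∈ Finset.Icc 1 (Nat.log 2 ((2 * (C * M)) ^ 2)), ((cand A C M n).card : Real) := by
  by_contra hcon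
  push Not at hcon
  choose f kf hf2 using fun n : Nat => hcon (n + 2)
  refine absurd (dim_le hA hs 1
    (fun n => (Finset.Icc 1 (Nat.log 2 ((2 * (C * f n)) ^ 2))).biUnion (cand A C (f n))) ?_ ?_ ?_)
    (not_le.2 hdimA)
  . intro n g hg
    simp only [mem_biUnion, cand, mem_filter] at hg
    obtain ⟨k, _, _, h, _⟩ := hg
    have h1 := kf n
    have : (n : Int) + 1 <= g 1 1 := by omega
    exact_mod_cast this
  . intro n a ha
    have hex : ∃ k, (f n : Int) <= wmat ((List.range k).map a) 1 1 := by
      refine ⟨2 * (f n) + 2, ?_⟩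
      obtain ⟨h1, h2⟩ := growth hA _ _ (wr_mem ha (2 * (f n) + 2))
      have : (2:Int) ^ (2 * f n + 2) = (2 * 2 ^ f n) ^ 2 := by ring
      rw [this] at h1
      have h3 := (pow_le_pow_iff_left₀ (by positivity) (by linarith) (by norm_num)).1 h1
      have : (f n : Int) < 2 ^ (f n) := mod_cast Nat.lt_two_pow_self
      linarith
    classical
    obtain ⟨k, hk, hmin⟩ : ∃ k, (f n : Int) <= wmat ((List.range k).map a) 1 1 ∧
      ∀ m < k, ¬ (f n : Int) <= wmat ((List.range m).map a) 1 1 :=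
      ⟨Nat.find hex, Nat.find_spec hex, fun m hm => Nat.find_min hex hm⟩
    have hfn := kf n
    have ll : 1 <= k := by
      rcases Nat.eq_zero_or_pos k with rfl | h
      . simp [wmat] at hk; omega
      . exact h
    refine ⟨k, ll, ?_⟩
    have hup : wmat ((List.range k).map a) 1 1 <= C * f n := by
      obtain ⟨m, rfl⟩ : ∃ m, k = m + 1 := ⟨k - 1, by omega⟩
      have hm := hmin m (by omega)
      rw [wr_succ, ao, dh, di]
      have bk := (growth hA _ _ (wr_mem ha m)).2
      have bw : wmat ((List.range m).map a) 1 0 <= wmat ((List.range m).map a) 1 1 := by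
        rcases Nat.eq_zero_or_pos m with rfl | h
        . simp [wmat]
        . exact (good_pow hA h (wr_mem ha m)).h4
      have hc : (a m : Int) + 1 <= C := mod_cast hC _ (ha m)
      push Not at hm
      nlinarith
    simp only [mem_biUnion, mem_Icc]
    refine ⟨k, ⟨ll, ?_⟩, ?_⟩
    . apply Nat.le_log_of_pow_le (by norm_num)
      obtain ⟨h1, h2⟩ := growth hA _ _ (wr_mem ha k)
      have : (2 * wmat ((List.range k).map a) 1 1) ^ 2 <= (2 * (C * f n : Int)) ^ 2 := by
        apply pow_le_pow_left₀ <;> linarith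
      exact_mod_cast h1.trans this
    . simp only [cand, mem_filter]
      exact ⟨wr_mem ha k, hk, hup⟩
  . intro n
    have hfn := kf n
    have lm : (0:Real) < f n := mod_cast (by omega : 0 < f n)
    calc _ <= ∑ g ∈ (Finset.Icc 1 (Nat.log 2 ((2 * (C * f n)) ^ 2))).biUnion (cand A C (f n)), (f n : Real) ^ (-(2*s)) := by
          apply sum_le_sum
          intro g hg
          simp only [mem_biUnion, cand, mem_filter] at hg
          obtain ⟨k, _, _, h, _⟩ := hg
          apply Real.rpow_le_rpow_of_nonpos lm _ (by linarith)
          exact_mod_cast h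
      _ <= 1 := by
          rw [sum_const, nsmul_eq_mul, Real.rpow_neg lm.le, <- div_eq_mul_inv,
            div_le_one (by positivity)]
          refine le_trans ?_ (hf2 n).le
          exact_mod_cast card_biUnion_le
lemma sum_mul_eq {A : Finset Nat} (hA : PA A) {n m : Nat} {U Z : Finset aa}
    (hU : U ⊆ G A ^ n) (hZ : Z ⊆ G A ^ m) {R : Type*} [AddCommMonoid R] (f : aa -> R) :
    ∑ g ∈ U * Z, f g = ∑ u ∈ U, ∑ z ∈ Z, f (u * z) := by
  rw [<- sum_product', mul_def, sum_image]
  rintro ⟨a, b⟩ h1 ⟨c, d⟩ h2 h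
  simp only [coe_product, Set.mem_prod, mem_coe] at h1 h2 h
  obtain ⟨ew, dk⟩ := factor_inj hA (hU h1.1) (hU h2.1) (hZ h1.2) (hZ h2.2) h
  rw [ew, dk]
lemma card_mul_eq {A : Finset Nat} (hA : PA A) {n m : Nat} {U Z : Finset aa}
    (hU : U ⊆ G A ^ n) (hZ : Z ⊆ G A ^ m) : (U * Z).card = U.card * Z.card := by
  have := sum_mul_eq hA hU hZ (fun _ => 1)
  simpa using this
lemma y_le {e ε y : Real} (he : e = 1 - ε) (hε : 0 <= ε) (ln : ε <= 1) (hy : 1 <= y) :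
    y ^ (-e) <= (1 + ε * (y - 1)) / y ∧ 1 / y <= y ^ (-e) := by
  have eg : 0 < y := by linarith
  have h1 : y ^ (-e) = y ^ ε / y := by
    rw [he, neg_sub, Real.rpow_sub eg, Real.rpow_one]
  rw [h1]
  constructor
  . apply div_le_div_of_nonneg_right _ eg.le
    have := rpow_one_add_le_one_add_mul_self (s := y - 1) (by linarith) hε ln
    simpa using this
  . apply div_le_div_of_nonneg_right _ eg.le
    exact Real.one_le_rpow hy hε
lemma tele (φ : Nat -> Real) (h0 : ∀ n, 0 <= φ n) (hmono : ∀ n, φ (n+1) <= φ n) (A : Finset Nat)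
    (hA : PA A) (gh : 1 ∉ A ∨ 2 ∉ A) (hconv : φ 2 <= φ 1 - φ 2 + φ 3) :
    ∑ a ∈ A, (φ a - φ (a+1)) <= φ 1 - φ 2 + φ 3 := by
  have tel : ∀ k n, k <= n -> ∑ a ∈ Finset.Ico k n, (φ a - φ (a+1)) = φ k - φ n := by
    intro k n h
    induction n, h using Nat.le_induction with
    | base => simp
    | succ n hn ih => rw [sum_Ico_succ_top hn, ih]; ring
  set n := A.sup id + 4
  have hn : ∀ a ∈ A, a < n := fun a ha => by
    have : a <= A.sup id := le_sup (f := id) ha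
    omega
  rcases gh with h | h
  . calc _ <= ∑ a ∈ Finset.Ico 2 n, (φ a - φ (a+1)) := by
          apply sum_le_sum_of_subset_of_nonneg
          . intro a ha
            have := hA a ha; have := hn a ha
            have : a ≠ 1 := fun h' => h (h' ▸ ha)
            simp; omega
          . intro a _ _; linarith [hmono a]
      _ <= _ := by rw [tel 2 n (by omega)]; linarith [h0 n]
  . calc _ <= ∑ a ∈ insert 1 (Finset.Ico 3 n), (φ a - φ (a+1)) := by
          apply sum_le_sum_of_subset_of_nonneg
          . intro a ha
            have := hA a ha; have := hn a ha
            have : a ≠ 2 := fun h' => h (h' ▸ ha)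
            simp; omega
          . intro a _ _; linarith [hmono a]
      _ <= _ := by
          rw [sum_insert (by simp), tel 3 n (by omega)]; linarith [h0 n]
lemma one_two_mem {A : Finset Nat} (hA : PA A)
    (hdimA : hdim (A : Set Nat) > 1 - 5 / 312) : 1 ∈ A ∧ 2 ∈ A := by
  by_contra hcon
  have gh : 1 ∉ A ∨ 2 ∉ A := by tauto
  set ε : Real := 10 / 312 with hε
  set e : Real := 302 / 312 with he
  have hee : e = 1 - ε := by norm_num [he, hε]
  have core : ∀ x : Real, 0 < x -> x <= 1 ->
      ∑ a ∈ A, (((a:Real) + x) ^ (-e) - ((a:Real) + 1 + x) ^ (-e)) <= (1 - (1 + x) ^ (-e)) / x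
      ∧ 2⁻¹ * (1 - ε) <= (1 - (1 + x) ^ (-e)) / x := by
    intro x hx fg
    have bl := y_le hee (by norm_num [hε]) (by norm_num [hε]) (y := 1 + x) (by linarith)
    have bx := y_le hee (by norm_num [hε]) (by norm_num [hε]) (y := 2 + x) (by linarith)
    have dp := y_le hee (by norm_num [hε]) (by norm_num [hε]) (y := 3 + x) (by linarith)
    have r : (1 - ε) / (1 + x) <= (1 - (1 + x) ^ (-e)) / x := by
      rw [le_div_iff₀ hx]
      have : (1 - ε) / (1 + x) * x = 1 - (1 + ε * (1 + x - 1)) / (1 + x) := by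
        field_simp; ring
      rw [this]; linarith [bl.1]
    constructor
    . refine le_trans ?_ r
      have t := tele (fun n => ((n:Real) + x) ^ (-e)) (fun n => by positivity)
        (fun n => by
          apply Real.rpow_le_rpow_of_nonpos
          . positivity
          . push_cast; linarith
          . norm_num [he]) A hA gh ?_
      . push_cast at t
        refine (t.trans ?_)
        have cf : (1 + x) ^ (-e) - (2 + x) ^ (-e) + (3 + x) ^ (-e) <=
          (1 + ε * (1 + x - 1)) / (1 + x) - 1 / (2 + x) + (1 + ε * (3 + x - 1)) / (3 + x) := by
          linarith [bl.1, bx.2, dp.1]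
        refine cf.trans ?_
        rw [div_sub_div _ _ (by positivity) (by positivity), div_add_div _ _ (by positivity) (by positivity),
          div_le_div_iff₀ (by positivity) (by positivity)]
        rw [hε]
        have : 0 <= (1 - x) := by linarith
        have ba : 0 < 1 + x := by linarith
        rw [<- sub_nonneg]
        have : (1 - 10 / 312) * ((1 + x) * (2 + x) * (3 + x)) -
          ((((1 + 10 / 312 * (1 + x - 1)) * (2 + x) - (1 + x) * 1) * (3 + x) +
            (1 + x) * (2 + x) * (1 + 10 / 312 * (3 + x - 1))) * (1 + x)) =
          (1 + x) * ((1 - 10/312) * ((2 + x) * (3 + x)) -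
          ((((1 + 10 / 312 * x) * (2 + x) - (1 + x)) * (3 + x) +
            (1 + x) * (2 + x) * (1 + 10 / 312 * (2 + x))))) := by ring
        rw [this]
        apply mul_nonneg ba.le
        nlinarith [mul_nonneg (mul_nonneg hx.le hx.le) ‹0 <= 1 - x›, mul_nonneg hx.le ‹0 <= 1 - x›]
      . simp only [Nat.cast_ofNat, Nat.cast_one]
        have cf : 2 * (2 + x) ^ (-e) <= 2 * ((1 + ε * (2 + x - 1)) / (2 + x)) := by linarith [bx.1]
        have cp : 1 / (1 + x) + 1 / (3 + x) <= (1 + x) ^ (-e) + (3 + x) ^ (-e) := by linarith [bl.2, dp.2]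
        have l3 : 2 * ((1 + ε * (2 + x - 1)) / (2 + x)) <= 1 / (1 + x) + 1 / (3 + x) := by
          rw [div_add_div _ _ (by positivity) (by positivity), mul_div_assoc', div_le_div_iff₀ (by positivity) (by positivity), hε]
          nlinarith [mul_nonneg hx.le (by linarith : 0 <= 1 - x), mul_nonneg (mul_nonneg hx.le hx.le) (by linarith : 0 <= 1 - x)]
        have kg := cf.trans (l3.trans cp)
        generalize (1 + x) ^ (-e) = bc at kg ⊢
        generalize (2 + x) ^ (-e) = be at kg ⊢
        generalize (3 + x) ^ (-e) = y3 at kg ⊢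
        linarith
    . refine le_trans ?_ r
      rw [div_eq_mul_inv, mul_comm]
      apply mul_le_mul_of_nonneg_left _ (by norm_num [hε])
      apply inv_anti₀ <;> linarith
  set H : Real -> Real := fun x => (1 - (1 + x) ^ (-e)) / x with hH
  set w : aa -> Real := fun g => (g 1 1 : Real) ^ (-(1 + e)) * H ((g 1 0 : Real) / g 1 1) with hw
  have step : ∀ g : aa, Good g -> ∑ z ∈ G A, w (g * z) <= w g := by
    intro g hg
    rw [G, sum_image (by
      intro a _ b _ h
      have := congrFun (congrFun h 1) 1
      simpa using this)]
    have bu : (0:Real) < g 1 1 := mod_cast hg.p11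
    have bt : (0:Real) < g 1 0 := mod_cast hg.p10
    have pq : (g 1 0 : Real) <= g 1 1 := mod_cast hg.h4
    set x : Real := (g 1 0 : Real) / g 1 1 with hx
    have cs : 0 < x := by positivity
    have af : x <= 1 := by rw [hx, div_le_one bu]; exact pq
    have hp : (g 1 0 : Real) = x * g 1 1 := by rw [hx]; field_simp
    have ab : ∀ a : Nat, w (g * gen a) = (g 1 1 : Real) ^ (-(1 + e)) * (((a:Real) + x) ^ (-e) - ((a:Real) + 1 + x) ^ (-e)) := by
      intro a
      simp only [hw, hH, cw, ao, dt, dh, du, di, mul_zero, mul_one, zero_add]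
      push_cast
      have au : 0 < (a:Real) + x := by positivity
      have h1 : (g 1 0 : Real) + g 1 1 * a = g 1 1 * (a + x) := by rw [hp]; ring
      rw [h1]
      have h2 : (g 1 1 : Real) / (g 1 1 * (a + x)) = 1 / (a + x) := by field_simp
      rw [h2, Real.mul_rpow bu.le au.le, mul_assoc]
      congr 1
      have h3 : 1 + 1 / ((a:Real) + x) = (a + 1 + x) / (a + x) := by field_simp; ring
      rw [h3, Real.div_rpow (by positivity) au.le, neg_add, Real.rpow_add au, Real.rpow_neg_one]
      have : ((a:Real) + x) ^ (-e) ≠ 0 := by positivity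
      field_simp
    rw [sum_congr rfl fun a _ => ab a, <- mul_sum]
    exact mul_le_mul_of_nonneg_left (core x cs af).1 (by positivity)
  have total : ∀ k, 1 <= k -> ∑ g ∈ G A ^ k, w g <= ∑ g ∈ G A, w g := by
    intro k hk
    induction k, hk using Nat.le_induction with
    | base => simp
    | succ k hk ih =>
      refine le_trans ?_ ih
      rw [pow_succ, sum_mul_eq hA (n := k) (m := 1) le_rfl (by rw [pow_one])]
      exact sum_le_sum fun g hg => step g (good_pow hA hk hg)
  refine absurd (dim_le hA (s := 307/312) (by norm_num) (2 / (1 - ε) * ∑ g ∈ G A, w g)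
    (fun n => G A ^ (2 * n + 2)) ?_ ?_ ?_) (not_le.2 (by norm_num at hdimA ⊢; linarith))
  . intro n g hg
    obtain ⟨h1, h2⟩ := growth hA _ _ hg
    have : (2:Int) ^ (2 * n + 2) = (2 * 2 ^ n) ^ 2 := by ring
    rw [this] at h1
    have h3 := (pow_le_pow_iff_left₀ (by positivity) (by linarith) (by norm_num)).1 h1
    have : (n : Int) < 2 ^ n := mod_cast Nat.lt_two_pow_self
    have : (n : Int) + 1 <= g 1 1 := by linarith
    exact_mod_cast this
  . intro n a ha
    exact ⟨2 * n + 2, by omega, wr_mem ha _⟩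
  . intro n
    refine le_trans ?_ (mul_le_mul_of_nonneg_left (total (2 * n + 2) (by omega)) (by norm_num [hε]))
    rw [mul_sum]
    apply sum_le_sum
    intro g hg
    have hg := good_pow hA (by omega) hg
    have bu : (0:Real) < g 1 1 := mod_cast hg.p11
    have bt : (0:Real) < g 1 0 := mod_cast hg.p10
    have pq : (g 1 0 : Real) <= g 1 1 := mod_cast hg.h4
    have c := (core ((g 1 0 : Real) / g 1 1) (by positivity) (by rw [div_le_one bu]; exact pq)).2
    have ac : (-(2 * (307 / 312)) : Real) = -(1 + e) := by norm_num [he]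
    rw [ac, hw]
    have gf : 1 <= 2 / (1 - ε) * H ((g 1 0 : Real) / g 1 1) := by
      calc (1:Real) = 2 / (1 - ε) * (2⁻¹ * (1 - ε)) := by norm_num [hε]
        _ <= _ := mul_le_mul_of_nonneg_left c (by norm_num [hε])
    calc (g 1 1 : Real) ^ (-(1 + e)) = (g 1 1 : Real) ^ (-(1 + e)) * 1 := by ring
      _ <= (g 1 1 : Real) ^ (-(1 + e)) * (2 / (1 - ε) * H ((g 1 0 : Real) / g 1 1)) :=
          mul_le_mul_of_nonneg_left gf (by positivity)
      _ = _ := by ring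
end ZD
namespace ZD
open scoped Pointwise
open Finset
def Spr (r : Real) (Z : Finset aa) : Prop := ∀ g ∈ Z, ∀ h ∈ Z, ∀ i j, (g i j : Real) <= r * h i j
lemma entries_pos {A : Finset Nat} (hA : PA A) {n : Nat} (hn : 2 <= n) {g : aa}
    (hg : g ∈ G A ^ n) (i j : Fin 2) : 1 <= g i j ∧ g i j <= g 1 1 := by
  have hG := good_pow hA (by omega) hg
  have eu : 1 <= g 0 0 := by
    obtain ⟨m, rfl⟩ : ∃ m, n = (m + 1) + 1 := ⟨n - 2, by omega⟩
    rw [pow_succ, Finset.mem_mul] at hg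
    obtain ⟨x, hx, y, hy, rfl⟩ := hg
    have := (good_pow hA (by omega) hx).p01
    rw [G, mem_image] at hy
    obtain ⟨a, ha, rfl⟩ := hy
    simpa [et] using this
  have bp := hG.h1; have br := hG.h2; have cy := hG.h3; have ec := hG.h4
  fin_cases i <;> fin_cases j <;> simp <;> omega
lemma ev_log (δ c : Real) (hδ : 0 < δ) : ∀ᶠ T : Nat in atTop, c * Real.log T ^ 9 <= (T : Real) ^ δ := by
  have h := isLittleO_log_rpow_rpow_atTop (s := δ) 9 hδ
  have h2 := h.bound (c := (|c| + 1)⁻¹) (by positivity)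
  have h3 := tendsto_natCast_atTop_atTop.eventually h2
  filter_upwards [h3, eventually_ge_atTop 1] with T hT h1
  have bf : 0 <= Real.log T := Real.log_natCast_nonneg T
  have kh : Real.log T ^ (9:Real) = Real.log T ^ 9 := by
    rw [<- Real.rpow_natCast]; norm_num
  rw [kh, Real.norm_of_nonneg (by positivity), Real.norm_of_nonneg (by positivity), inv_mul_eq_div,
    le_div_iff₀ (by positivity)] at hT
  have : c <= |c| + 1 := by linarith [le_abs_self c]
  nlinarith [pow_nonneg bf 9]
lemma pinned {A : Finset Nat} (hA : PA A) {C : Nat} (hC : ∀ a ∈ A, a + 1 <= C)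
    (hdimA : hdim (A : Set Nat) > 1 - 5 / 312) :
    ∃ bn : Nat, ∀ T : Nat, bn <= T -> ∃ n, 1 <= n ∧ ∃ Z ⊆ G A ^ n,
      (∀ g ∈ Z, (T : Int) <= g 1 1 ∧ g 1 1 <= C * T) ∧ (T : Real) ^ (393 / 200 : Real) <= Z.card ∧
      Spr (1 + 1 / Real.log T) Z := by
  obtain ⟨gg, eh⟩ := count_lower hA hC (s := 307 / 312) (by norm_num) (by norm_num at hdimA ⊢; linarith)
  have hlog : Tendsto (fun T : Nat => Real.log T) atTop atTop :=
    Real.tendsto_log_atTop.comp tendsto_natCast_atTop_atTop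
  have ev : ∀ᶠ T : Nat in atTop, gg <= T ∧ 2 * C <= T ∧ C + 1 <= T ∧ 3 <= T ∧
      5000 * Real.log T ^ 9 <= (T : Real) ^ (614 / 312 - 393 / 200 : Real) ∧ 1 <= Real.log T := by
    filter_upwards [eventually_ge_atTop gg, eventually_ge_atTop (2 * C), eventually_ge_atTop (C + 1),
      eventually_ge_atTop 3, ev_log (614 / 312 - 393 / 200 : Real) 5000 (by norm_num),
      hlog.eventually_ge_atTop 1] with T h1 h2 h3 h4 ay bb
    exact ⟨h1, h2, h3, h4, ay, bb⟩
  obtain ⟨bn, fh⟩ := eventually_atTop.1 ev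
  refine ⟨bn, fun T hT => ?_⟩
  obtain ⟨h1, h2, h3, h4, ay, bb⟩ := fh T hT
  set ℓ := Real.log T with hℓ
  have hsum := eh T h1
  set Lg := Nat.log 2 ((2 * (C * T)) ^ 2) with hLg
  have bn : (0:Real) < T := mod_cast (by omega : 0 < T)
  have hLgb : (Lg : Real) <= 8 * ℓ := by
    have bp : Lg <= Nat.log 2 (T ^ 4) := by
      apply Nat.log_mono_right
      have : 2 * (C * T) <= T ^ 2 := by nlinarith
      calc (2 * (C * T)) ^ 2 <= (T ^ 2) ^ 2 := Nat.pow_le_pow_left this 2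
        _ = T ^ 4 := by ring
    have br : (2:Real) ^ (Nat.log 2 (T ^ 4)) <= (T:Real) ^ 4 := by
      exact_mod_cast Nat.pow_log_le_self 2 (by positivity)
    have cy := Real.log_le_log (by positivity) br
    rw [Real.log_pow, Real.log_pow] at cy
    have ec : (Lg : Real) <= Nat.log 2 (T ^ 4) := mod_cast bp
    have a5 := Real.log_two_gt_d9
    have a6 : (0:Real) <= (Nat.log 2 (T ^ 4) : Real) := by positivity
    push_cast at cy
    nlinarith
  obtain ⟨n, hn, hcard⟩ : ∃ n ∈ Finset.Icc 1 Lg, (T : Real) ^ (614 / 312 : Real) / (8 * ℓ) <= ((cand A C T n).card : Real) := by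
    by_contra hcon
    push Not at hcon
    have lo : (2 * (307 / 312) : Real) = 614 / 312 := by norm_num
    rw [lo] at hsum
    have hTp : 0 < (T : Real) ^ (614 / 312 : Real) := by positivity
    rcases Nat.eq_zero_or_pos Lg with h | h
    . rw [h] at hsum; simp at hsum; linarith
    . have := sum_lt_sum_of_nonempty (nonempty_Icc.2 h) hcon
      rw [sum_const, nsmul_eq_mul, Nat.card_Icc, mul_div_assoc', Nat.add_sub_cancel] at this
      have h' := lt_of_le_of_lt hsum this
      rw [lt_div_iff₀ (by positivity)] at h'
      nlinarith
  have db : 1 <= n := (mem_Icc.1 hn).1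
  have hpos : ∀ g ∈ cand A C T n, ∀ i j, 1 <= g i j ∧ g i j <= C * T := by
    intro g hg i j
    simp only [cand, mem_filter] at hg
    have ki : 2 <= n := by
      by_contra h
      have : n = 1 := by omega
      subst this
      rw [pow_one, G, mem_image] at hg
      obtain ⟨⟨a, ha, rfl⟩, h, _⟩ := hg
      have := hC a ha
      simp at h; omega
    have := entries_pos hA ki hg.1 i j
    exact ⟨this.1, this.2.trans hg.2.2⟩
  set K : Nat := ⌊4 * ℓ ^ 2⌋₊ + 1 with hK
  have hKb : (K : Real) <= 5 * ℓ ^ 2 := by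
    rw [hK]; push_cast
    have := Nat.floor_le (show 0 <= 4 * ℓ ^ 2 by positivity)
    nlinarith
  let cls : aa -> (Fin 2 -> Fin 2 -> Nat) := fun g i j => ⌊Real.log (g i j) * (2 * ℓ)⌋₊
  let t : Finset (Fin 2 -> Fin 2 -> Nat) := Fintype.piFinset fun _ => Fintype.piFinset fun _ => range K
  have hmaps : ∀ g ∈ cand A C T n, cls g ∈ t := by
    intro g hg
    simp only [t, cls, Fintype.mem_piFinset, mem_range]
    intro i j
    rw [hK, Nat.lt_succ_iff]
    apply Nat.floor_le_floor
    obtain ⟨bk, bw⟩ := hpos g hg i j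
    have g1' : (1:Real) <= g i j := mod_cast bk
    have g2' : (g i j : Real) <= (T:Real) ^ 2 := by
      have : g i j <= (T:Int) ^ 2 := by
        refine bw.trans ?_
        have : (C:Int) <= T := by omega
        nlinarith
      exact_mod_cast this
    have := Real.log_le_log (by linarith) g2'
    rw [Real.log_pow] at this
    push_cast at this
    nlinarith
  have tcard : (t.card : Real) = (K:Real) ^ 4 := by
    simp only [t, Fintype.card_piFinset, prod_const, card_univ, Fintype.card_fin, card_range]
    push_cast; ring
  have tne : t.Nonempty := by
    rw [<- card_pos]
    have : (0:Real) < t.card := by rw [tcard]; positivity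
    exact_mod_cast this
  obtain ⟨y, hy, hyc⟩ := exists_le_card_fiber_of_nsmul_le_card_of_maps_to hmaps tne
    (b := (T : Real) ^ (393 / 200 : Real)) (by
      rw [nsmul_eq_mul, tcard]
      refine le_trans ?_ hcard
      rw [le_div_iff₀ (by positivity)]
      have e : (T : Real) ^ (614 / 312 : Real) = (T : Real) ^ (393 / 200 : Real) * (T : Real) ^ (614 / 312 - 393 / 200 : Real) := by
        rw [<- Real.rpow_add bn]; norm_num
      rw [e]
      have gc : (K:Real) ^ 4 <= (5 * ℓ ^ 2) ^ 4 := pow_le_pow_left₀ (by positivity) hKb 4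
      have : (K:Real) ^ 4 * (8 * ℓ) <= (T : Real) ^ (614 / 312 - 393 / 200 : Real) := by
        refine le_trans ?_ ay
        calc (K:Real) ^ 4 * (8 * ℓ) <= (5 * ℓ ^ 2) ^ 4 * (8 * ℓ) := by
              apply mul_le_mul_of_nonneg_right gc; positivity
          _ = _ := by ring
      calc (K:Real) ^ 4 * (T:Real) ^ (393 / 200 : Real) * (8 * ℓ) = (T:Real) ^ (393 / 200 : Real) * ((K:Real) ^ 4 * (8 * ℓ)) := by ring
        _ <= _ := mul_le_mul_of_nonneg_left this (by positivity))
  refine ⟨n, db, (cand A C T n).filter fun x => cls x = y, ?_, ?_, hyc, ?_⟩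
  . exact (filter_subset _ _).trans (filter_subset _ _)
  . intro g hg
    rw [mem_filter] at hg
    have := hg.1
    simp only [cand, mem_filter] at this
    exact this.2
  . intro g hg h hh i j
    rw [mem_filter] at hg hh
    have e : cls g i j = cls h i j := by rw [hg.2, hh.2]
    simp only [cls] at e
    have bk : (1:Real) <= g i j := mod_cast (hpos g hg.1 i j).1
    have bw : (1:Real) <= h i j := mod_cast (hpos h hh.1 i j).1
    have bl : Real.log (g i j) * (2 * ℓ) < ⌊Real.log (g i j) * (2 * ℓ)⌋₊ + 1 := Nat.lt_floor_add_one _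
    have bx : (⌊Real.log (h i j) * (2 * ℓ)⌋₊ : Real) <= Real.log (h i j) * (2 * ℓ) :=
      Nat.floor_le (mul_nonneg (Real.log_nonneg bw) (by positivity))
    rw [e] at bl
    have dp : Real.log (g i j) <= 1 / (2 * ℓ) + Real.log (h i j) := by
      have bf : 0 < 2 * ℓ := by positivity
      have : Real.log (g i j) * (2 * ℓ) <= (1 / (2 * ℓ) + Real.log (h i j)) * (2 * ℓ) := by
        rw [add_mul, one_div, inv_mul_cancel₀ bf.ne']; linarith
      exact le_of_mul_le_mul_right this bf
    have kk := Real.exp_le_exp.2 dp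
    rw [Real.exp_add, Real.exp_log (by linarith), Real.exp_log (by linarith)] at kk
    refine kk.trans (mul_le_mul_of_nonneg_right ?_ (by linarith))
    have af : 1 / (2 * ℓ) <= 1 := by rw [div_le_one (by positivity)]; linarith
    have cs : 0 <= 1 / (2 * ℓ) := by positivity
    have := Real.abs_exp_sub_one_le (x := 1 / (2 * ℓ)) (by rw [abs_of_nonneg cs]; exact af)
    rw [abs_of_nonneg cs] at this
    have h9 := (abs_le.1 this).2
    have : 2 * (1 / (2 * ℓ)) = 1 / ℓ := by field_simp
    linarith
lemma Spr.mul {r r' : Real} {U Z : Finset aa} (hr : 0 <= r) (_hr' : 0 <= r')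
    (hU : Spr r U) (hZ : Spr r' Z) (pU : ∀ g ∈ U, ∀ i j, 0 <= g i j) (pZ : ∀ g ∈ Z, ∀ i j, 0 <= g i j) :
    Spr (r * r') (U * Z) := by
  intro g hg h hh i j
  rw [Finset.mem_mul] at hg hh
  obtain ⟨a, ha, b, hb, rfl⟩ := hg
  obtain ⟨c, hc, d, hd, rfl⟩ := hh
  simp only [Matrix.mul_apply, Fin.sum_univ_two]
  push_cast
  have key : ∀ k, (a i k : Real) * b k j <= r * r' * (c i k * d k j) := by
    intro k
    have h1 := hU a ha c hc i k
    have h2 := hZ b hb d hd k j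
    have ba : (0:Real) <= b k j := mod_cast pZ b hb k j
    have cg : (0:Real) <= c i k := mod_cast pU c hc i k
    calc _ <= (r * c i k) * (r' * d k j) := mul_le_mul h1 h2 ba (by positivity)
      _ = _ := by ring
  have := key 0; have := key 1
  linarith
lemma Good.nonneg {g : aa} (hg : Good g) (i j : Fin 2) : 0 <= g i j := by
  have kl := hg.h0; have bp := hg.p01; have br := hg.p10; have cy := hg.p11
  fin_cases i <;> fin_cases j <;> simp <;> omega
structure ChainU (A : Finset Nat) (B j : Nat) (U : Finset aa) : Prop where
  sub : ∃ n, 1 <= n ∧ U ⊆ G A ^ n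
  le : ∀ g ∈ U, g 1 1 <= (B:Int) ^ (2 ^ j)
  ge : ∀ g ∈ U, 6 <= g 1 1
  card : ((B:Real) ^ (2 ^ j)) ^ (49 / 25 : Real) <= U.card
  spr : Spr (2 - (1/2) ^ (j + 1)) U
structure ChainZ (A : Finset Nat) (C B j : Nat) (Z : Finset aa) : Prop where
  sub : ∃ n, 1 <= n ∧ Z ⊆ G A ^ n
  size : ∃ T : Nat, (∀ g ∈ Z, (T : Int) <= g 1 1 ∧ g 1 1 <= C * T) ∧ T <= B ^ (2 ^ j) ∧
    B ^ (2 ^ j) <= 4 * C * T ∧ (T : Real) ^ (49 / 25 : Real) <= Z.card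
lemma rpow_shrink {k : Real} (hk : 1 <= k) : ∃ dc : Nat, ∀ b : Real, (dc : Real) <= b -> 1 <= b ∧
    b ^ (49 / 25 : Real) <= (b / k) ^ (393 / 200 : Real) := by
  have h := (tendsto_rpow_atTop (show (0:Real) < 1/200 by norm_num)).eventually_ge_atTop (k ^ (393 / 200 : Real))
  obtain ⟨dc, fi⟩ := eventually_atTop.1 (h.and (eventually_ge_atTop 1))
  refine ⟨⌈dc⌉₊, fun b hb => ?_⟩
  obtain ⟨h1, h2⟩ := fi b ((Nat.le_ceil dc).trans hb)
  refine ⟨h2, ?_⟩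
  have dc : 0 < b := by linarith
  rw [Real.div_rpow dc.le (by linarith), le_div_iff₀ (by positivity)]
  calc _ <= b ^ (49 / 25 : Real) * b ^ (1/200 : Real) := mul_le_mul_of_nonneg_left h1 (by positivity)
    _ = _ := by rw [<- Real.rpow_add dc]; norm_num
lemma chain {A : Finset Nat} (hA : PA A) {C : Nat} (ei : 1 <= C) (hC : ∀ a ∈ A, a + 1 <= C)
    (hdimA : hdim (A : Set Nat) > 1 - 5 / 312) :
    ∃ km : Nat, ∀ B : Nat, km <= B -> ∃ U Z : Nat -> Finset aa, (∀ j, ChainU A B j (U j)) ∧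
      (∀ j, ChainZ A C B j (Z j)) ∧ ∀ j, U (j + 1) = U j * Z j := by
  obtain ⟨bn, fh⟩ := pinned hA hC hdimA
  have hC' : (1:Real) <= C := mod_cast ei
  obtain ⟨dc, fi⟩ := rpow_shrink (k := 4 * C) (by linarith)
  refine ⟨dc + 4 * C * (bn + 1) + 24 * C + 12000 * C, fun B hB => ?_⟩
  have blk : ∀ b : Nat, B <= b -> ∃ T : Nat, ∃ n, 1 <= n ∧ ∃ Z ⊆ G A ^ n,
      (∀ g ∈ Z, (T : Int) <= g 1 1 ∧ g 1 1 <= C * T) ∧ 2 * C * T <= b ∧ b <= 4 * C * T ∧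
      (b : Real) ^ (49 / 25 : Real) <= Z.card ∧ Spr (1 + 1 / Real.log T) Z := by
    intro b hb
    have hmod := Nat.div_add_mod b (2 * C)
    have hml := Nat.mod_lt b (show 0 < 2 * C by omega)
    set T := b / (2 * C) with hTdef
    have fk : bn + 1 <= T := by
      rw [hTdef, Nat.le_div_iff_mul_le (by omega)]; nlinarith
    obtain ⟨n, hn, Z, hZ, h1, h2, h3⟩ := fh T (by omega)
    have lp : b <= 4 * C * T := by nlinarith
    refine ⟨T, n, hn, Z, hZ, h1, by omega, lp, ?_, h3⟩
    refine le_trans (fi b (mod_cast (by omega : dc <= b))).2 (le_trans ?_ h2)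
    apply Real.rpow_le_rpow (by positivity) _ (by norm_num)
    rw [div_le_iff₀ (by positivity)]
    have : (b:Real) <= 4 * C * T := mod_cast lp
    linarith
  have hBpow : ∀ j, B <= B ^ (2 ^ j) := fun j => Nat.le_self_pow (by positivity) B
  choose T n hn Z hZ h1 h2 h3 h4 ay using fun j => blk (B ^ (2 ^ j)) (hBpow j)
  have hCn : ∀ j, T j <= B ^ (2 ^ j) := fun j => by have := h2 j; nlinarith
  have logT : ∀ j, (2:Real) ^ j * 8 <= Real.log (T j) := by
    intro j
    have : (3000:Nat) ^ (2 ^ j) <= T j := by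
      have ab : (12000 * C) ^ (2 ^ j) <= B ^ (2 ^ j) := Nat.pow_le_pow_left (by omega) _
      rw [mul_pow] at ab
      have ac : C <= C ^ (2 ^ j) := Nat.le_self_pow (by positivity) C
      have bv : (12000:Nat) ^ (2 ^ j) = 4 ^ (2^j) * 3000 ^ (2 ^ j) := by rw [<- mul_pow]; norm_num
      have bz : 4 <= (4:Nat) ^ (2^j) := Nat.le_self_pow (by positivity) 4
      have gi := h3 j
      have : 4 * C * 3000 ^ (2 ^ j) <= 4 * C * T j := by
        refine le_trans ?_ (ab.trans gi)
        rw [bv]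
        calc 4 * C * 3000 ^ (2 ^ j) = (4 * 3000 ^ (2 ^ j)) * C := by ring
          _ <= _ := Nat.mul_le_mul (Nat.mul_le_mul bz le_rfl) ac
      exact Nat.le_of_mul_le_mul_left this (by omega)
    have h3000 : (8:Real) <= Real.log 3000 := by
      rw [Real.le_log_iff_exp_le (by norm_num)]
      have := Real.exp_one_lt_d9
      calc Real.exp 8 = Real.exp 1 ^ 8 := by rw [<- Real.exp_nat_mul]; norm_num
        _ <= 2.7182818286 ^ 8 := pow_le_pow_left₀ (Real.exp_pos 1).le this.le 8
        _ <= 3000 := by norm_num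
    have h := Real.log_le_log (by positivity) (show ((3000:Real)) ^ (2 ^ j) <= T j by exact_mod_cast this)
    rw [Real.log_pow] at h
    push_cast at h
    have : (0:Real) < 2 ^ j := by positivity
    nlinarith
  have hZZ : ∀ j, ChainZ A C B j (Z j) := fun j => ⟨⟨n j, hn j, hZ j⟩, T j, h1 j, hCn j, h3 j, by
    refine le_trans ?_ (h4 j)
    apply Real.rpow_le_rpow (by positivity) _ (by norm_num)
    exact_mod_cast hCn j⟩
  let U : Nat -> Finset aa := fun j => Nat.rec (Z 0) (fun j U => U * Z j) j
  have lr : U 0 = Z 0 := rfl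
  have US : ∀ j, U (j + 1) = U j * Z j := fun j => rfl
  refine ⟨U, Z, fun j => ?_, hZZ, US⟩
  have ls : ∀ j, (1:Real) / Real.log (T j) <= 1 / (2 ^ j * 8) := fun j =>
    one_div_le_one_div_of_le (by positivity) (logT j)
  induction j with
  | zero =>
    refine ⟨⟨n 0, hn 0, hZ 0⟩, ?_, ?_, ?_, ?_⟩
    . intro g hg
      refine (h1 0 g hg).2.trans ?_
      have := h2 0
      exact_mod_cast (by nlinarith : C * T 0 <= B ^ (2 ^ 0))
    . intro g hg
      refine le_trans ?_ (h1 0 g hg).1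
      have e := h3 0
      have : 6 <= T 0 := by
        by_contra hcon
        have : T 0 <= 5 := by omega
        have ab : B <= 4 * C * 5 := by
          refine (hBpow 0).trans (e.trans ?_); exact Nat.mul_le_mul le_rfl this
        omega
      exact_mod_cast this
    . have := h4 0; rw [lr]; exact_mod_cast this
    . rw [lr]
      intro g hg h hh i j
      refine (ay 0 g hg h hh i j).trans (le_of_le_of_eq ?_ rfl)
      have p : (0:Real) <= h i j := mod_cast (good_pow hA (hn 0) (hZ 0 hh)).nonneg i j
      apply mul_le_mul_of_nonneg_right _ p
      have q := ls 0
      norm_num at q ⊢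
      linarith
  | succ j ih =>
    obtain ⟨⟨m, hm, hsub⟩, ile, ige, icard, ispr⟩ := ih
    have hbb : (B:Int) ^ (2 ^ (j+1)) = B ^ (2^j) * B ^ (2^j) := by rw [<- pow_add]; congr 1; ring
    have hbr : (B:Real) ^ (2 ^ (j+1)) = B ^ (2^j) * B ^ (2^j) := by rw [<- pow_add]; congr 1; ring
    rw [US]
    refine ⟨⟨m + n j, by omega, by rw [pow_add]; exact mul_subset_mul hsub (hZ j)⟩, ?_, ?_, ?_, ?_⟩
    . intro g hg
      rw [Finset.mem_mul] at hg
      obtain ⟨a, ha, b, hb, rfl⟩ := hg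
      have ga := good_pow hA hm (hsub ha)
      have gb := good_pow hA (hn j) (hZ j hb)
      rw [ao, hbb]
      have ab := ile a ha; have ac := (h1 j b hb).2
      have bv : 2 * (C:Int) * T j <= B ^ (2^j) := mod_cast h2 j
      have := ga.h4; have := gb.h2; have := ga.p10; have := gb.p01; have := gb.p11; have := ga.p11
      have bz : 2 * b 1 1 <= B ^ (2^j) := by linarith
      calc a 1 0 * b 0 1 + a 1 1 * b 1 1 <= a 1 1 * b 1 1 + a 1 1 * b 1 1 := by nlinarith
        _ = a 1 1 * (2 * b 1 1) := by ring
        _ <= _ := mul_le_mul ab bz (by linarith) (by positivity)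
    . intro g hg
      rw [Finset.mem_mul] at hg
      obtain ⟨a, ha, b, hb, rfl⟩ := hg
      have ga := good_pow hA hm (hsub ha)
      have gb := good_pow hA (hn j) (hZ j hb)
      rw [ao]
      have := ige a ha; have := ga.p10; have := gb.p01; have := gb.p11
      nlinarith
    . rw [card_mul_eq hA hsub (hZ j), hbr, Real.mul_rpow (by positivity) (by positivity)]
      push_cast
      refine mul_le_mul icard ?_ (by positivity) (by positivity)
      have := h4 j; exact_mod_cast this
    . have ba : ∀ g ∈ U j, ∀ i k, 0 <= g i k := fun g hg => (good_pow hA hm (hsub hg)).nonneg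
      have cg : ∀ g ∈ Z j, ∀ i k, 0 <= g i k := fun g hg => (good_pow hA (hn j) (hZ j hg)).nonneg
      have hl : 0 < Real.log (T j) := lt_of_lt_of_le (by positivity) (logT j)
      have hpw : (1/2:Real) ^ (j+1) <= 1 := pow_le_one₀ (by norm_num) (by norm_num)
      have S := Spr.mul (by linarith) (by positivity) ispr (ay j) ba cg
      intro g hg h hh i k
      refine (S g hg h hh i k).trans ?_
      have p : (0:Real) <= h i k := by
        rw [Finset.mem_mul] at hh
        obtain ⟨a, ha, b, hb, rfl⟩ := hh
        exact_mod_cast ((good_pow hA hm (hsub ha)).mul (good_pow hA (hn j) (hZ j hb))).nonneg i k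
      apply mul_le_mul_of_nonneg_right _ p
      have q := ls j
      have fl : (1:Real) / (2 ^ j * 8) = (1/2)^(j+1) / 4 := by rw [div_pow, one_pow, pow_succ]; field_simp; norm_num
      rw [fl] at q
      set y := (1/2:Real) ^ (j+1) with hy
      have au : 0 < y := by positivity
      rw [pow_succ (1/2:Real) (j+1), <- hy]
      have : (2 - y) * (1 + 1 / Real.log (T j)) <= (2 - y) * (1 + y / 4) := by
        apply mul_le_mul_of_nonneg_left _ (by linarith); linarith
      nlinarith
end ZD
namespace ZD
open scoped Pointwise
open Finset
lemma psi_conj {P : Nat} [NeZero P] (a : ZMod P) : (starRingEnd Complex) (ZMod.stdAddChar a) = ZMod.stdAddChar (-a) := by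
  exact (AddChar.map_neg_eq_conj _ _).symm
lemma psi_sum {P : Nat} [NeZero P] (b : ZMod P) :
    ∑ x : ZMod P, (ZMod.stdAddChar (b * x) : Complex) = if b = 0 then (P : Complex) else 0 := by
  have := AddChar.sum_mulShift b (ZMod.isPrimitive_stdAddChar P)
  simp only [ZMod.card] at this
  rw [<- (by push_cast; rfl : (((if b = 0 then P else 0 : Nat)) : Complex) = if b = 0 then (P : Complex) else 0)] 
  rw [<- this]
  simp_rw [mul_comm]
lemma psi_sum2 {P : Nat} [NeZero P] (b : ZMod P × ZMod P) :
    ∑ y : ZMod P × ZMod P, (ZMod.stdAddChar (b.1 * y.1 + b.2 * y.2) : Complex) = if b = 0 then (P : Complex) ^ 2 else 0 := by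
  simp_rw [AddChar.map_add_eq_mul]
  rw [Fintype.sum_prod_type]
  simp_rw [<- mul_sum, <- sum_mul, psi_sum]
  rcases b with ⟨bl, bx⟩
  by_cases h1 : bl = 0 <;> by_cases h2 : bx = 0 <;> simp [h1, h2, sq]
lemma parseval2 {P : Nat} [NeZero P] (b : ZMod P × ZMod P -> Complex) :
    ∑ y : ZMod P × ZMod P, ‖∑ w, b w * ZMod.stdAddChar (w.1 * y.1 + w.2 * y.2)‖ ^ 2
      = (P : Real) ^ 2 * ∑ w, ‖b w‖ ^ 2 := by
  have key : ((∑ y : ZMod P × ZMod P, ‖∑ w, b w * ZMod.stdAddChar (w.1 * y.1 + w.2 * y.2)‖ ^ 2 : Real) : Complex)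
      = (((P : Real) ^ 2 * ∑ w, ‖b w‖ ^ 2 : Real) : Complex) := by
    push_cast
    have ab : ∀ y : ZMod P × ZMod P,
        ((‖∑ w, b w * ZMod.stdAddChar (w.1 * y.1 + w.2 * y.2)‖ : Complex)) ^ 2
        = ∑ w, ∑ w', b w * (starRingEnd Complex) (b w') *
            ZMod.stdAddChar ((w - w').1 * y.1 + (w - w').2 * y.2) := by
      intro y
      rw [<- Complex.mul_conj', map_sum, sum_mul_sum]
      refine sum_congr rfl fun w _ => sum_congr rfl fun w' _ => ?_
      rw [map_mul, psi_conj, mul_mul_mul_comm, <- AddChar.map_add_eq_mul]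
      congr 2
      simp; ring
    simp_rw [ab]
    rw [sum_comm]
    rw [mul_sum]
    refine sum_congr rfl fun w _ => ?_
    rw [sum_comm]
    simp_rw [<- mul_sum, psi_sum2, sub_eq_zero, mul_ite, mul_zero]
    rw [sum_ite_eq univ w]
    simp only [mem_univ, if_true]
    rw [Complex.mul_conj', mul_comm]
  exact_mod_cast key
lemma parseval_fib {P : Nat} [NeZero P] {τ : Type*} (Ξ : Finset τ) (u : τ -> ZMod P × ZMod P)
    (a : τ -> Complex) (Bf : Real) (h : ∀ w, ((Ξ.filter (fun ξ => u ξ = w)).card : Real) <= Bf) :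
    ∑ y : ZMod P × ZMod P, ‖∑ ξ ∈ Ξ, a ξ * ZMod.stdAddChar ((u ξ).1 * y.1 + (u ξ).2 * y.2)‖ ^ 2
      <= (P : Real) ^ 2 * (Bf * ∑ ξ ∈ Ξ, ‖a ξ‖ ^ 2) := by
  classical
  have e : ∀ y : ZMod P × ZMod P, ∑ ξ ∈ Ξ, a ξ * ZMod.stdAddChar ((u ξ).1 * y.1 + (u ξ).2 * y.2)
      = ∑ w, (∑ ξ ∈ Ξ.filter (fun ξ => u ξ = w), a ξ) * ZMod.stdAddChar (w.1 * y.1 + w.2 * y.2) := by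
    intro y
    rw [<- sum_fiberwise Ξ u]
    refine sum_congr rfl fun w _ => ?_
    rw [sum_mul]
    refine sum_congr rfl fun ξ hξ => ?_
    rw [(mem_filter.1 hξ).2]
  simp_rw [e]
  rw [parseval2]
  gcongr
  rw [<- sum_fiberwise Ξ u, mul_sum]
  refine sum_le_sum fun w _ => ?_
  calc ‖∑ ξ ∈ Ξ.filter (fun ξ => u ξ = w), a ξ‖ ^ 2
      <= (∑ ξ ∈ Ξ.filter (fun ξ => u ξ = w), ‖a ξ‖) ^ 2 := by gcongr; exact norm_sum_le _ _
    _ <= _ := sq_sum_le_card_mul_sum_sq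
    _ <= _ := by gcongr; exact h w
lemma D_lower {P : Nat} [NeZero P] {n : Nat} {M : Int} (hP : 6 * n * M <= P) (y : Int) (h0 : 0 <= y) (h1 : y <= M) :
    (n : Real) / 2 <= ‖∑ s ∈ range n, (ZMod.stdAddChar ((s : ZMod P) * (y : ZMod P)) : Complex)‖ := by
  refine le_trans ?_ (Complex.re_le_norm _)
  rw [Complex.re_sum]
  have : (n : Real) / 2 = ∑ s ∈ range n, (1 / 2 : Real) := by simp; ring
  rw [this]
  refine sum_le_sum fun s hs => ?_
  rw [mem_range] at hs
  have e : ((s : ZMod P) * (y : ZMod P)) = (((s : Int) * y : Int) : ZMod P) := by push_cast; rfl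
  have ek : (0 : Real) < P := mod_cast Nat.pos_of_ne_zero (NeZero.ne P)
  rw [e, ZMod.stdAddChar_coe]
  have ac : (2 * (Real.pi : Complex) * Complex.I * (((s : Int) * y : Int) : Complex) / (P : Complex))
      = ((2 * Real.pi * (s * y) / P : Real) : Complex) * Complex.I := by push_cast; ring
  rw [ac, Complex.exp_ofReal_mul_I_re, <- Real.cos_pi_div_three]
  have hb : (6 * s * y : Real) <= P := by
    have : (6 * s * y : Int) <= P := by
      calc (6 * s * y : Int) <= 6 * n * M := by gcongr
        _ <= P := hP
    exact_mod_cast this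
  have hy : (0:Real) <= y := mod_cast h0
  apply Real.cos_le_cos_of_nonneg_of_le_pi
  . positivity
  . have := Real.pi_pos; linarith
  . rw [div_le_iff₀ ek]
    have := Real.pi_pos
    nlinarith
set_option maxHeartbeats 1000000 in
lemma lemA {P : Nat} [NeZero P] {ι κ : Type*} (X : Finset ι) (af ag : ι -> Int) (Y : Finset κ)
    (bc be : κ -> Int) (hinj : ∀ i ∈ Y, ∀ j ∈ Y, bc i = bc j -> be i = be j -> i = j) (M : Int)
    (fm : 1 <= M)
    (hy : ∀ j ∈ Y, 0 <= bc j ∧ bc j <= M ∧ 0 <= be j ∧ be j <= M) (n : Nat) (hn : 1 <= n)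
    (hP : 6 * n * M <= P) (K : Finset (ZMod P)) (Bf : Real)
    (hf : ∀ w : ZMod P × ZMod P, (((X ×ˢ K ×ˢ range n ×ˢ range n).filter (fun ξ =>
      (ξ.2.1 * (af ξ.1 : ZMod P) + (ξ.2.2.1 : ZMod P), ξ.2.1 * (ag ξ.1 : ZMod P) + (ξ.2.2.2 : ZMod P)) = w)).card : Real) <= Bf) :
    ∑ k ∈ K, ‖∑ i ∈ X, ∑ j ∈ Y, (ZMod.stdAddChar (k * ((af i * bc j + ag i * be j : Int) : ZMod P)) : Complex)‖ ^ 2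
      <= 16 * ((P : Real) / n) ^ 2 * Bf * X.card * Y.card := by
  classical
  set S : ZMod P -> Complex := fun k => ∑ i ∈ X, ∑ j ∈ Y, (ZMod.stdAddChar (k * ((af i * bc j + ag i * be j : Int) : ZMod P)) : Complex) with hS
  set E : Real := ∑ k ∈ K, ‖S k‖ ^ 2 with hE
  have kn : 0 <= E := sum_nonneg fun _ _ => by positivity
  set Gf : ZMod P × ZMod P -> Complex := fun y => ∑ i ∈ X, ∑ k ∈ K, (starRingEnd Complex) (S k) *
    ZMod.stdAddChar (k * ((af i : ZMod P) * y.1 + (ag i : ZMod P) * y.2)) with hG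
  set D : ZMod P -> Complex := fun y => ∑ s ∈ range n, (ZMod.stdAddChar ((s : ZMod P) * y) : Complex) with hD
  have hn0 : (0 : Real) < n := mod_cast hn
  have ek : (0 : Real) < P := mod_cast Nat.pos_of_ne_zero (NeZero.ne P)
  let yv : κ -> ZMod P × ZMod P := fun j => ((bc j : ZMod P), (be j : ZMod P))
  have ab : (E : Complex) = ∑ j ∈ Y, Gf (yv j) := by
    simp only [hE, hG, yv]
    push_cast
    rw [sum_comm]
    have : ∀ i ∈ X, ∑ j ∈ Y, ∑ k ∈ K, (starRingEnd Complex) (S k) *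
      (ZMod.stdAddChar (k * ((af i : ZMod P) * (bc j : ZMod P) + (ag i : ZMod P) * (be j : ZMod P))) : Complex) =
      ∑ k ∈ K, ∑ j ∈ Y, (starRingEnd Complex) (S k) *
      (ZMod.stdAddChar (k * ((af i : ZMod P) * (bc j : ZMod P) + (ag i : ZMod P) * (be j : ZMod P))) : Complex) :=
      fun i _ => sum_comm
    rw [sum_congr rfl this, sum_comm]
    refine sum_congr rfl fun k _ => ?_
    rw [<- Complex.conj_mul']
    simp_rw [<- mul_sum]
    congr 1
    simp only [hS]
    push_cast
    rfl
  have ac : E <= ∑ j ∈ Y, ‖Gf (yv j)‖ := by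
    calc E = ‖(E : Complex)‖ := by rw [Complex.norm_real, Real.norm_of_nonneg kn]
      _ <= _ := by rw [ab]; exact norm_sum_le _ _
  have bv : E ^ 2 <= Y.card * ∑ j ∈ Y, ‖Gf (yv j)‖ ^ 2 :=
    (pow_le_pow_left₀ kn ac 2).trans sq_sum_le_card_mul_sum_sq
  have bz : ∀ j ∈ Y, ‖Gf (yv j)‖ ^ 2 <= 16 / (n : Real) ^ 4 * ‖Gf (yv j) * D (yv j).1 * D (yv j).2‖ ^ 2 := by
    intro j hj
    obtain ⟨a, b, c, d⟩ := hy j hj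
    have dd := D_lower (P := P) hP (bc j) a b
    have de := D_lower (P := P) hP (be j) c d
    change (n : Real) / 2 <= ‖D (yv j).1‖ at dd
    change (n : Real) / 2 <= ‖D (yv j).2‖ at de
    rw [norm_mul, norm_mul, mul_pow, mul_pow]
    have gk : (n : Real) ^ 2 / 4 <= ‖D (yv j).1‖ ^ 2 := by nlinarith
    have gl : (n : Real) ^ 2 / 4 <= ‖D (yv j).2‖ ^ 2 := by nlinarith
    have fn : (n : Real) ^ 4 / 16 <= ‖D (yv j).1‖ ^ 2 * ‖D (yv j).2‖ ^ 2 := by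
      calc (n : Real) ^ 4 / 16 = (n ^ 2 / 4) * (n ^ 2 / 4) := by ring
        _ <= _ := by gcongr
    rw [div_mul_eq_mul_div, le_div_iff₀ (by positivity)]
    nlinarith [sq_nonneg ‖Gf (yv j)‖]
  have yinj : ∀ i ∈ Y, ∀ j ∈ Y, yv i = yv j -> i = j := by
    intro i hi j hj h
    have hMP : M < P := by nlinarith
    obtain ⟨a, b, c, d⟩ := hy j hj
    obtain ⟨a', b', c', d'⟩ := hy i hi
    simp only [yv, Prod.mk.injEq, ZMod.intCast_eq_intCast_iff] at h
    refine hinj i hi j hj ?_ ?_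
    . have := h.1; unfold Int.ModEq at this
      rwa [Int.emod_eq_of_lt a' (by omega), Int.emod_eq_of_lt a (by omega)] at this
    . have := h.2; unfold Int.ModEq at this
      rwa [Int.emod_eq_of_lt c' (by omega), Int.emod_eq_of_lt c (by omega)] at this
  have gi : ∑ j ∈ Y, ‖Gf (yv j) * D (yv j).1 * D (yv j).2‖ ^ 2 <=
      ∑ y : ZMod P × ZMod P, ‖Gf y * D y.1 * D y.2‖ ^ 2 := by
    have := sum_image (s := Y) (g := yv) (f := fun y : ZMod P × ZMod P => ‖Gf y * D y.1 * D y.2‖ ^ 2) yinj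
    rw [<- this]
    exact sum_le_sum_of_subset_of_nonneg (subset_univ _) fun _ _ _ => by positivity
  have ko : ∀ y : ZMod P × ZMod P, Gf y * D y.1 * D y.2 =
      ∑ ξ ∈ X ×ˢ K ×ˢ range n ×ˢ range n, (starRingEnd Complex) (S ξ.2.1) *
       ZMod.stdAddChar ((ξ.2.1 * (af ξ.1 : ZMod P) + (ξ.2.2.1 : ZMod P)) * y.1 +
        (ξ.2.1 * (ag ξ.1 : ZMod P) + (ξ.2.2.2 : ZMod P)) * y.2) := by
    intro y
    simp only [hG, hD, sum_product]
    rw [sum_mul, sum_mul]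
    refine sum_congr rfl fun i _ => ?_
    rw [sum_mul, sum_mul]
    refine sum_congr rfl fun k _ => ?_
    rw [mul_assoc, sum_mul_sum, mul_sum]
    refine sum_congr rfl fun s _ => ?_
    rw [mul_sum]
    refine sum_congr rfl fun t _ => ?_
    rw [mul_assoc, <- AddChar.map_add_eq_mul, <- AddChar.map_add_eq_mul]
    congr 2
    ring
  have e7 : ∑ y : ZMod P × ZMod P, ‖Gf y * D y.1 * D y.2‖ ^ 2 <=
      (P : Real) ^ 2 * (Bf * (X.card * (n ^ 2 * E))) := by
    simp_rw [ko]
    have := parseval_fib (X ×ˢ K ×ˢ range n ×ˢ range n) (fun ξ =>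
      (ξ.2.1 * (af ξ.1 : ZMod P) + (ξ.2.2.1 : ZMod P), ξ.2.1 * (ag ξ.1 : ZMod P) + (ξ.2.2.2 : ZMod P)))
      (fun ξ => (starRingEnd Complex) (S ξ.2.1)) Bf hf
    refine this.trans (le_of_eq ?_)
    congr 2
    simp only [sum_product, sum_const, card_product, card_range, RCLike.norm_conj]
    rw [<- smul_sum]
    simp only [nsmul_eq_mul, hE]
    push_cast; ring
  by_cases hEz : E = 0
  . rw [hEz]
    have : 0 <= Bf := le_trans (Nat.cast_nonneg _) (hf 0)
    exact mul_nonneg (mul_nonneg (mul_nonneg (by positivity) this) (Nat.cast_nonneg _)) (Nat.cast_nonneg _)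
  have hEp : 0 < E := lt_of_le_of_ne kn (Ne.symm hEz)
  have lu : E ^ 2 <= Y.card * (16 / (n : Real) ^ 4 * ((P : Real) ^ 2 * (Bf * (X.card * (n ^ 2 * E))))) := by
    refine bv.trans (mul_le_mul_of_nonneg_left ?_ (Nat.cast_nonneg _))
    refine (sum_le_sum bz).trans ?_
    rw [<- mul_sum]
    gcongr
    exact gi.trans e7
  have kh : Y.card * (16 / (n : Real) ^ 4 * ((P : Real) ^ 2 * (Bf * (X.card * (n ^ 2 * E))))) =
    (16 * ((P : Real) / n) ^ 2 * Bf * X.card * Y.card) * E := by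
    have : ∀ a b c d f : Real, a * (16 / (n:Real) ^ 4 * (b ^ 2 * (c * (d * (n ^ 2 * f))))) = 
      (16 * (b / n) ^ 2 * c * d * a) * f := by
      intro a b c d f
      field_simp
    exact this _ _ _ _ _
  rw [kh, sq] at lu
  exact le_of_mul_le_mul_right lu hEp
lemma sieve {P : Nat} [NeZero P] {ι κ : Type*} (X : Finset ι) (af ag : ι -> Int) (Y : Finset κ)
    (bc be : κ -> Int) (hinj : ∀ i ∈ Y, ∀ j ∈ Y, bc i = bc j -> be i = be j -> i = j) (M : Int)
    (fm : 1 <= M)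
    (hy : ∀ j ∈ Y, 0 <= bc j ∧ bc j <= M ∧ 0 <= be j ∧ be j <= M) 
    (hP : 6 * M <= P) (K : Finset (ZMod P)) (Bf : Real) (el : 0 <= Bf)
    (hf : ∀ n : Nat, 1 <= n -> 6 * n * M <= P -> ∀ ad ∈ X, ∀ an ∈ K, ∀ Q : Finset (ι × ZMod P),
      (∀ p ∈ Q, p.1 ∈ X ∧ p.2 ∈ K ∧ ∃ am ak : Int, |am| <= n ∧ |ak| <= n ∧
        p.2 * (af p.1 : ZMod P) = an * (af ad : ZMod P) + am ∧
        p.2 * (ag p.1 : ZMod P) = an * (ag ad : ZMod P) + ak) -> (Q.card : Real) <= Bf) :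
    ∑ k ∈ K, ‖∑ i ∈ X, ∑ j ∈ Y, (ZMod.stdAddChar (k * ((af i * bc j + ag i * be j : Int) : ZMod P)) : Complex)‖ ^ 2
      <= 2304 * (M : Real) ^ 2 * Bf * X.card * Y.card := by
  classical
  obtain ⟨m, rfl⟩ : ∃ m : Nat, M = m := ⟨M.toNat, by omega⟩
  have dr : 1 <= m := mod_cast fm
  have hP' : 6 * m <= P := mod_cast hP
  set n : Nat := P / (6 * m) with hn
  have db : 1 <= n := (Nat.one_le_div_iff (by omega)).2 hP'
  have hnP : n * (6 * m) <= P := Nat.div_mul_le_self _ _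
  have lv : 6 * (n : Int) * (m : Int) <= P := by
    have : 6 * n * m <= P := by nlinarith
    exact_mod_cast this
  have hPn : P < (n + 1) * (6 * m) := by
    rw [mul_comm]; exact Nat.lt_mul_div_succ P (by omega)
  have hnP3 : n <= P := by nlinarith
  have key := lemA X af ag Y bc be hinj m fm hy n db lv K Bf ?_
  . refine key.trans ?_
    have gh : (P : Real) / n <= 12 * m := by
      rw [div_le_iff₀ (mod_cast db)]
      have : P <= 12 * m * n := by nlinarith
      exact_mod_cast this
    calc 16 * ((P : Real) / n) ^ 2 * Bf * X.card * Y.card <= 16 * (12 * m) ^ 2 * Bf * X.card * Y.card := by gcongr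
      _ = _ := by push_cast; ring
  intro w
  set Fb := (X ×ˢ K ×ˢ range n ×ˢ range n).filter (fun ξ =>
      (ξ.2.1 * (af ξ.1 : ZMod P) + (ξ.2.2.1 : ZMod P), ξ.2.1 * (ag ξ.1 : ZMod P) + (ξ.2.2.2 : ZMod P)) = w) with hFb
  rcases Fb.eq_empty_or_nonempty with he | ⟨gn, h0⟩
  . rw [he]; simpa using el
  have hmem : ∀ ξ ∈ Fb, ξ.1 ∈ X ∧ ξ.2.1 ∈ K ∧ ξ.2.2.1 < n ∧ ξ.2.2.2 < n ∧
      ξ.2.1 * (af ξ.1 : ZMod P) + (ξ.2.2.1 : ZMod P) = w.1 ∧ ξ.2.1 * (ag ξ.1 : ZMod P) + (ξ.2.2.2 : ZMod P) = w.2 := by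
    intro ξ hξ
    simp only [hFb, mem_filter, mem_product, mem_range, Prod.ext_iff] at hξ
    tauto
  have hcast : ∀ s t : Nat, s < n -> t < n -> (s : ZMod P) = (t : ZMod P) -> s = t := by
    intro s t hs ht h
    rw [ZMod.natCast_eq_natCast_iff'] at h
    rwa [Nat.mod_eq_of_lt (by omega), Nat.mod_eq_of_lt (by omega)] at h
  have hcard : Fb.card = (Fb.image (fun ξ => (ξ.1, ξ.2.1))).card := by
    rw [card_image_of_injOn]
    rintro ⟨i, k, s, t⟩ h ⟨i', k', s', t'⟩ h' hh
    simp only [Prod.mk.injEq] at hh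
    obtain ⟨rfl, rfl⟩ := hh
    obtain ⟨-, -, a, b, c, d⟩ := hmem _ h
    obtain ⟨-, -, a', b', c', d'⟩ := hmem _ h'
    simp only at a b c d a' b' c' d'
    rw [<- c'] at c; rw [<- d'] at d
    rw [hcast _ _ a a' (by simpa using c), hcast _ _ b b' (by simpa using d)]
  rw [hcard]
  obtain ⟨ba, cg, ex, go, kp, p6⟩ := hmem _ h0
  refine hf n db lv gn.1 ba gn.2.1 cg _ ?_
  intro p hp
  obtain ⟨ξ, hξ, rfl⟩ := mem_image.1 hp
  obtain ⟨kr, fl, q3, q4, q5, q6⟩ := hmem _ hξ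
  refine ⟨kr, fl, (gn.2.2.1 : Int) - ξ.2.2.1, (gn.2.2.2 : Int) - ξ.2.2.2, ?_, ?_, ?_, ?_⟩
  . rw [abs_le]; omega
  . rw [abs_le]; omega
  . push_cast; linear_combination q5 - kp
  . push_cast; linear_combination q6 - p6
end ZD
namespace ZD
open scoped Pointwise
open Finset
lemma ksmall {P : Nat} [NeZero P] (Q : Finset (ZMod P)) (dw : Nat)
    (h : ∀ k ∈ Q, ∀ k' ∈ Q, ∃ m : Int, |m| <= dw ∧ k = k' + m) : Q.card <= 2 * dw + 1 := by
  classical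
  rcases Q.eq_empty_or_nonempty with rfl | ⟨k', hk'⟩
  . simp
  have : Q ⊆ (Finset.Icc (-(dw : Int)) dw).image (fun m : Int => k' + (m : ZMod P)) := by
    intro k hk
    obtain ⟨m, hm, rfl⟩ := h k hk k' hk'
    exact mem_image.2 ⟨m, mem_Icc.2 (abs_le.1 hm), rfl⟩
  refine (card_le_card this).trans (card_image_le.trans ?_)
  simp; omega
lemma spaced {τ : Type*} (s : Finset τ) (f : τ -> Real) (δ : Real) (hδ : 0 < δ)
    (hsep : ∀ a ∈ s, ∀ b ∈ s, a ≠ b -> δ <= |f a - f b|) (z w : Real) (hw : 0 <= w) (h : ∀ a ∈ s, |f a - z| <= w) :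
    (s.card : Real) <= 2 * w / δ + 1 := by
  classical
  set φ : τ -> Int := fun a => ⌊(f a - z + w) / δ⌋ with hφ
  have hinj : Set.InjOn φ s := by
    intro a ha b hb hab
    by_contra hne
    have h1 := hsep a ha b hb hne
    have h2 := Int.abs_sub_lt_one_of_floor_eq_floor hab
    rw [<- sub_div, abs_div, abs_of_pos hδ, div_lt_one hδ] at h2
    have : f a - z + w - (f b - z + w) = f a - f b := by ring
    rw [this] at h2
    linarith
  have hsub : s.image φ ⊆ Finset.Icc 0 ⌊2 * w / δ⌋ := by
    intro m hm
    obtain ⟨a, ha, rfl⟩ := mem_image.1 hm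
    have := abs_le.1 (h a ha)
    rw [mem_Icc]
    constructor
    . apply Int.floor_nonneg.2; apply div_nonneg _ hδ.le; linarith
    . apply Int.floor_le_floor; gcongr; linarith
  have hc := card_le_card hsub
  rw [card_image_of_injOn hinj, Int.card_Icc] at hc
  have hfl : 0 <= ⌊2 * w / δ⌋ := Int.floor_nonneg.2 (by positivity)
  have : (s.card : Int) <= ⌊2 * w / δ⌋ + 1 := by omega
  have h3 : (s.card : Real) <= (⌊2 * w / δ⌋ : Real) + 1 := mod_cast this
  linarith [Int.floor_le (2 * w / δ)]
lemma Good.cop {g : aa} (h : Good g) : IsCoprime (g 1 0) (g 1 1) := by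
  have := h.hd
  have h1 : (g 0 0 * g 1 1 - g 0 1 * g 1 0) * (g 0 0 * g 1 1 - g 0 1 * g 1 0) = 1 := by rw [<- sq]; exact this
  refine ⟨-(g 0 1) * (g 0 0 * g 1 1 - g 0 1 * g 1 0), g 0 0 * (g 0 0 * g 1 1 - g 0 1 * g 1 0), ?_⟩
  linear_combination h1
def InM (P : Nat) (H : Int) (k : ZMod P) : Prop := ∃ q r : Int, 1 <= q ∧ q <= H ∧ |r| <= H ∧ (q : ZMod P) * k = r
lemma InM.red {P : Nat} {H : Int} {k : ZMod P} (h : InM P H k) (κ : Int) (hκ : (κ : ZMod P) = k) :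
    ∃ q a r : Int, 1 <= q ∧ q <= H ∧ |r| <= H ∧ q * κ = a * P + r ∧ IsCoprime q a := by
  obtain ⟨q, r, h1, h2, h3, h4⟩ := h
  rw [<- hκ] at h4
  have : ((q * κ : Int) : ZMod P) = ((r : Int) : ZMod P) := by push_cast; exact h4
  rw [ZMod.intCast_eq_intCast_iff_dvd_sub] at this
  obtain ⟨a, ha⟩ := this
  have hg : 0 < Int.gcd q a := Int.gcd_pos_of_ne_zero_left _ (by omega)
  obtain ⟨q', hq'⟩ := Int.gcd_dvd_left (a := q) (b := a)
  obtain ⟨a', ha'⟩ := Int.gcd_dvd_right (a := q) (b := a)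
  set g : Int := (Int.gcd q a : Int) with hgdef
  have hg' : 1 <= g := by omega
  have dy : 1 <= q' := by nlinarith
  have hr : r = g * (P * a' + q' * κ) := by
    have : r = P * a + q * κ := by linarith
    rw [this, hq', ha']; ring
  refine ⟨q', -a', P * a' + q' * κ, dy, ?_, ?_, by ring, ?_⟩
  . nlinarith
  . rw [hr, abs_mul, abs_of_pos (by omega : 0 < g)] at h3
    nlinarith [abs_nonneg (P * a' + q' * κ)]
  . rw [IsCoprime.neg_right_iff]
    have e := Int.gcd_eq_gcd_ab q a
    refine ⟨Int.gcdA q a, Int.gcdB q a, ?_⟩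
    have : g * (Int.gcdA q a * q' + Int.gcdB q a * a') = g * 1 := by
      have e' : g = q * Int.gcdA q a + a * Int.gcdB q a := e
      calc g * (Int.gcdA q a * q' + Int.gcdB q a * a') = (g * q') * Int.gcdA q a + (g * a') * Int.gcdB q a := by ring
        _ = q * Int.gcdA q a + a * Int.gcdB q a := by rw [<- hq', <- ha']
        _ = g * 1 := by rw [<- e']; ring
    exact mul_left_cancel₀ (by omega) this
lemma cop_dvd {q s af ag : Int} (hx : IsCoprime af ag) (h1 : q ∣ s * af) (h2 : q ∣ s * ag) : q ∣ s := by
  obtain ⟨u, v, huv⟩ := hx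
  have : s = u * (s * af) + v * (s * ag) := by linear_combination (-s) * huv
  rw [this]
  exact dvd_add (h1.mul_left _) (h2.mul_left _)
lemma arcs {P : Int} (hP : 0 < P) {q a r κ q' a' r' κ' af ag x1' x2' am ak cf cp : Int}
    (hq : 1 <= q) (hq' : 1 <= q') (e : q * κ = a * P + r) (e' : q' * κ' = a' * P + r')
    (ca : IsCoprime q a) (ca' : IsCoprime q' a') (cx : IsCoprime af ag) (cx' : IsCoprime x1' x2')
    (av : κ' * x1' = κ * af + am + P * cf) (ap : κ' * x2' = κ * ag + ak + P * cp)
    (bl : |q * q' * am + q' * r * af - q * r' * x1'| < P)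
    (bx : |q * q' * ak + q' * r * ag - q * r' * x2'| < P) :
    q = q' ∧ r' * x1' = r * af + q * am ∧ r' * x2' = r * ag + q * ak ∧ q ∣ a' * x1' - a * af ∧ q ∣ a' * x2' - a * ag := by
  have z : ∀ y y' σ l : Int, κ' * y' = κ * y + σ + P * l -> |q * q' * σ + q' * r * y - q * r' * y'| < P ->
      q * q' * σ + q' * r * y - q * r' * y' = 0 ∧ q * a' * y' - q' * a * y = q * q' * l := by
    intro y y' σ l h hb
    have h1 : q * q' * σ + q' * r * y - q * r' * y' = P * (q * a' * y' - q' * a * y - q * q' * l) := by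
      linear_combination (-q * q') * h + (- q' * y) * e + (q * y') * e'
    have h2 : q * q' * σ + q' * r * y - q * r' * y' = 0 := Int.eq_zero_of_abs_lt_dvd ⟨_, h1⟩ hb
    refine ⟨h2, ?_⟩
    rw [h2] at h1
    have := (mul_eq_zero.1 h1.symm).resolve_left (by omega)
    linarith
  obtain ⟨ds, cn⟩ := z _ _ _ _ av bl
  obtain ⟨z2, dn⟩ := z _ _ _ _ ap bx
  have dd : q ∣ q' := by
    apply ca.dvd_of_dvd_mul_right
    apply cop_dvd cx
    . exact ⟨a' * x1' - q' * cf, by linear_combination -cn⟩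
    . exact ⟨a' * x2' - q' * cp, by linear_combination -dn⟩
  have de : q' ∣ q := by
    apply ca'.dvd_of_dvd_mul_right
    apply cop_dvd cx'
    . exact ⟨a * af + q * cf, by linear_combination cn⟩
    . exact ⟨a * ag + q * cp, by linear_combination dn⟩
  have hqq : q = q' := Int.dvd_antisymm (by omega) (by omega) dd de
  subst hqq
  have bu : q ≠ 0 := by omega
  refine ⟨rfl, ?_, ?_, ⟨cf, ?_⟩, ⟨cp, ?_⟩⟩ <;> apply mul_left_cancel₀ bu <;> linarith
end ZD
namespace ZD
open scoped Pointwise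
open Finset
lemma ratio_close {g t : aa} (hg : Good g) (ht : Good t) :
    |((g * t) 1 0 : Real) / ((g * t) 1 1) - (t 1 0 : Real) / t 1 1| <= 1 / (t 1 1 : Real) ^ 2 := by
  have ba : (1:Real) <= t 1 1 := mod_cast ht.p11
  have cg : (1:Real) <= g 1 1 := mod_cast hg.p11
  have ex : (1:Real) <= t 0 1 := mod_cast ht.p01
  have go : (1:Real) <= g 1 0 := mod_cast hg.p10
  have kp : (g 1 0 : Real) <= g 1 1 := mod_cast hg.h4
  have hd : ((t 0 0 : Real) * t 1 1 - t 0 1 * t 1 0) ^ 2 = 1 := mod_cast ht.hd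
  have hd' : |(t 0 0 : Real) * t 1 1 - t 0 1 * t 1 0| = 1 := by
    rwa [<- sq_abs, pow_eq_one_iff_of_nonneg (abs_nonneg _) two_ne_zero] at hd
  rw [cw, ao]
  push_cast
  have hpos : (0:Real) < g 1 0 * t 0 1 + g 1 1 * t 1 1 := by positivity
  rw [div_sub_div _ _ hpos.ne' (by positivity), abs_div]
  have e : ((g 1 0 : Real) * t 0 0 + g 1 1 * t 1 0) * t 1 1 - (g 1 0 * t 0 1 + g 1 1 * t 1 1) * t 1 0
    = g 1 0 * (t 0 0 * t 1 1 - t 0 1 * t 1 0) := by ring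
  rw [e, abs_mul, hd', abs_of_pos (by positivity), abs_of_pos (by positivity), mul_one,
    div_le_div_iff₀ (by positivity) (by positivity)]
  nlinarith [mul_nonneg (sub_nonneg.2 kp) (sq_nonneg (t 1 1 : Real)), mul_pos (mul_pos (zero_lt_one.trans_le go) (zero_lt_one.trans_le ex)) (zero_lt_one.trans_le ba)]
lemma ratio_sep {g h : aa} (hg : Good g) (hh : Good h) (hne : ¬ (g 1 0 = h 1 0 ∧ g 1 1 = h 1 1)) (L : Real)
    (h1 : (g 1 1 : Real) <= L) (h2 : (h 1 1 : Real) <= L) :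
    1 / L ^ 2 <= |(g 1 0 : Real) / g 1 1 - (h 1 0 : Real) / h 1 1| := by
  have ba : (1:Real) <= g 1 1 := mod_cast hg.p11
  have cg : (1:Real) <= h 1 1 := mod_cast hh.p11
  have hdet : g 1 0 * h 1 1 - g 1 1 * h 1 0 ≠ 0 := by
    intro h0
    apply hne
    have bg := hg.cop
    have dv := hh.cop
    have dd : g 1 1 ∣ h 1 1 := bg.symm.dvd_of_dvd_mul_left ⟨h 1 0, by linarith⟩
    have de : h 1 1 ∣ g 1 1 := dv.symm.dvd_of_dvd_mul_right ⟨g 1 0, by linarith⟩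
    have e := Int.dvd_antisymm (by linarith [hg.p11]) (by linarith [hh.p11]) dd de
    refine ⟨?_, e⟩
    rw [e] at h0
    have : h 1 1 * (g 1 0 - h 1 0) = 0 := by linarith
    rcases mul_eq_zero.1 this with h | h
    . have := hh.p11; omega
    . omega
  have hdet' : (1:Real) <= |(g 1 0 : Real) * h 1 1 - g 1 1 * h 1 0| := by
    exact_mod_cast Int.one_le_abs hdet
  rw [div_sub_div _ _ (by positivity) (by positivity), abs_div, abs_of_pos (by positivity : (0:Real) < g 1 1 * h 1 1),
    div_le_div_iff₀ (by nlinarith) (by positivity)]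
  have : (g 1 1 : Real) * h 1 1 <= L ^ 2 := by nlinarith
  nlinarith [sq_nonneg L]
lemma row2_det {v w g : aa} (hg : Good g) :
    |(v * g) 1 0 * (w * g) 1 1 - (v * g) 1 1 * (w * g) 1 0| = |v 1 0 * w 1 1 - v 1 1 * w 1 0| := by
  have hd := hg.hd
  have hd' : |g 0 0 * g 1 1 - g 0 1 * g 1 0| = 1 := by
    rwa [<- sq_abs, pow_eq_one_iff_of_nonneg (abs_nonneg _) two_ne_zero] at hd
  have : (v * g) 1 0 * (w * g) 1 1 - (v * g) 1 1 * (w * g) 1 0 = (v 1 0 * w 1 1 - v 1 1 * w 1 0) * (g 0 0 * g 1 1 - g 0 1 * g 1 0) := by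
    simp only [cw, ao]; ring
  rw [this, abs_mul, hd', mul_one]
set_option maxHeartbeats 1000000 in
lemma absdet_le {a b a' b' c : Int} (h1 : 1 <= a) (h2 : a <= b) (h3 : b <= c) (h4 : 1 <= a') (ay : a' <= b') (bb : b' <= c) :
    |a * b' - b * a'| <= c ^ 2 := by
  rw [abs_le]; constructor <;> nlinarith
lemma fin_num {v r s s' k : Real} (hv : 0 <= v) (hr : 0 <= r) (hs : 0 <= s) (h : s' <= k) : v * (r * s') <= r * (s + v * k) := by
  calc v * (r * s') <= v * (r * k) := by gcongr
    _ = r * (0 + v * k) := by ring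
    _ <= _ := by gcongr
lemma regime1_fib {P : Nat} [NeZero P] {ρ : Type*} {ho C : Real} (ah : 0 < ho) (hC : 1 <= C) {c : Int} (hc : 6 <= c)
    {T : Nat} (fk : 1 <= T) {V S : Finset aa} {R : Finset ρ} {mid : ρ -> aa} {M : Int} {n : Nat}
    (hV : ∀ v ∈ V, Good v ∧ v 1 1 <= c) (hVi : ∀ v ∈ V, ∀ w ∈ V, v 1 0 = w 1 0 -> v 1 1 = w 1 1 -> v = w)
    (hS : ∀ t ∈ S, Good t ∧ (T : Int) <= t 1 1 ∧ (t 1 1 : Real) <= C * T)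
    (hSi : ∀ v ∈ S, ∀ w ∈ S, v 1 0 = w 1 0 -> v 1 1 = w 1 1 -> v = w)
    (hmid : ∀ r ∈ R, Good (mid r))
    (hx : ∀ v ∈ V, ∀ r ∈ R, ∀ t ∈ S, (v * mid r * t) 1 1 * M <= P ∧ ho * P <= 2 * M * ((v * mid r * t) 1 1 : Real))
    (hM : 3 * c ^ 28 < M) (hn : 6 * n * M <= P)
    (ad : aa × ρ × aa) (ar : ad ∈ V ×ˢ R ×ˢ S) (an : ZMod P) (ez : InM P (c ^ 14) an)
    (hk0' : ¬ InM P (c ^ 7) an)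
    (Q : Finset ((aa × ρ × aa) × ZMod P))
    (hQ : ∀ p ∈ Q, p.1 ∈ V ×ˢ R ×ˢ S ∧ InM P (c ^ 14) p.2 ∧ ∃ am ak : Int, |am| <= n ∧ |ak| <= n ∧
        p.2 * (((p.1.1 * mid p.1.2.1 * p.1.2.2) 1 0 : Int) : ZMod P) = an * (((ad.1 * mid ad.2.1 * ad.2.2) 1 0 : Int) : ZMod P) + am ∧
        p.2 * (((p.1.1 * mid p.1.2.1 * p.1.2.2) 1 1 : Int) : ZMod P) = an * (((ad.1 * mid ad.2.1 * ad.2.2) 1 1 : Int) : ZMod P) + ak) :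
    (Q.card : Real) <= (2 / ho + 1) * (R.card * (S.card + V.card * ((2 * C ^ 2 + 1 + 2 * C ^ 2 / ho) * (1 + T ^ 2 / c ^ 5)))) := by
  classical
  set x : aa × ρ × aa -> aa := fun i => i.1 * mid i.2.1 * i.2.2 with hxdef
  have ek : (0 : Int) < P := mod_cast Nat.pos_of_ne_zero (NeZero.ne P)
  have eh : 0 < M := lt_trans (by positivity) hM
  have hc0' : (0:Int) < c := by omega
  have hgood : ∀ i ∈ V ×ˢ R ×ˢ S, Good (x i) := by
    intro i hi
    simp only [mem_product] at hi
    exact ((hV _ hi.1).1.mul (hmid _ hi.2.1)).mul (hS _ hi.2.2).1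
  have hxM : ∀ i ∈ V ×ˢ R ×ˢ S, (x i) 1 1 * M <= P ∧ ho * P <= 2 * M * ((x i) 1 1 : Real) := by
    intro i hi
    simp only [mem_product] at hi
    exact hx _ hi.1 _ hi.2.1 _ hi.2.2
  have hnx : ∀ i ∈ V ×ˢ R ×ˢ S, 3 * ho * n <= ((x i) 1 1 : Real) := by
    intro i hi
    have h1 := (hxM i hi).2
    have h2 : (6 * n * M : Real) <= P := mod_cast hn
    have hM0' : (0:Real) < M := mod_cast eh
    have h3 : (2 * M : Real) * (3 * ho * n) <= 2 * M * ((x i) 1 1 : Real) := by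
      linarith [mul_le_mul_of_nonneg_left h2 ah.le]
    exact le_of_mul_le_mul_left h3 (by positivity)
  obtain ⟨ks, kt⟩ := ZMod.intCast_surjective an
  obtain ⟨q, kl, cb, dy, hqH, hr0, ku, hc0c⟩ := ez.red ks kt
  have data : ∀ p ∈ Q, ∃ κ a r am ak : Int, (κ : ZMod P) = p.2 ∧ q * κ = a * P + r ∧ |am| <= n ∧ |ak| <= n ∧
      r * (x p.1) 1 0 = cb * (x ad) 1 0 + q * am ∧ r * (x p.1) 1 1 = cb * (x ad) 1 1 + q * ak ∧
      q ∣ a * (x p.1) 1 0 - kl * (x ad) 1 0 ∧ q ∣ a * (x p.1) 1 1 - kl * (x ad) 1 1 ∧ IsCoprime q a := by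
    intro p hp
    obtain ⟨hpX, hpM, am, ak, av, ap, ct, cu⟩ := hQ p hp
    obtain ⟨κ, hκ⟩ := ZMod.intCast_surjective p.2
    obtain ⟨q', a, r, hq1', hqH', hr, he, hcc⟩ := hpM.red κ hκ
    have lift : ∀ y au σ : Int, p.2 * (y : ZMod P) = an * (au : ZMod P) + σ -> ∃ l, κ * y = ks * au + σ + P * l := by
      intro y au σ h
      rw [<- hκ, <- kt] at h
      have : ((ks * au + σ : Int) : ZMod P) = ((κ * y : Int) : ZMod P) := by push_cast; exact h.symm
      rw [ZMod.intCast_eq_intCast_iff_dvd_sub] at this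
      obtain ⟨l, hl⟩ := this
      exact ⟨l, by linarith⟩
    obtain ⟨cf, bk⟩ := lift _ _ _ ct
    obtain ⟨cp, bw⟩ := lift _ _ _ cu
    have bd : ∀ y au σ : Int, |σ| <= n -> 0 <= y -> y <= (x p.1) 1 1 -> 0 <= au -> au <= (x ad) 1 1 ->
        |q * q' * σ + q' * cb * au - q * r * y| < P := by
      intro y au σ hσ eg hy eu h0
      have H0 : (0:Int) <= c ^ 14 := by positivity
      have bl : |q * q' * σ| <= c ^ 14 * c ^ 14 * n := by
        rw [abs_mul, abs_mul, abs_of_pos (by omega : 0 < q), abs_of_pos (by omega : 0 < q')]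
        gcongr
      have bx : |q' * cb * au| <= c ^ 14 * c ^ 14 * (x ad) 1 1 := by
        rw [abs_mul, abs_mul, abs_of_pos (by omega : 0 < q'), abs_of_nonneg eu]
        gcongr
      have dp : |q * r * y| <= c ^ 14 * c ^ 14 * (x p.1) 1 1 := by
        rw [abs_mul, abs_mul, abs_of_pos (by omega : 0 < q), abs_of_nonneg eg]
        gcongr
      have kk : |q * q' * σ + q' * cb * au - q * r * y| <= c ^ 28 * n + c ^ 28 * (x ad) 1 1 + c ^ 28 * (x p.1) 1 1 := by
        have ab := abs_sub (q * q' * σ + q' * cb * au) (q * r * y)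
        have ac := abs_add_le (q * q' * σ) (q' * cb * au)
        have bv : c ^ 14 * c ^ 14 = c ^ 28 := by ring
        rw [bv] at bl bx dp
        linarith
      have dl := (hxM _ ar).1
      have cm := (hxM _ hpX).1
      have c28 : (0:Int) < c ^ 28 := by positivity
      have key : |q * q' * σ + q' * cb * au - q * r * y| * M < P * M := by
        calc _ <= (c ^ 28 * n + c ^ 28 * (x ad) 1 1 + c ^ 28 * (x p.1) 1 1) * M := by gcongr
          _ = c ^ 28 * (n * M + (x ad) 1 1 * M + (x p.1) 1 1 * M) := by ring
          _ <= c ^ 28 * (3 * P) := by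
            gcongr
            have : (n : Int) * M ≥ 0 := by positivity
            linarith
          _ = P * (3 * c ^ 28) := by ring
          _ < P * M := by gcongr
      exact lt_of_mul_lt_mul_right key eh.le
    have bh := hgood _ hpX
    have aw := hgood _ ar
    obtain ⟨rfl, lw, u2, u3, u4⟩ := arcs ek dy hq1' ku he hc0c hcc aw.cop bh.cop bk bw
      (bd _ _ _ av (by linarith [bh.p10]) bh.h4 (by linarith [aw.p10]) aw.h4)
      (bd _ _ _ ap (by linarith [bh.p11]) le_rfl (by linarith [aw.p11]) le_rfl)
    exact ⟨κ, a, r, am, ak, hκ, he, av, ap, lw, u2, u3, u4, hcc⟩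
  have em : q ≠ 0 := by omega
  have hk : ∀ i ∈ Q.image Prod.fst, (Q.filter (fun p => p.1 = i)).card <= 2 * ⌊1 / ho⌋₊ + 1 := by
    intro i hi
    obtain ⟨bt, hp0, rfl⟩ := mem_image.1 hi
    have hcard : (Q.filter (fun p => p.1 = bt.1)).card = ((Q.filter (fun p => p.1 = bt.1)).image Prod.snd).card := by
      rw [card_image_of_injOn]
      rintro ⟨i, k⟩ h ⟨i', k'⟩ h' hh
      simp at h h' hh
      simp [h.2, h'.2, hh]
    rw [hcard]
    apply ksmall
    intro k hk k' hk'
    simp only [mem_image, mem_filter] at hk hk'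
    obtain ⟨p, ⟨hp, hpi⟩, rfl⟩ := hk
    obtain ⟨p', ⟨hp', hpi'⟩, rfl⟩ := hk'
    obtain ⟨κ, a, r, am, ak, dd, de, gk, gl, fn, fo, fp, fs, kv⟩ := data p hp
    obtain ⟨κ', a', r', σ1', σ2', d1', d2', d3', d4', d5', d6', d7', d8', d9'⟩ := data p' hp'
    rw [hpi] at fn fo fp fs
    rw [hpi'] at d5' d6' d7' d8'
    have hX := (hQ bt hp0).1
    have G := hgood _ hX
    have da : q ∣ a - a' := by
      apply cop_dvd G.cop
      . have := dvd_sub fp d7'; ring_nf at this ⊢; exact this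
      . have := dvd_sub fs d8'; ring_nf at this ⊢; exact this
    obtain ⟨s, hs⟩ := da
    set m := κ - κ' - s * P with hm
    have hrm : r - r' = q * m := by rw [hm]; linear_combination d2' - de - P * hs
    have hmx : m * (x bt.1) 1 1 = ak - σ2' := by
      apply mul_left_cancel₀ em
      linear_combination fo - d6' - (x bt.1) 1 1 * hrm
    refine ⟨m, ?_, ?_⟩
    . have fg : (1:Real) <= (x bt.1) 1 1 := mod_cast G.p11
      have h2n : |m| * (x bt.1) 1 1 <= 2 * n := by
        rw [<- abs_of_pos (by linarith [G.p11] : 0 < (x bt.1) 1 1), <- abs_mul, hmx]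
        have := abs_sub ak σ2'
        linarith
      have h2n' : (|m| : Real) * (x bt.1) 1 1 <= 2 * n := mod_cast h2n
      have := hnx _ hX
      have h3 : (|m| : Real) <= 1 / ho := by
        rw [le_div_iff₀ ah]
        by_contra hcon
        push Not at hcon
        have : (x bt.1) 1 1 * 1 < ((x bt.1) 1 1 : Real) * ((|m| : Real) * ho) := by gcongr
        linarith [mul_le_mul_of_nonneg_left h2n' ah.le]
      have h4 : ((m.natAbs : Nat) : Real) <= 1 / ho := by rw [Nat.cast_natAbs]; push_cast; exact h3
      have ay := Nat.le_floor h4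
      have bb : |m| = (m.natAbs : Int) := Int.abs_eq_natAbs m
      rw [bb]; exact_mod_cast ay
    . rw [<- dd, <- d1', hm]; push_cast; simp
  have h1 := card_le_mul_card_image Q _ hk
  have h1' : (Q.card : Real) <= (2 / ho + 1) * (Q.image Prod.fst).card := by
    calc (Q.card : Real) <= ((2 * ⌊1 / ho⌋₊ + 1 : Nat) : Real) * (Q.image Prod.fst).card := mod_cast h1
      _ <= _ := by
        gcongr
        push_cast
        have := Nat.floor_le (by positivity : 0 <= 1 / ho)
        have e : 2 / ho = 2 * (1 / ho) := by ring
        rw [e]; linarith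
  refine h1'.trans ?_
  gcongr
  set C2 : Real := 2 * C ^ 2 + 1 + 2 * C ^ 2 / ho with hC2
  have hcR : (0:Real) < c := mod_cast hc0'
  have hTR : (1:Real) <= T := mod_cast fk
  by_cases kw : c ^ 2 < q
  ·
    have : (Q.image Prod.fst).card <= (R ×ˢ S).card := by
      apply card_le_card_of_injOn (fun i => i.2)
      . intro i hi
        obtain ⟨p, hp, rfl⟩ := mem_image.1 hi
        have := (hQ p hp).1
        rw [mem_product] at this
        exact this.2
      . rintro i hi i' hi' hii
        obtain ⟨p, hp, rfl⟩ := mem_image.1 hi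
        obtain ⟨p', hp', rfl⟩ := mem_image.1 hi'
        obtain ⟨κ, a, r, am, ak, dd, de, gk, gl, fn, fo, fp, fs, kv⟩ := data p hp
        obtain ⟨κ', a', r', σ1', σ2', d1', d2', d3', d4', d5', d6', d7', d8', d9'⟩ := data p' hp'
        simp only at hii
        have dl := (hQ p hp).1
        have cm := (hQ p' hp').1
        simp only [mem_product] at dl cm
        have hdet : q ∣ (x p.1) 1 0 * (x p'.1) 1 1 - (x p.1) 1 1 * (x p'.1) 1 0 := by
          apply kv.dvd_of_dvd_mul_left
          have ab := dvd_sub fp d7'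
          have ac := dvd_sub fs d8'
          have := dvd_sub (ab.mul_right ((x p'.1) 1 1)) (ac.mul_right ((x p'.1) 1 0))
          ring_nf at this ⊢; exact this
        have hxp : x p.1 = p.1.1 * (mid p'.1.2.1 * p'.1.2.2) := by
          rw [hxdef]; simp only; rw [hii, Matrix.mul_assoc]
        have hxp' : x p'.1 = p'.1.1 * (mid p'.1.2.1 * p'.1.2.2) := by
          rw [hxdef]; simp only; rw [Matrix.mul_assoc]
        have gm := (hmid _ cm.2.1).mul (hS _ cm.2.2).1
        have hab := row2_det (v := p.1.1) (w := p'.1.1) gm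
        rw [<- hxp, <- hxp'] at hab
        have fa := hV _ dl.1
        have fb := hV _ cm.1
        have hlt : |p.1.1 1 0 * p'.1.1 1 1 - p.1.1 1 1 * p'.1.1 1 0| < q :=
          lt_of_le_of_lt (absdet_le fa.1.p10 fa.1.h4 fa.2 fb.1.p10 fb.1.h4 fb.2) kw
        rw [<- hab] at hlt
        have hz := Int.eq_zero_of_abs_lt_dvd hdet hlt
        rw [hz, abs_zero] at hab
        have lx : p.1.1 1 0 * p'.1.1 1 1 - p.1.1 1 1 * p'.1.1 1 0 = 0 := abs_eq_zero.1 hab.symm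
        have hvv : p.1.1 = p'.1.1 := by
          by_contra hne
          have hne' : ¬ (p.1.1 1 0 = p'.1.1 1 0 ∧ p.1.1 1 1 = p'.1.1 1 1) := fun h => hne (hVi _ dl.1 _ cm.1 h.1 h.2)
          have := ratio_sep fa.1 fb.1 hne' c (mod_cast fa.2) (mod_cast fb.2)
          have cn : (0:Real) < p.1.1 1 1 := mod_cast fa.1.p11
          have dn : (0:Real) < p'.1.1 1 1 := mod_cast fb.1.p11
          have kx : (p.1.1 1 0 : Real) * p'.1.1 1 1 - p.1.1 1 1 * p'.1.1 1 0 = 0 := mod_cast lx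
          rw [div_sub_div _ _ cn.ne' dn.ne', kx] at this
          simp at this
          have : (0:Real) < ((c:Real) ^ 2)⁻¹ := by positivity
          linarith
        exact Prod.ext hvv hii
    rw [card_product] at this
    have h3 : ((Q.image Prod.fst).card : Real) <= R.card * S.card := mod_cast this
    exact h3.trans (mul_le_mul_of_nonneg_left (le_add_of_nonneg_right (mul_nonneg (Nat.cast_nonneg _) (by positivity))) (Nat.cast_nonneg _))
  . push Not at kw
    have hr7 : c ^ 7 < |cb| := by
      by_contra hcon
      push Not at hcon
      apply hk0'
      refine ⟨q, cb, dy, ?_, hcon, ?_⟩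
      . refine kw.trans ?_
        exact pow_le_pow_right₀ (by omega) (by norm_num)
      . rw [<- kt]
        have := congrArg (Int.cast : Int -> ZMod P) ku
        push_cast at this
        simpa using this
    set S' := (Q.image Prod.fst).image (fun i => i.2.2) with hS'
    have hsub : Q.image Prod.fst ⊆ V ×ˢ R ×ˢ S' := by
      intro i hi
      have hi' := hi
      obtain ⟨p, hp, rfl⟩ := mem_image.1 hi
      have := (hQ p hp).1
      simp only [mem_product] at this ⊢
      exact ⟨this.1, this.2.1, mem_image.2 ⟨_, hi', rfl⟩⟩
    have hS'S : S' ⊆ S := by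
      intro t ht
      obtain ⟨i, hi, rfl⟩ := mem_image.1 ht
      obtain ⟨p, hp, rfl⟩ := mem_image.1 hi
      have := (hQ p hp).1
      simp only [mem_product] at this
      exact this.2.2
    have hcnt : (S'.card : Real) <= C2 * (1 + T ^ 2 / c ^ 5) := by
      have hsp := spaced S' (fun t => (t 1 0 : Real) / t 1 1) (1 / (C * T) ^ 2) (by positivity) ?_
        (((x ad) 1 0 : Real) / (x ad) 1 1) (1 / T ^ 2 + 1 / (ho * c ^ 5)) (by positivity) ?_
      . refine hsp.trans ?_
        have e : 2 * (1 / (T:Real) ^ 2 + 1 / (ho * (c:Real) ^ 5)) / (1 / (C * T) ^ 2) + 1 = 2 * C ^ 2 + 1 + (2 * C ^ 2 / ho) * (T ^ 2 / c ^ 5) := by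
          field_simp
          ring
        rw [e, hC2, mul_add, mul_one]
        have ds : 0 <= 2 * C ^ 2 / ho := by positivity
        have z2 : 0 <= (2 * C ^ 2 + 1) * ((T:Real) ^ 2 / c ^ 5) := by positivity
        nlinarith
      . intro t ht t' ht' hne
        have av := hS _ (hS'S ht)
        have ap := hS _ (hS'S ht')
        exact ratio_sep av.1 ap.1 (fun h => hne (hSi _ (hS'S ht) _ (hS'S ht') h.1 h.2)) _ av.2.2 ap.2.2
      . intro t ht
        obtain ⟨i, hi, rfl⟩ := mem_image.1 ht
        obtain ⟨p, hp, rfl⟩ := mem_image.1 hi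
        obtain ⟨κ, a, r, am, ak, dd, de, gk, gl, fn, fo, fp, fs, kv⟩ := data p hp
        have hX := (hQ p hp).1
        have bh := hgood _ hX
        have aw := hgood _ ar
        have hX' := hX
        simp only [mem_product] at hX'
        have hSt := hS _ hX'.2.2
        have rc := ratio_close ((hV _ hX'.1).1.mul (hmid _ hX'.2.1)) hSt.1
        change |((x p.1) 1 0 : Real) / (x p.1) 1 1 - _| <= _ at rc
        have tT : (T:Real) <= p.1.2.2 1 1 := mod_cast hSt.2.1
        have rc2 : 1 / (p.1.2.2 1 1 : Real) ^ 2 <= 1 / (T:Real) ^ 2 := by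
          gcongr
        have hdet : |cb| * |(x ad) 1 0 * (x p.1) 1 1 - (x ad) 1 1 * (x p.1) 1 0| <= q * (2 * n * (x p.1) 1 1) := by
          rw [<- abs_mul]
          have e : cb * ((x ad) 1 0 * (x p.1) 1 1 - (x ad) 1 1 * (x p.1) 1 0) = q * (ak * (x p.1) 1 0 - am * (x p.1) 1 1) := by
            linear_combination (-(x p.1) 1 1) * fn + (x p.1) 1 0 * fo
          rw [e, abs_mul, abs_of_pos (by omega : 0 < q)]
          gcongr
          have := abs_sub (ak * (x p.1) 1 0) (am * (x p.1) 1 1)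
          have ab : |ak * (x p.1) 1 0| <= n * (x p.1) 1 1 := by
            rw [abs_mul, abs_of_pos (by linarith [bh.p10] : 0 < (x p.1) 1 0)]
            have := bh.h4; have := bh.p10
            gcongr
          have ac : |am * (x p.1) 1 1| <= n * (x p.1) 1 1 := by
            rw [abs_mul, abs_of_pos (by linarith [bh.p11] : 0 < (x p.1) 1 1)]
            have := bh.p11
            gcongr
          linarith
        have hdet2 : c ^ 5 * |(x ad) 1 0 * (x p.1) 1 1 - (x ad) 1 1 * (x p.1) 1 0| <= 2 * n * (x p.1) 1 1 := by
          have hp11 := bh.p11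
          have : c ^ 2 * (c ^ 5 * |(x ad) 1 0 * (x p.1) 1 1 - (x ad) 1 1 * (x p.1) 1 0|) <= c ^ 2 * (2 * n * (x p.1) 1 1) := by
            calc _ = c ^ 7 * |(x ad) 1 0 * (x p.1) 1 1 - (x ad) 1 1 * (x p.1) 1 0| := by ring
              _ <= |cb| * |(x ad) 1 0 * (x p.1) 1 1 - (x ad) 1 1 * (x p.1) 1 0| := by gcongr
              _ <= _ := hdet
              _ <= _ := by gcongr
          exact le_of_mul_le_mul_left this (by positivity)
        have hdet3 : (c:Real) ^ 5 * |((x ad) 1 0 : Real) * (x p.1) 1 1 - (x ad) 1 1 * (x p.1) 1 0| <= 2 * n * (x p.1) 1 1 := by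
          exact_mod_cast hdet2
        have bk : (0:Real) < (x p.1) 1 1 := mod_cast bh.p11
        have ai : (0:Real) < (x ad) 1 1 := mod_cast aw.p11
        have hr : |((x ad) 1 0 : Real) / (x ad) 1 1 - ((x p.1) 1 0 : Real) / (x p.1) 1 1| <= 1 / (ho * c ^ 5) := by
          rw [div_sub_div _ _ ai.ne' bk.ne', abs_div, abs_of_pos (by positivity : (0:Real) < (x ad) 1 1 * (x p.1) 1 1),
            div_le_div_iff₀ (by positivity) (by positivity)]
          have := hnx _ ar
          calc _ = ho * ((c:Real) ^ 5 * |((x ad) 1 0 : Real) * (x p.1) 1 1 - (x ad) 1 1 * (x p.1) 1 0|) := by ring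
            _ <= ho * (2 * n * (x p.1) 1 1) := by gcongr
            _ <= (3 * ho * n) * (x p.1) 1 1 := by
              have : 0 <= ho * n * ((x p.1) 1 1 : Real) := by positivity
              linarith
            _ <= _ := by rw [one_mul]; gcongr
        have cv := abs_le.1 rc
        have ch := abs_le.1 hr
        rw [abs_le]
        constructor <;> linarith
    have h3 := card_le_card hsub
    rw [card_product, card_product] at h3
    have h4 : ((Q.image Prod.fst).card : Real) <= V.card * (R.card * S'.card) := mod_cast h3
    exact h4.trans (fin_num (Nat.cast_nonneg _) (Nat.cast_nonneg _) (Nat.cast_nonneg _) hcnt)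
end ZD
namespace ZD
open scoped Pointwise
open Finset
lemma card_le_sq (Y : Finset aa) (M : Nat) (hY : ∀ g ∈ Y, Good g ∧ g 1 1 <= M)
    (hi : ∀ v ∈ Y, ∀ w ∈ Y, v 1 0 = w 1 0 -> v 1 1 = w 1 1 -> v = w) : Y.card <= M ^ 2 := by
  classical
  have : Y.card <= (Finset.Icc (1:Int) M ×ˢ Finset.Icc (1:Int) M).card := by
    apply card_le_card_of_injOn (fun g => (g 1 0, g 1 1))
    . intro g hg
      have h := hY g hg
      have := h.1.p10; have := h.1.p11; have := h.1.h4; have := h.2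
      simp only [coe_product, Set.mem_prod, mem_coe, mem_Icc]
      omega
    . intro g hg h hh e
      simp only [Prod.mk.injEq] at e
      exact hi g hg h hh e.1 e.2
  rw [card_product] at this
  simp at this
  rw [sq]; exact this
lemma regime1_num {c T V S R Y M az cc : Real} (hc : 1 <= c) (hT : c <= T) (ky : T <= c ^ 80)
    (hV : c ^ k49 <= V) (hS : T ^ k49 <= S) (hY : (c ^ 32) ^ k49 <= Y)
    (eh : 0 <= M) (hM : M <= c ^ 32) (hR : 0 <= R) (hK1 : 0 <= az) (ly : 1 <= cc) :
    2304 * M ^ 2 * (az * (R * (S + V * (cc * (1 + T ^ 2 / c ^ 5))))) * (V * (R * S)) * Y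
      <= (2304 * az * (3 * cc)) * c ^ nhf * (V * (R * S) * Y) ^ 2 := by
  have ho : 0 < c := by linarith
  have bn : 0 < T := by linarith
  have V0 : 0 < V := lt_of_lt_of_le (by positivity) hV
  have S0 : 0 < S := lt_of_lt_of_le (by positivity) hS
  have Y0 : 0 < Y := lt_of_lt_of_le (by positivity) hY
  have ab : M ^ 2 <= c ^ (32/25 : Real) * Y := by
    calc M ^ 2 <= (c ^ 32) ^ 2 := by gcongr
      _ = c ^ (32/25 : Real) * (c ^ 32) ^ k49 := by
        rw [<- Real.rpow_natCast c 32, <- Real.rpow_mul ho.le, <- Real.rpow_add ho, <- Real.rpow_natCast, <- Real.rpow_mul ho.le]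
        norm_num
      _ <= _ := by gcongr
  have ac : 1 <= c ^ (-(49/25) : Real) * V := by
    calc (1:Real) = c ^ (-(49/25) : Real) * c ^ k49 := by rw [<- Real.rpow_add ho]; norm_num
      _ <= _ := by gcongr
  have bv : 1 <= c ^ (-(49/25) : Real) * S := by
    calc (1:Real) = c ^ (-(49/25) : Real) * c ^ k49 := by rw [<- Real.rpow_add ho]; norm_num
      _ <= c ^ (-(49/25) : Real) * T ^ k49 := by gcongr
      _ <= _ := by gcongr
  have bz : T ^ 2 / c ^ 5 <= c ^ (-(9/5) : Real) * S := by
    have h1 : T ^ 2 = T ^ (1/25 : Real) * T ^ k49 := by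
      rw [<- Real.rpow_add bn, <- Real.rpow_natCast]; norm_num
    have h2 : T ^ (1/25 : Real) <= c ^ (16/5 : Real) := by
      calc T ^ (1/25 : Real) <= (c ^ 80) ^ (1/25 : Real) := by gcongr
        _ = _ := by rw [<- Real.rpow_natCast c 80, <- Real.rpow_mul ho.le]; norm_num
    rw [div_le_iff₀ (by positivity)]
    have h3 : c ^ (-(9/5) : Real) * S * c ^ 5 = c ^ (16/5 : Real) * S := by
      have : c ^ (16/5 : Real) = c ^ (-(9/5) : Real) * c ^ 5 := by
        rw [<- Real.rpow_natCast c 5, <- Real.rpow_add ho]; norm_num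
      rw [this]; ring
    rw [h3, h1]
    gcongr
  have cf : c ^ (-(49/25) : Real) <= c ^ (-(89/50) : Real) := Real.rpow_le_rpow_of_exponent_le hc (by norm_num)
  have cp : c ^ (-(9/5) : Real) <= c ^ (-(89/50) : Real) := Real.rpow_le_rpow_of_exponent_le hc (by norm_num)
  have gi : S + V * (cc * (1 + T ^ 2 / c ^ 5)) <= 3 * cc * c ^ (-(89/50) : Real) * (V * S) := by
    set γ := c ^ (-(89/50) : Real)
    have bp : S <= γ * (V * S) := by
      calc S = 1 * S := by ring
        _ <= (γ * V) * S := by gcongr; exact ac.trans (by gcongr)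
        _ = _ := by ring
    have br : 1 + T ^ 2 / c ^ 5 <= 2 * γ * S := by
      have := bv.trans (by gcongr : c ^ (-(49/25) : Real) * S <= γ * S)
      have := bz.trans (by gcongr : c ^ (-(9/5) : Real) * S <= γ * S)
      linarith
    have cy : V * (cc * (1 + T ^ 2 / c ^ 5)) <= V * (cc * (2 * γ * S)) := by gcongr
    have ec : γ * (V * S) <= cc * (γ * (V * S)) := le_mul_of_one_le_left (by positivity) ly
    calc _ <= cc * (γ * (V * S)) + V * (cc * (2 * γ * S)) := by linarith
      _ = _ := by ring
  have ko : c ^ (32/25 : Real) * c ^ (-(89/50) : Real) = c ^ nhf := by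
    rw [<- Real.rpow_add ho]; norm_num
  calc _ <= 2304 * (c ^ (32/25 : Real) * Y) * (az * (R * (3 * cc * c ^ (-(89/50) : Real) * (V * S)))) * (V * (R * S)) * Y := by gcongr
    _ = (2304 * az * (3 * cc)) * (c ^ (32/25 : Real) * c ^ (-(89/50) : Real)) * (V * (R * S) * Y) ^ 2 := by ring
    _ = _ := by rw [ko]
lemma M_large {c Y : Real} {M : Nat} (hc : 6 <= c) (hY : (c ^ 32) ^ k49 <= Y) (hM : Y <= (M:Real) ^ 2) : 3 * c ^ 28 < M := by
  have ho : 0 < c := by linarith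
  have e : (c ^ 31) ^ 2 <= (M:Real) ^ 2 := by
    calc (c ^ 31) ^ 2 = c ^ (62 : Real) := by rw [<- pow_mul, <- Real.rpow_natCast]; norm_num
      _ <= c ^ (32 * (49/25) : Real) := Real.rpow_le_rpow_of_exponent_le (by linarith) (by norm_num)
      _ = (c ^ 32) ^ k49 := by rw [<- Real.rpow_natCast c 32, <- Real.rpow_mul ho.le]; norm_num
      _ <= _ := hY.trans hM
  have ac : c ^ 31 <= M := (pow_le_pow_iff_left₀ (by positivity) (by positivity) two_ne_zero).1 e
  have : 3 * c ^ 28 < c ^ 31 := by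
    have h28 : 0 < c ^ 28 := by positivity
    have : (3:Real) < c ^ 3 := by nlinarith [sq_nonneg c]
    calc 3 * c ^ 28 < c ^ 3 * c ^ 28 := by gcongr
      _ = _ := by ring
  linarith
set_option maxHeartbeats 1000000 in
def en (P : Nat) [NeZero P] (ho C al : Real) : Prop :=
  ∀ (ρ : Type) (c T : Nat) (V S : Finset aa) (R : Finset ρ) (mid : ρ -> aa) (Y : Finset aa) (K : Finset (ZMod P)),
    6 <= c -> c <= T -> T <= c ^ 80 ->
    (∀ v ∈ V, Good v ∧ v 1 1 <= c) -> (∀ v ∈ V, ∀ w ∈ V, v 1 0 = w 1 0 -> v 1 1 = w 1 1 -> v = w) ->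
    (∀ t ∈ S, Good t ∧ (T : Int) <= t 1 1 ∧ (t 1 1 : Real) <= C * T) ->
    (∀ v ∈ S, ∀ w ∈ S, v 1 0 = w 1 0 -> v 1 1 = w 1 1 -> v = w) ->
    (∀ r ∈ R, Good (mid r)) ->
    (∀ g ∈ Y, Good g ∧ g 1 1 <= (c : Int) ^ 32) -> (∀ v ∈ Y, ∀ w ∈ Y, v 1 0 = w 1 0 -> v 1 1 = w 1 1 -> v = w) ->
    ((c:Real) ^ k49 <= V.card) -> ((T:Real) ^ k49 <= S.card) -> (((c:Real) ^ 32) ^ k49 <= Y.card) ->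
    (∀ v ∈ V, ∀ r ∈ R, ∀ t ∈ S, ∀ g ∈ Y, ho * P <= (((v * mid r * t) 1 0 * g 1 0 + (v * mid r * t) 1 1 * g 1 1 : Int) : Real) ∧
      (v * mid r * t) 1 0 * g 1 0 + (v * mid r * t) 1 1 * g 1 1 <= P) ->
    (∀ k ∈ K, InM P (c ^ 14) k ∧ ¬ InM P (c ^ 7) k) ->
    ∑ k ∈ K, ‖∑ i ∈ V ×ˢ R ×ˢ S, ∑ g ∈ Y, (ZMod.stdAddChar (k * (((i.1 * mid i.2.1 * i.2.2) 1 0 * g 1 0 +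
      (i.1 * mid i.2.1 * i.2.2) 1 1 * g 1 1 : Int) : ZMod P)) : Complex)‖ ^ 2
      <= al * (c:Real) ^ nhf * (V.card * (R.card * S.card) * Y.card : Real) ^ 2
lemma regime1 {ho C : Real} (ah : 0 < ho) (hC : 1 <= C) : ∃ al : Real, 0 < al ∧ ∀ (P : Nat) [NeZero P], en P ho C al := by
  refine ⟨2304 * (2 / ho + 1) * (3 * (2 * C ^ 2 + 1 + 2 * C ^ 2 / ho)), by positivity, ?_⟩
  intro P _ ρ c T V S R mid Y K hc hcT hTc hV hVi hS hSi hmid hY hYi cV cS cY hd hK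
  have hcR : (6:Real) <= c := mod_cast hc
  have hYne : Y.Nonempty := by
    rw [<- card_pos]
    have : (0:Real) < Y.card := lt_of_lt_of_le (by positivity) cY
    exact_mod_cast this
  obtain ⟨ai, eo, hmax⟩ := exists_max_image Y (fun g => g 1 1) hYne
  have ci := (hY ai eo).1
  obtain ⟨M, hM⟩ : ∃ M : Nat, (M : Int) = ai 1 1 := ⟨(ai 1 1).toNat, by have := ci.p11; omega⟩
  have hMax : ∀ g ∈ Y, g 1 1 <= M := fun g hg => by rw [hM]; exact hmax g hg
  have fm : (1:Int) <= M := by rw [hM]; exact ci.p11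
  have hMc : (M:Real) <= (c:Real) ^ 32 := by
    have := (hY ai eo).2; rw [<- hM] at this; exact_mod_cast this
  have hcard := card_le_sq Y M (fun g hg => ⟨(hY g hg).1, hMax g hg⟩) hYi
  have hcard' : (Y.card : Real) <= (M:Real) ^ 2 := mod_cast hcard
  have hMl := M_large hcR cY hcard'
  have hxx : ∀ v ∈ V, ∀ r ∈ R, ∀ t ∈ S, Good (v * mid r * t) ∧ (v * mid r * t) 1 1 * M <= P ∧ ho * P <= 2 * (M:Int) * ((v * mid r * t) 1 1 : Real) ∧ (6 <= (v * mid r * t) 1 1) := by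
    intro v hv r hr t ht
    have bh := (hV v hv).1.mul (hmid r hr)
    have G := bh.mul (hS t ht).1
    have h := hd v hv r hr t ht ai eo
    have p := G.p10
    have p' := ci.p10
    have cg := G.h4
    have ex := ci.h4
    refine ⟨G, ?_, h.1.trans ?_, ?_⟩
    . rw [hM]; 
      have : 0 <= (v * mid r * t) 1 0 * ai 1 0 := by positivity
      linarith [h.2]
    . have : (v * mid r * t) 1 0 * ai 1 0 + (v * mid r * t) 1 1 * ai 1 1 <= 2 * (M:Int) * (v * mid r * t) 1 1 := by
        rw [hM]
        have : (v * mid r * t) 1 0 * ai 1 0 <= (v * mid r * t) 1 1 * ai 1 1 := by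
          have := G.p11; have := ci.p11
          gcongr
        linarith
      exact_mod_cast this
    . rw [ao]
      have h1 := bh.p10; have h2 := bh.p11; have h3 := (hS t ht).1.p01; have h4 := (hS t ht).2.1
      have ay : (6:Int) <= t 1 1 := by omega
      have : 1 * 6 <= (v * mid r) 1 1 * t 1 1 := by gcongr
      have : 0 <= (v * mid r) 1 0 * t 0 1 := by positivity
      linarith
  by_cases hVR : (V ×ˢ R ×ˢ S).Nonempty
  swap
  . rw [not_nonempty_iff_eq_empty] at hVR
    rw [sum_eq_zero (fun k _ => by rw [hVR]; simp)]
    exact mul_nonneg (mul_nonneg (by positivity) (Real.rpow_nonneg (Nat.cast_nonneg _) _)) (sq_nonneg _)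
  obtain ⟨ad, ar⟩ := hVR
  simp only [mem_product] at ar
  have bb : 6 * (M:Int) <= P := by
    obtain ⟨-, a, -, b⟩ := hxx _ ar.1 _ ar.2.1 _ ar.2.2
    have : 6 * (M:Int) <= (ad.1 * mid ad.2.1 * ad.2.2) 1 1 * M := by gcongr
    linarith
  have kr : (6:Int) <= (c:Int) := mod_cast hc
  have fl : 3 * (c:Int) ^ 28 < (M:Int) := mod_cast hMl
  have key := sieve (P := P) (V ×ˢ R ×ˢ S) (fun i => (i.1 * mid i.2.1 * i.2.2) 1 0) (fun i => (i.1 * mid i.2.1 * i.2.2) 1 1)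
    Y (fun g => g 1 0) (fun g => g 1 1) hYi M fm ?_ bb K
    ((2 / ho + 1) * (R.card * (S.card + V.card * ((2 * C ^ 2 + 1 + 2 * C ^ 2 / ho) * (1 + T ^ 2 / c ^ 5)))))
    (mul_nonneg (by positivity) (mul_nonneg (Nat.cast_nonneg _) (add_nonneg (Nat.cast_nonneg _) (mul_nonneg (Nat.cast_nonneg _) (by positivity))))) ?_
  . refine key.trans ?_
    have := regime1_num (c := c) (T := T) (V := V.card) (S := S.card) (R := R.card) (Y := Y.card) (M := M)
      (az := 2 / ho + 1) (cc := 2 * C ^ 2 + 1 + 2 * C ^ 2 / ho) (by linarith) (mod_cast hcT) (mod_cast hTc)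
      cV cS cY (Nat.cast_nonneg _) hMc (Nat.cast_nonneg _) (by positivity) (by
        have : 0 <= 2 * C ^ 2 / ho := by positivity
        linarith [sq_nonneg C])
    rw [card_product, card_product]
    push_cast
    exact this
  . intro g hg
    have := hY g hg
    have h1 := this.1.p10; have h2 := this.1.h4; have h3 := hMax g hg
    refine ⟨by omega, by omega, by omega, by omega⟩
  . intro n hn hnP ad ar an ez Q hQ
    have := regime1_fib (P := P) (c := c) (T := T) (M := M) (n := n) ah hC kr (by omega) hV hVi hS hSi hmid
      (fun v hv r hr t ht => ⟨(hxx v hv r hr t ht).2.1, (hxx v hv r hr t ht).2.2.1⟩) fl hnP ad ar an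
      (hK an ez).1 (hK an ez).2 Q (fun p hp => ⟨(hQ p hp).1, (hK _ (hQ p hp).2.1).1, (hQ p hp).2.2⟩)
    rw [Int.cast_natCast] at this
    exact this
end ZD
namespace ZD
open scoped Pointwise
open Finset
lemma row_eq {g h : aa} (hg : Good g) (hh : Good h) (h0 : g 1 0 * h 1 1 - g 1 1 * h 1 0 = 0) :
    g 1 0 = h 1 0 ∧ g 1 1 = h 1 1 := by
  by_contra hne
  have ba : (0:Real) < g 1 1 := mod_cast hg.p11
  have cg : (0:Real) < h 1 1 := mod_cast hh.p11
  have := ratio_sep hg hh hne (max (g 1 1 : Real) (h 1 1)) (le_max_left _ _) (le_max_right _ _)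
  have kx : (g 1 0 : Real) * h 1 1 - g 1 1 * h 1 0 = 0 := mod_cast h0
  rw [div_sub_div _ _ ba.ne' cg.ne', kx] at this
  have hmx : 0 < max (g 1 1 : Real) (h 1 1) := lt_of_lt_of_le ba (le_max_left _ _)
  rw [zero_div, abs_zero] at this
  have h3 : 0 < 1 / (max (g 1 1 : Real) (h 1 1)) ^ 2 := by positivity
  linarith
lemma n_small {ho : Real} {n : Nat} {P : Nat} {M x : Int} (hM : 0 < M) (hn : 6 * n * M <= P)
    (h1 : ho * P <= 2 * M * (x : Real)) (ah : 0 < ho) : 3 * ho * n <= (x : Real) := by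
  have h2 : (6 * n * M : Real) <= P := mod_cast hn
  have hM0' : (0:Real) < M := mod_cast hM
  have h3 : (2 * M : Real) * (3 * ho * n) <= 2 * M * (x : Real) := by nlinarith
  exact le_of_mul_le_mul_left h3 (by positivity)
lemma m_small {ho : Real} {n : Nat} {m x : Int} (ah : 0 < ho) (hx : 1 <= x) (h2n : |m| * x <= 2 * n)
    (h : 3 * ho * n <= (x : Real)) : |m| <= (⌊1 / ho⌋₊ : Int) := by
  have fg : (1:Real) <= x := mod_cast hx
  have h2n' : (|m| : Real) * x <= 2 * n := mod_cast h2n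
  have h3 : (|m| : Real) <= 1 / ho := by
    rw [le_div_iff₀ ah]
    by_contra hcon
    push Not at hcon
    have : x * 1 < (x : Real) * ((|m| : Real) * ho) := by gcongr
    nlinarith
  have h4 : ((m.natAbs : Nat) : Real) <= 1 / ho := by rw [Nat.cast_natAbs]; push_cast; exact h3
  have ay := Nat.le_floor h4
  rw [Int.abs_eq_natAbs m]; exact_mod_cast ay
lemma kdiff {P : Nat} {k k' : ZMod P} {af ag cv ch : Int} (cx : IsCoprime af ag) (hx : ag ≠ 0)
    (h1 : (k - k') * (af : ZMod P) = cv) (h2 : (k - k') * (ag : ZMod P) = ch) (hb : |cv * ag - ch * af| < P) :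
    ∃ m : Int, m * ag = ch ∧ k = k' + m := by
  have hz : ((cv * ag - ch * af : Int) : ZMod P) = 0 := by
    push_cast; rw [<- h1, <- h2]; ring
  rw [ZMod.intCast_zmod_eq_zero_iff_dvd] at hz
  have lx := Int.eq_zero_of_abs_lt_dvd hz hb
  have hd : ag ∣ ch := cx.symm.dvd_of_dvd_mul_right ⟨cv, by linarith⟩
  obtain ⟨m, rfl⟩ := hd
  have lz : cv = m * af := by
    apply mul_right_cancel₀ hx; linarith
  refine ⟨m, by ring, ?_⟩
  obtain ⟨u, v, huv⟩ := cx
  have huv' : (u : ZMod P) * af + v * ag = 1 := mod_cast congrArg (Int.cast : Int -> ZMod P) huv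
  rw [lz] at h1
  push_cast at h1 h2
  linear_combination (-(k - k' - m)) * huv' + (u : ZMod P) * h1 + (v : ZMod P) * h2
lemma det_bd {av ap af ag n : Int} (h1 : |av| <= n) (h2 : |ap| <= n) (a : 0 <= af) (b : af <= ag) :
    |av * ag - ap * af| <= 2 * n * ag := by
  have n0 := (abs_nonneg _).trans h1
  have lo := abs_sub (av * ag) (ap * af)
  have ab : |av * ag| <= n * ag := by
    rw [abs_mul, abs_of_nonneg (a.trans b)]
    have := a.trans b
    gcongr
  have ac : |ap * af| <= n * ag := by
    rw [abs_mul, abs_of_nonneg a]; gcongr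
  linarith
set_option maxHeartbeats 1000000 in
lemma regime2_fib {P : Nat} [NeZero P] {ho : Real} (ah : 0 < ho) {c : Int} (hc : 1 <= c) (hcc : 1 <= ho * c)
    {X : Finset aa} {M : Int} {n : Nat} (eh : c ^ 4 <= M)
    (hX : ∀ v ∈ X, Good v ∧ v 1 1 <= c ^ 4) (hXi : ∀ v ∈ X, ∀ w ∈ X, v 1 0 = w 1 0 -> v 1 1 = w 1 1 -> v = w)
    (hx : ∀ v ∈ X, ho * P <= 2 * M * (v 1 1 : Real))
    (hn : 6 * n * M <= P) (ad : aa) (ar : ad ∈ X) (an : ZMod P) (hk0' : ¬ InM P (c ^ 14) an)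
    (Q : Finset (aa × ZMod P))
    (hQ : ∀ p ∈ Q, p.1 ∈ X ∧ ∃ am ak : Int, |am| <= n ∧ |ak| <= n ∧
        p.2 * ((p.1 1 0 : Int) : ZMod P) = an * ((ad 1 0 : Int) : ZMod P) + am ∧
        p.2 * ((p.1 1 1 : Int) : ZMod P) = an * ((ad 1 1 : Int) : ZMod P) + ak) :
    (Q.card : Real) <= (2 / ho + 1) := by
  classical
  have hMpos : 0 < M := lt_of_lt_of_le (by positivity) eh
  have hcR : (1:Real) <= c := mod_cast hc
  have ek : (0 : Int) < P := mod_cast Nat.pos_of_ne_zero (NeZero.ne P)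
  have hn4 : (n : Real) * 2 <= c ^ 6 := by
    have h := n_small hMpos hn (hx ad ar) ah
    have h1 : (ad 1 1 : Real) <= c ^ 4 := mod_cast (hX ad ar).2
    have h2 : ho * (n * 2) <= ho * c ^ 6 := by
      calc ho * (n * 2) <= 3 * ho * n := by nlinarith [mul_nonneg ah.le (Nat.cast_nonneg (α := Real) n)]
        _ <= c ^ 4 := h.trans h1
        _ <= c ^ 5 := pow_le_pow_right₀ hcR (by norm_num)
        _ = 1 * c ^ 5 := by ring
        _ <= (ho * c) * c ^ 5 := by gcongr
        _ = _ := by ring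
    exact le_of_mul_le_mul_left h2 ah
  have hn4' : (n : Int) * 2 <= c ^ 6 := mod_cast hn4
  have heq : ∀ p ∈ Q, p.1 = ad := by
    intro p hp
    obtain ⟨hpX, am, ak, av, ap, ct, cu⟩ := hQ p hp
    have G := hX _ hpX
    have aw := hX _ ar
    set D := ad 1 0 * p.1 1 1 - ad 1 1 * p.1 1 0 with hD
    have hk : ((D : Int) : ZMod P) * an = ((ak * p.1 1 0 - am * p.1 1 1 : Int) : ZMod P) := by
      rw [hD]; push_cast
      linear_combination ((p.1 1 0 : Int) : ZMod P) * cu - ((p.1 1 1 : Int) : ZMod P) * ct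
    have hr : |ak * p.1 1 0 - am * p.1 1 1| <= c ^ 14 := by
      rw [abs_sub_comm]
      refine (det_bd av ap (by linarith [G.1.p10]) G.1.h4).trans ?_
      calc 2 * (n:Int) * p.1 1 1 <= c ^ 6 * c ^ 4 := by
            have := G.1.p11; have := G.2
            rw [mul_comm 2]
            gcongr
        _ = c ^ 10 := by ring
        _ <= c ^ 14 := pow_le_pow_right₀ hc (by norm_num)
    have hDb : |D| <= c ^ 14 := by
      have bp := G.1.p10; have br := G.1.h4; have cy := G.2; have bl := aw.1.p10; have bx := aw.1.h4; have dp := aw.2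
      have c14 : c ^ 4 * c ^ 4 <= c ^ 14 := by
        rw [<- pow_add]; exact pow_le_pow_right₀ hc (by norm_num)
      have dd : ad 1 0 * p.1 1 1 <= c ^ 4 * c ^ 4 := by
        have : ad 1 0 <= c ^ 4 := by linarith
        gcongr
        linarith
      have de : ad 1 1 * p.1 1 0 <= c ^ 4 * c ^ 4 := by
        have : p.1 1 0 <= c ^ 4 := by linarith
        gcongr
      have gk : 0 <= ad 1 0 * p.1 1 1 := by have := G.1.p11; positivity
      have gl : 0 <= ad 1 1 * p.1 1 0 := by have := aw.1.p11; positivity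
      rw [abs_le]; constructor <;> linarith
    have ft : D = 0 := by
      by_contra hne
      apply hk0'
      rcases lt_or_gt_of_ne hne with h | h
      . refine ⟨-D, -(ak * p.1 1 0 - am * p.1 1 1), by omega, by linarith [neg_le_abs D], by rwa [abs_neg], ?_⟩
        rw [Int.cast_neg, Int.cast_neg, <- hk]; ring
      . exact ⟨D, _, by omega, by linarith [le_abs_self D], hr, hk⟩
    obtain ⟨ab, ac⟩ := row_eq aw.1 G.1 ft
    exact (hXi _ ar _ hpX ab ac).symm
  have hcard : Q.card = (Q.image Prod.snd).card := by
    rw [card_image_of_injOn]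
    rintro p h p' h' hh
    exact Prod.ext ((heq p h).trans (heq p' h').symm) hh
  have hfin : (Q.image Prod.snd).card <= 2 * ⌊1 / ho⌋₊ + 1 := by
    apply ksmall
    intro k hk k' hk'
    obtain ⟨p, hp, rfl⟩ := mem_image.1 hk
    obtain ⟨p', hp', rfl⟩ := mem_image.1 hk'
    obtain ⟨hpX, am, ak, av, ap, ct, cu⟩ := hQ p hp
    obtain ⟨hpX', σ1', σ2', s1', s2', f1', f2'⟩ := hQ p' hp'
    rw [heq p hp] at ct cu
    rw [heq p' hp'] at f1' f2'
    have aw := hX _ ar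
    have cv : |am - σ1'| <= 2 * n := (abs_sub _ _).trans (by linarith)
    have ch : |ak - σ2'| <= 2 * n := (abs_sub _ _).trans (by linarith)
    obtain ⟨m, dr, hm2⟩ := kdiff (k := p.2) (k' := p'.2) (cv := am - σ1') (ch := ak - σ2') aw.1.cop (by linarith [aw.1.p11])
      (by push_cast; linear_combination ct - f1') (by push_cast; linear_combination cu - f2') (by
        refine lt_of_le_of_lt (det_bd cv ch (by linarith [aw.1.p10]) aw.1.h4) ?_
        have h1 : 6 * (n:Int) * ad 1 1 <= 6 * n * M := by
          have := aw.2
          gcongr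
          linarith
        have := aw.1.p11
        nlinarith)
    refine ⟨m, m_small ah aw.1.p11 ?_ (n_small hMpos hn (hx ad ar) ah), hm2⟩
    rw [<- abs_of_pos (by linarith [aw.1.p11] : 0 < ad 1 1), <- abs_mul, dr]
    exact ch
  rw [hcard]
  calc ((Q.image Prod.snd).card : Real) <= ((2 * ⌊1 / ho⌋₊ + 1 : Nat) : Real) := mod_cast hfin
    _ <= _ := by
        push_cast
        have := Nat.floor_le (by positivity : 0 <= 1 / ho)
        have e : 2 / ho = 2 * (1 / ho) := by ring
        rw [e]; linarith
lemma regime2 {P : Nat} [NeZero P] {κ : Type} {ho : Real} (ah : 0 < ho) {c : Nat} (hcc : 1 <= ho * c) (hPc : 2 * c ^ 8 <= ho * P)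
    (X : Finset aa) (Y : Finset κ) (y : κ -> aa) (Mb : Real) (K : Finset (ZMod P)) (h6c : 1 <= c)
    (hX : ∀ v ∈ X, Good v ∧ v 1 1 <= (c:Int) ^ 4) (hX6 : ∀ v ∈ X, 6 <= v 1 1)
    (hXi : ∀ v ∈ X, ∀ w ∈ X, v 1 0 = w 1 0 -> v 1 1 = w 1 1 -> v = w) (hXn : X.Nonempty)
    (hY : ∀ j ∈ Y, Good (y j) ∧ (y j 1 1 : Real) <= Mb)
    (hYi : ∀ i ∈ Y, ∀ j ∈ Y, y i 0 1 = y j 0 1 -> y i 1 1 = y j 1 1 -> i = j)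
    (hd : ∀ v ∈ X, ∀ j ∈ Y, ho * P <= ((v * y j) 1 1 : Real) ∧ (v * y j) 1 1 <= P)
    (hK : ∀ k ∈ K, ¬ InM P (c ^ 14) k) :
    ∑ k ∈ K, ‖∑ v ∈ X, ∑ j ∈ Y, (ZMod.stdAddChar (k * (((v * y j) 1 1 : Int) : ZMod P)) : Complex)‖ ^ 2
      <= 2304 * (2 / ho + 1) * Mb ^ 2 * X.card * Y.card := by
  rcases Y.eq_empty_or_nonempty with rfl | hYne
  . simp
  obtain ⟨ai, eo, hmax⟩ := exists_max_image Y (fun j => y j 1 1) hYne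
  have ci := (hY ai eo).1
  have hhx : ∀ v ∈ X, v 1 1 * y ai 1 1 <= P ∧ ho * P <= 2 * (y ai 1 1 : Real) * (v 1 1 : Real) := by
    intro v hv
    have h := hd v hv ai eo
    rw [ao] at h
    have p := (hX v hv).1.p10
    have p' := ci.p01
    have cg := (hX v hv).1.h4
    have ex := ci.h2
    constructor
    . have : 0 <= v 1 0 * y ai 0 1 := by positivity
      linarith [h.2]
    . refine h.1.trans ?_
      have : v 1 0 * y ai 0 1 + v 1 1 * y ai 1 1 <= 2 * (y ai 1 1) * v 1 1 := by
        have : v 1 0 * y ai 0 1 <= v 1 1 * y ai 1 1 := by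
          have := (hX v hv).1.p11
          gcongr
        linarith
      exact_mod_cast this
  obtain ⟨fc, gp⟩ := hXn
  have bb : 6 * y ai 1 1 <= P := by
    have h1 := (hhx fc gp).1; have h2 := hX6 fc gp; have h3 := ci.p11
    nlinarith
  have hc4 : (c:Int) ^ 4 <= y ai 1 1 := by
    have h1 := (hhx fc gp).2
    have h2 : (fc 1 1 : Real) <= c ^ 4 := mod_cast (hX fc gp).2
    have h3 : (1:Real) <= y ai 1 1 := mod_cast ci.p11
    have kz : (1:Real) <= c := mod_cast h6c
    have : (c:Real) ^ 4 * (2 * c ^ 4) <= (y ai 1 1 : Real) * (2 * c ^ 4) := by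
      calc (c:Real) ^ 4 * (2 * c ^ 4) = 2 * c ^ 8 := by ring
        _ <= 2 * (y ai 1 1 : Real) * (fc 1 1 : Real) := hPc.trans h1
        _ <= 2 * (y ai 1 1 : Real) * c ^ 4 := by gcongr
        _ = _ := by ring
    have h4 := le_of_mul_le_mul_right this (by positivity)
    exact_mod_cast h4
  have key := sieve (P := P) X (fun v => v 1 0) (fun v => v 1 1) Y (fun j => y j 0 1) (fun j => y j 1 1) hYi (y ai 1 1)
    ci.p11 (fun j hj => ⟨by linarith [(hY j hj).1.p01], (hY j hj).1.h2.trans (hmax j hj), by linarith [(hY j hj).1.p11], hmax j hj⟩) bb K (2 / ho + 1) (by positivity) ?_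
  . simp only [ao] at key ⊢
    refine key.trans ?_
    have h3 : (1:Real) <= y ai 1 1 := mod_cast ci.p11
    have h4 : (y ai 1 1 : Real) ^ 2 <= Mb ^ 2 := by
      have := (hY ai eo).2
      gcongr
    calc _ = 2304 * (2 / ho + 1) * (y ai 1 1 : Real) ^ 2 * X.card * Y.card := by ring
      _ <= _ := by gcongr
  . intro n hn hnP ad ar an ez Q hQ
    exact regime2_fib (c := (c:Int)) ah (mod_cast h6c) (by push_cast; exact hcc) hc4 hX hXi (fun v hv => (hhx v hv).2) hnP ad ar an
      (hK an ez) Q (fun p hp => ⟨(hQ p hp).1, (hQ p hp).2.2⟩)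
end ZD
namespace ZD
open scoped Pointwise
open Finset
lemma parseval1 {P : Nat} [NeZero P] (b : ZMod P -> Complex) :
    ∑ y : ZMod P, ‖∑ w, b w * ZMod.stdAddChar (w * y)‖ ^ 2 = (P : Real) * ∑ w, ‖b w‖ ^ 2 := by
  have key : ((∑ y : ZMod P, ‖∑ w, b w * ZMod.stdAddChar (w * y)‖ ^ 2 : Real) : Complex)
      = (((P : Real) * ∑ w, ‖b w‖ ^ 2 : Real) : Complex) := by
    push_cast
    have ab : ∀ y : ZMod P, ((‖∑ w, b w * ZMod.stdAddChar (w * y)‖ : Complex)) ^ 2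
        = ∑ w, ∑ w', b w * (starRingEnd Complex) (b w') * ZMod.stdAddChar ((w - w') * y) := by
      intro y
      rw [<- Complex.mul_conj', map_sum, sum_mul_sum]
      refine sum_congr rfl fun w _ => sum_congr rfl fun w' _ => ?_
      rw [map_mul (starRingEnd Complex), psi_conj, mul_mul_mul_comm, <- AddChar.map_add_eq_mul]
      congr 2
      ring
    simp_rw [ab]
    rw [sum_comm, mul_sum]
    refine sum_congr rfl fun w _ => ?_
    rw [sum_comm]
    simp_rw [<- mul_sum, psi_sum, sub_eq_zero, mul_ite, mul_zero]
    rw [sum_ite_eq univ w]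
    simp only [mem_univ, if_true]
    rw [Complex.mul_conj', mul_comm]
  exact_mod_cast key
lemma psi_pick {P : Nat} [NeZero P] {Ω : Type*} (Om : Finset Ω) (d : Ω -> ZMod P) (k : ZMod P) :
    ∑ x : ZMod P, ((Om.filter (fun w => d w = x)).card : Complex) * ZMod.stdAddChar (x * k)
      = ∑ w ∈ Om, ZMod.stdAddChar (k * d w) := by
  rw [<- sum_fiberwise Om d]
  refine sum_congr rfl fun x _ => ?_
  rw [sum_congr rfl (g := fun _ => ZMod.stdAddChar (x * k))
    (fun w hw => by rw [(mem_filter.1 hw).2, mul_comm])]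
  simp
lemma fourier_bad {P : Nat} [NeZero P] {Ω τ : Type*} (Om : Finset Ω) (d : Ω -> ZMod P) (Hs : Finset τ)
    (s : τ -> ZMod P) (hH : Hs.Nonempty) (Bad : Finset (ZMod P)) (ρ : Real) (hρ : 0 <= ρ)
    (h1 : ∀ x ∈ Bad, ∀ w ∈ Om, d w ≠ x)
    (h2 : ∀ x ∈ Bad, ρ * Hs.card <= ((Om ×ˢ Hs).filter (fun p => d p.1 + s p.2 = x)).card) :
    Bad.card * ρ ^ 2 * P <= ∑ k : ZMod P, ‖∑ w ∈ Om, (ZMod.stdAddChar (k * d w) : Complex)‖ ^ 2 *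
      ‖1 - (1 / (Hs.card : Complex)) * ∑ t ∈ Hs, ZMod.stdAddChar (k * s t)‖ ^ 2 := by
  classical
  have gr : (0:Real) < Hs.card := mod_cast hH.card_pos
  set b : ZMod P -> Complex := fun x => ((Om.filter (fun w => d w = x)).card : Complex) -
    (1 / (Hs.card : Complex)) * (((Om ×ˢ Hs).filter (fun p => d p.1 + s p.2 = x)).card : Complex) with hb
  have e : ∀ k : ZMod P, ∑ x, b x * ZMod.stdAddChar (x * k) = (∑ w ∈ Om, (ZMod.stdAddChar (k * d w) : Complex)) *
      (1 - (1 / (Hs.card : Complex)) * ∑ t ∈ Hs, ZMod.stdAddChar (k * s t)) := by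
    intro k
    simp only [hb, sub_mul, sum_sub_distrib, mul_assoc, <- mul_sum]
    rw [psi_pick, psi_pick (Om ×ˢ Hs) (fun p => d p.1 + s p.2), sum_product]
    simp only [mul_add, AddChar.map_add_eq_mul, <- mul_sum, <- sum_mul]
    ring
  have h3 := parseval1 b
  simp only [e, norm_mul, mul_pow] at h3 ⊢
  rw [h3, mul_comm (P : Real)]
  gcongr
  calc (Bad.card : Real) * ρ ^ 2 = ∑ x ∈ Bad, ρ ^ 2 := by simp
    _ <= ∑ x ∈ Bad, ‖b x‖ ^ 2 := by
        refine sum_le_sum fun x hx => ?_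
        have : b x = -((((Om ×ˢ Hs).filter (fun p => d p.1 + s p.2 = x)).card / Hs.card : Real) : Complex) := by
          simp only [hb]
          rw [filter_false_of_mem (h1 x hx)]
          push_cast; simp; ring
        rw [this, norm_neg, Complex.norm_real, Real.norm_of_nonneg (by positivity)]
        gcongr
        rw [le_div_iff₀ gr]
        exact h2 x hx
    _ <= _ := sum_le_sum_of_subset_of_nonneg (subset_univ _) (fun _ _ _ => by positivity)
lemma psi_near {P : Nat} [NeZero P] (a : Int) : ‖(ZMod.stdAddChar ((a : Int) : ZMod P) : Complex) - 1‖ <= 2 * Real.pi * |(a:Real)| / P := by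
  rw [ZMod.stdAddChar_coe]
  have : 2 * (Real.pi:Complex) * Complex.I * a / P = Complex.I * ((2 * Real.pi * a / P : Real) : Complex) := by push_cast; ring
  rw [this]
  refine (Real.norm_exp_I_mul_ofReal_sub_one_le).trans ?_
  rw [Real.norm_eq_abs, abs_div, abs_mul, abs_of_pos Real.two_pi_pos, Nat.abs_cast]
lemma avg_le {τ : Type*} (Hs : Finset τ) (hH : Hs.Nonempty) (z : τ -> Complex) (ε : Real) (h : ∀ t ∈ Hs, ‖z t - 1‖ <= ε) :
    ‖1 - (1 / (Hs.card : Complex)) * ∑ t ∈ Hs, z t‖ <= ε := by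
  have gr : (0:Real) < Hs.card := mod_cast hH.card_pos
  have hHc : (Hs.card : Complex) ≠ 0 := mod_cast gr.ne'
  have : 1 - (1 / (Hs.card : Complex)) * ∑ t ∈ Hs, z t = -((1 / (Hs.card : Complex)) * ∑ t ∈ Hs, (z t - 1)) := by
    rw [sum_sub_distrib]; field_simp; simp
  rw [this, norm_neg, norm_mul, norm_div, norm_one, Complex.norm_natCast, div_mul_eq_mul_div, one_mul,
    div_le_iff₀ gr]
  refine (norm_sum_le _ _).trans ((sum_le_sum h).trans ?_)
  simp [mul_comm]
lemma kernel_major {P : Nat} [NeZero P] {H : Nat} {k : ZMod P} (hk : InM P H k) {bu : Nat} (em : ∀ q : Nat, 1 <= q -> q <= H -> q ∣ bu)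
    (Hs : Finset Int) (hH : Hs.Nonempty) (η : Real) (hη : ∀ t ∈ Hs, (bu : Real) * |(t:Real)| <= η * P) :
    ‖1 - (1 / (Hs.card : Complex)) * ∑ t ∈ Hs, ZMod.stdAddChar (k * ((bu * t : Int) : ZMod P))‖ <= 2 * Real.pi * η * H := by
  refine avg_le Hs hH _ _ fun t ht => ?_
  obtain ⟨q, r, dy, hqH, hr, e⟩ := hk
  lift q to Nat using by omega
  obtain ⟨s, hs⟩ := em q (mod_cast dy) (mod_cast hqH)
  have ac : k * ((bu * t : Int) : ZMod P) = ((s * r * t : Int) : ZMod P) := by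
    rw [hs]; push_cast; push_cast at e; rw [<- e]; ring
  rw [ac]
  refine (psi_near _).trans ?_
  have hP : (0:Real) < P := mod_cast NeZero.pos P
  rw [div_le_iff₀ hP]
  have h1 := hη t ht
  have hsq : (s:Real) <= bu := by
    rw [hs]; push_cast
    have : (1:Real) <= q := mod_cast dy
    nlinarith [(Nat.cast_nonneg s : (0:Real) <= s)]
  have hr' : |(r:Real)| <= H := mod_cast hr
  push_cast
  rw [abs_mul, abs_mul, Nat.abs_cast]
  calc 2 * Real.pi * (s * |(r:Real)| * |(t:Real)|) <= 2 * Real.pi * (bu * H * |(t:Real)|) := by gcongr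
    _ = 2 * Real.pi * ((bu * |(t:Real)|) * H) := by ring
    _ <= 2 * Real.pi * ((η * P) * H) := by gcongr
    _ = _ := by ring
lemma card_major {P : Nat} [Fact P.Prime] {H : Nat} (hH : 1 <= H) (hHP : H < P) (K : Finset (ZMod P)) (hK : ∀ k ∈ K, InM P H k) :
    (K.card : Real) <= 3 * (H:Real) ^ 2 := by
  classical
  have : K ⊆ ((Finset.Icc 1 H) ×ˢ (Finset.Icc (-(H:Int)) H)).image (fun p => ((p.2 : Int) : ZMod P) / (p.1 : ZMod P)) := by
    intro k hk
    obtain ⟨q, r, dy, hqH, hr, e⟩ := hK k hk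
    lift q to Nat using by omega
    refine mem_image.2 ⟨(q, r), by simp [abs_le.1 hr]; omega, ?_⟩
    have : (q : ZMod P) ≠ 0 := by
      intro h
      rw [ZMod.natCast_eq_zero_iff] at h
      have := Nat.le_of_dvd (by omega) h
      omega
    push_cast at e
    rw [<- e]
    field_simp
  have h2 := (card_le_card this).trans card_image_le
  rw [card_product] at h2
  simp at h2
  have h3 : (H + 1 + H : Int).toNat = 2 * H + 1 := by omega
  rw [h3] at h2
  have h4 : K.card <= 3 * H ^ 2 := by nlinarith
  exact_mod_cast h4
end ZD
namespace ZD
open scoped Pointwise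
open Finset
abbrev Mq (q : Nat) := Matrix (Fin 2) (Fin 2) (ZMod q)
def red (q : Nat) (g : aa) : Mq q := g.map (Int.cast : Int -> ZMod q)
lemma red_mul (q : Nat) (g h : aa) : red q (g * h) = red q g * red q h :=
  Matrix.map_mul (f := Int.castRingHom (ZMod q))
lemma red_one (q : Nat) : red q 1 = 1 := by
  ext i j; fin_cases i <;> fin_cases j <;> simp [red]
lemma red_pow (q : Nat) (g : aa) (n : Nat) : red q (g ^ n) = red q g ^ n := by
  induction n with
  | zero => simpa using red_one q
  | succ n ih => rw [pow_succ, red_mul, ih, pow_succ]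
lemma red_gen (q a : Nat) : red q (gen a) = !![0, 1; 1, (a : ZMod q)] := by
  ext i j; fin_cases i <;> fin_cases j <;> simp [red, gen]
def WS (A : Finset Nat) (q : Nat) (g : Mq q) : Prop := ∃ n, ∃ w ∈ G A ^ n, red q w = g
lemma WS.mul {A : Finset Nat} {q : Nat} {g h : Mq q} (hg : WS A q g) (hh : WS A q h) : WS A q (g * h) := by
  obtain ⟨n, w, hw, rfl⟩ := hg
  obtain ⟨m, v, hv, rfl⟩ := hh
  exact ⟨n + m, w * v, by rw [pow_add]; exact mul_mem_mul hw hv, red_mul q w v⟩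
lemma WS.one {A : Finset Nat} {q : Nat} : WS A q 1 := ⟨0, 1, by simp, red_one q⟩
lemma WS.pow {A : Finset Nat} {q : Nat} {g : Mq q} (hg : WS A q g) (n : Nat) : WS A q (g ^ n) := by
  induction n with
  | zero => simpa using WS.one
  | succ n ih => rw [pow_succ]; exact ih.mul hg
lemma WS.gen {A : Finset Nat} {q a : Nat} (ha : a ∈ A) : WS A q !![0, 1; 1, (a : ZMod q)] :=
  ⟨1, ZD.gen a, by rw [pow_one]; exact mem_image_of_mem _ ha, red_gen q a⟩
lemma gen_order (q a : Nat) [NeZero q] : ∃ e, 1 <= e ∧ (!![0, 1; 1, (a : ZMod q)] : Mq q) ^ e = 1 := by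
  have hu : IsUnit (!![0, 1; 1, (a : ZMod q)] : Mq q) := by
    rw [Matrix.isUnit_iff_isUnit_det]; simp [Matrix.det_fin_two_of]
  obtain ⟨u, hu⟩ := hu
  obtain ⟨e, he, h⟩ := isOfFinOrder_iff_pow_eq_one.1 (isOfFinOrder_of_finite u)
  exact ⟨e, he, by rw [<- hu, <- Units.val_pow_eq_pow_val, h]; rfl⟩
lemma WS.elem {A : Finset Nat} {q : Nat} [NeZero q] (h1 : 1 ∈ A) (h2 : 2 ∈ A) (x : ZMod q) :
    WS A q !![1, x; 0, 1] ∧ WS A q !![1, 0; x, 1] := by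
  obtain ⟨e, he, h⟩ := gen_order q 1
  obtain ⟨e, rfl⟩ : ∃ f, e = f + 1 := ⟨e - 1, by omega⟩
  have cn : WS A q _ := WS.gen (q := q) h1
  have dn : WS A q _ := WS.gen (q := q) h2
  set bp : Mq q := !![0, 1; 1, ((1:Nat) : ZMod q)] with ma
  set br : Mq q := !![0, 1; 1, ((2:Nat) : ZMod q)] with mb
  have ab : bp ^ e * br = !![1, 1; 0, 1] := by
    have : br = bp * !![1, 1; 0, 1] := by
      rw [ma, mb, Matrix.mul_fin_two]; ext i j; fin_cases i <;> fin_cases j <;> norm_num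
    rw [this, <- mul_assoc, <- pow_succ, h, one_mul]
  have ac : br * bp ^ e = !![1, 0; 1, 1] := by
    have : br = !![1, 0; 1, 1] * bp := by
      rw [ma, mb, Matrix.mul_fin_two]; ext i j; fin_cases i <;> fin_cases j <;> norm_num
    rw [this, mul_assoc, <- pow_succ', h, mul_one]
  have key : ∀ n : Nat, WS A q !![1, (n : ZMod q); 0, 1] ∧ WS A q !![1, 0; (n : ZMod q), 1] := by
    intro n
    induction n with
    | zero => constructor <;> simpa [<- Matrix.one_fin_two] using WS.one
    | succ n ih =>
      constructor
      . have := ih.1.mul ((cn.pow e).mul dn)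
        rw [ab, Matrix.mul_fin_two] at this
        convert this using 1
        ext i j; fin_cases i <;> fin_cases j <;> simp [add_comm]
      . have := ih.2.mul (dn.mul (cn.pow e))
        rw [ac, Matrix.mul_fin_two] at this
        convert this using 1
        ext i j; fin_cases i <;> fin_cases j <;> simp
  have := key x.val
  rwa [ZMod.natCast_zmod_val] at this
lemma unit_shift {q : Nat} [NeZero q] (c d x y : ZMod q) (h : x * c + y * d = 1) : ∃ t, IsUnit (d + t * c) := by
  set t := ∏ p ∈ q.primeFactors.filter (fun p => ¬ p ∣ d.val), p with ht
  refine ⟨t, ?_⟩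
  have e : d + (t : ZMod q) * c = ((d.val + t * c.val : Nat) : ZMod q) := by push_cast; simp
  rw [e, ZMod.isUnit_iff_coprime]
  refine Nat.Coprime.symm (Nat.coprime_of_dvd fun p hp hpq hpd => ?_)
  have hpt : p ∣ t ↔ ¬ p ∣ d.val := by
    rw [ht, Prime.dvd_finsetProd_iff hp.prime]
    constructor
    . rintro ⟨r, hr, hpr⟩
      rw [mem_filter] at hr
      rw [(Nat.prime_dvd_prime_iff_eq hp (Nat.prime_of_mem_primeFactors hr.1)).1 hpr]
      exact hr.2
    . intro hd
      exact ⟨p, by simp [hp, hpq, hd, NeZero.ne q], dvd_rfl⟩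
  by_cases hd : p ∣ d.val
  . have h3 : p ∣ t * c.val := (Nat.dvd_add_right hd).1 hpd
    have h4 : p ∣ c.val := (hp.dvd_mul.1 h3).resolve_left (fun h => (hpt.1 h) hd)
    have hh := congrArg (ZMod.castHom hpq (ZMod p)) h
    have ah : ZMod.castHom hpq (ZMod p) c = 0 := by
      rw [<- ZMod.natCast_zmod_val c, map_natCast]; exact (ZMod.natCast_eq_zero_iff _ _).2 h4
    have mc : ZMod.castHom hpq (ZMod p) d = 0 := by
      rw [<- ZMod.natCast_zmod_val d, map_natCast]; exact (ZMod.natCast_eq_zero_iff _ _).2 hd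
    have := Fact.mk hp
    rw [map_add, map_mul, map_mul, ah, mc, map_one] at hh
    simp at hh
  . have h4 : p ∣ t * c.val := (hpt.2 hd).mul_right _
    exact hd ((Nat.dvd_add_left h4).1 hpd)
lemma WS.unit {A : Finset Nat} {q : Nat} [NeZero q] (h1 : 1 ∈ A) (h2 : 2 ∈ A) (a b c d : ZMod q) (hdet : a * d - b * c = 1)
    (hd : IsUnit d) : WS A q !![a, b; c, d] := by
  obtain ⟨v, hv⟩ := hd.exists_right_inv
  have e := fun x => WS.elem (A := A) (q := q) h1 h2 x
  set s := (1 - b) * v with hs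
  have hs' : b + s * d = 1 := by rw [hs]; linear_combination (1 - b) * hv
  set c' := c + (1 - d) * (a + s * c) with hc'
  have := ((e (-s)).1.mul (e (d - 1)).2).mul ((e 1).1.mul (e c').2)
  convert this using 1
  have hac : a + s * c - c' = 1 := by
    rw [hc']; linear_combination hdet + c * hs'
  simp only [Matrix.mul_fin_two]
  ext i j
  fin_cases i <;> fin_cases j <;> simp
  . linear_combination (1 - s * (d - 1)) * hac + s * hc'
  . linear_combination hs'
  . linear_combination (d - 1) * hac - hc'
lemma WS.all {A : Finset Nat} {q : Nat} [NeZero q] (h1 : 1 ∈ A) (h2 : 2 ∈ A) (g : Mq q) (hg : g.det = 1 ∨ g.det = -1) :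
    WS A q g := by
  have key : ∀ a b c d : ZMod q, a * d - b * c = 1 -> WS A q !![a, b; c, d] := by
    intro a b c d hdet
    obtain ⟨t, ht⟩ := unit_shift c d (-b) a (by linear_combination hdet)
    have := (WS.unit h1 h2 a (b + t * a) c (d + t * c) (by linear_combination hdet) ht).mul
      (WS.elem h1 h2 (-t)).1
    convert this using 1
    rw [Matrix.mul_fin_two]
    ext i j; fin_cases i <;> fin_cases j <;> simp <;> ring
  rw [Matrix.eta_fin_two g] at hg ⊢
  simp only [Matrix.det_fin_two_of] at hg
  rcases hg with hg | hg
  . exact key _ _ _ _ hg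
  . have := (WS.gen (q := q) h1).mul (key (g 1 0 - g 0 0) (g 1 1 - g 0 1) (g 0 0) (g 0 1) (by linear_combination -hg))
    convert this using 1
    rw [Matrix.mul_fin_two]
    ext i j; fin_cases i <;> fin_cases j <;> simp 
end ZD
namespace ZD
open scoped Pointwise
open Finset
open Classical in
noncomputable def WQ (q : Nat) [NeZero q] : Finset (Mq q) := univ.filter (fun g => g.det = 1 ∨ g.det = -1)
lemma mem_WQ {q : Nat} [NeZero q] {g : Mq q} : g ∈ WQ q ↔ g.det = 1 ∨ g.det = -1 := by simp [WQ]
lemma kill {R : Type*} [CommRing R] {c d x y α β : R} (h : x * c + y * d = 1) (h1 : α * d = β * c)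
    (h2 : α * x + β * y = 0) : α = 0 ∧ β = 0 := by
  constructor
  . linear_combination (-α) * h + c * h2 + y * h1
  . linear_combination (-β) * h + d * h2 - x * h1
lemma det_card (q : Nat) [NeZero q] (ε : ZMod q) (hε : ε * ε = 1) [DecidablePred fun g : Mq q => g.det = ε] :
    (univ.filter (fun g : Mq q => g.det = ε)).card <= q ^ 3 := by
  classical
  have hex : ∀ p : ZMod q × ZMod q, ∃ r : ZMod q × ZMod q, (∃ x y, x * p.1 + y * p.2 = 1) -> r.1 * p.1 + r.2 * p.2 = 1 := by
    intro p
    by_cases h : ∃ x y, x * p.1 + y * p.2 = 1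
    . obtain ⟨x, y, h⟩ := h; exact ⟨(x, y), fun _ => h⟩
    . exact ⟨0, fun h' => absurd h' h⟩
  choose r hr using hex
  have : (univ.filter (fun g : Mq q => g.det = ε)).card <=
      (univ : Finset (ZMod q × ZMod q × ZMod q)).card := by
    refine card_le_card_of_injOn (fun g => (g 1 0, g 1 1, g 0 0 * (r (g 1 0, g 1 1)).1 + g 0 1 * (r (g 1 0, g 1 1)).2))
      (fun _ _ => by simp) ?_
    intro g hg h hh e
    simp only [coe_filter, mem_univ, true_and, Set.mem_ofPred_eq, Matrix.det_fin_two] at hg hh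
    simp only [Prod.mk.injEq] at e
    obtain ⟨ab, ac, bv⟩ := e
    have la := hr (g 1 0, g 1 1) ⟨-(g 0 1) * ε, g 0 0 * ε, by simp only; linear_combination ε * hg + hε⟩
    simp only at la
    rw [ab, ac] at bv la hg
    obtain ⟨ed, ee⟩ := kill (α := g 0 0 - h 0 0) (β := g 0 1 - h 0 1) la (by linear_combination hg - hh)
      (by linear_combination bv)
    ext i j
    fin_cases i <;> fin_cases j
    . exact sub_eq_zero.1 ed
    . exact sub_eq_zero.1 ee
    . exact ab
    . exact ac
  refine this.trans (le_of_eq ?_)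
  simp [ZMod.card]; ring
lemma WQ_card (q : Nat) [NeZero q] : (WQ q).card <= 2 * q ^ 3 := by
  classical
  have h1 := det_card q 1 (by ring)
  have h2 := det_card q (-1) (by ring)
  rw [WQ, filter_or]
  refine (card_union_le _ _).trans ?_
  rw [two_mul]
  convert add_le_add h1 h2
open Classical in
lemma WQ_lower (q : Nat) [NeZero q] (d : ZMod q) :
    q * (univ.filter (fun c : ZMod q => ∃ x y, x * c + y * d = 1)).card <=
      ((WQ q).filter (fun g => g 1 1 = d)).card := by
  have hex : ∀ c : ZMod q, ∃ r : ZMod q × ZMod q, (∃ x y, x * c + y * d = 1) -> r.1 * c + r.2 * d = 1 := by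
    intro c
    by_cases h : ∃ x y, x * c + y * d = 1
    . obtain ⟨x, y, h⟩ := h; exact ⟨(x, y), fun _ => h⟩
    . exact ⟨0, fun h' => absurd h' h⟩
  choose r hr using hex
  have := card_le_card_of_injOn (s := (univ : Finset (ZMod q)) ×ˢ
    (univ.filter (fun c : ZMod q => ∃ x y, x * c + y * d = 1))) (t := (WQ q).filter (fun g => g 1 1 = d))
    (fun p => !![(r p.2).2 + p.1 * p.2, -(r p.2).1 + p.1 * d; p.2, d]) ?_ ?_
  . rw [card_product] at this
    simpa [ZMod.card] using this
  . rintro ⟨s, c⟩ h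
    simp only [coe_product, Set.mem_prod, mem_coe, mem_filter, mem_univ, true_and] at h ⊢
    refine ⟨mem_WQ.2 (Or.inl ?_), by simp⟩
    rw [Matrix.det_fin_two_of]
    linear_combination hr c h
  . rintro ⟨s, c⟩ h ⟨s', c'⟩ h' e
    simp only [coe_product, Set.mem_prod, mem_coe, mem_filter, mem_univ, true_and] at h h'
    have md := congrFun (congrFun e 1) 0
    simp at md
    subst md
    have me := congrFun (congrFun e 0) 0
    have mf := congrFun (congrFun e 0) 1
    simp at me mf
    have := hr c h
    rw [Prod.mk.injEq]
    refine ⟨?_, rfl⟩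
    linear_combination (-s + s') * this + (r c).1 * me + (r c).2 * mf
lemma coprime_count (q D : Nat) (hq : 0 < q) (hD : D ∣ q) : (D.totient : Real) / D * q <= ((range q).filter (fun n => D.Coprime n)).card := by
  obtain ⟨m, rfl⟩ := hD
  have ft : 0 < D := Nat.pos_of_mul_pos_right hq
  have h := card_le_card_of_injOn (s := (range m) ×ˢ ((range D).filter (fun n => D.Coprime n)))
    (t := (range (D * m)).filter (fun n => D.Coprime n)) (fun p => p.2 + D * p.1) ?_ ?_
  . rw [card_product, card_range, <- Nat.totient_eq_card_coprime] at h
    have h' : ((m * D.totient : Nat) : Real) <= _ := Nat.cast_le.2 h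
    refine le_trans (le_of_eq ?_) h'
    have : (D:Real) ≠ 0 := by positivity
    push_cast; field_simp
  . rintro ⟨s, x⟩ h
    simp only [coe_product, Set.mem_prod, mem_coe, mem_filter, mem_range] at h ⊢
    obtain ⟨h1, h2, h3⟩ := h
    refine ⟨by nlinarith, by simpa using h3⟩
  . rintro ⟨s, x⟩ h ⟨s', x'⟩ h' e
    simp only [coe_product, Set.mem_prod, mem_coe, mem_filter, mem_range] at h h' e
    have ab := congrArg (· % D) e
    have ac := congrArg (· / D) e
    simp [Nat.mod_eq_of_lt h.2.1, Nat.mod_eq_of_lt h'.2.1] at ab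
    simp [Nat.add_mul_div_left _ _ ft, Nat.div_eq_of_lt h.2.1, Nat.div_eq_of_lt h'.2.1] at ac
    rw [ab, ac]
lemma totient_lower (D : Nat) (hD : 0 < D) (L : Real) (h : ∑ p ∈ D.primeFactors, (1 / (p:Real)) <= L) :
    Real.exp (-2 * L) <= (D.totient : Real) / D := by
  have h1 : (D.totient : Real) = D * ∏ p ∈ D.primeFactors, (1 - (p:Real)⁻¹) := by
    have := congrArg (Rat.cast : Rat -> Real) (Nat.totient_eq_mul_prod_factors D)
    push_cast at this; exact this
  have hD' : (D:Real) ≠ 0 := by positivity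
  rw [h1, mul_div_cancel_left₀ _ hD']
  calc Real.exp (-2 * L) <= Real.exp (∑ p ∈ D.primeFactors, (-2 * (1 / (p:Real)))) := by
        rw [<- mul_sum]; exact Real.exp_le_exp.2 (by linarith)
    _ = ∏ p ∈ D.primeFactors, Real.exp (-2 * (1 / (p:Real))) := Real.exp_sum _ _
    _ <= _ := by
        refine prod_le_prod (fun _ _ => by positivity) fun p hp => ?_
        have h2 : (2:Real) <= p := mod_cast (Nat.prime_of_mem_primeFactors hp).two_le
        rw [<- one_div]
        set x := 1 / (p:Real) with hx
        have gs : 0 <= x := by positivity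
        have fg : x <= 1/2 := by rw [hx]; gcongr
        have h3 := Real.add_one_le_exp (2 * x)
        rw [neg_mul, Real.exp_neg, inv_le_comm₀ (by positivity) (by linarith)]
        refine le_trans ?_ h3
        rw [inv_le_iff_one_le_mul₀ (by linarith)]
        nlinarith
open Classical in
lemma N_lower (q : Nat) [NeZero q] (d : Nat) (hd : 0 < d) (L : Real) (h : ∑ p ∈ d.primeFactors, (1 / (p:Real)) <= L) :
    (q:Real) ^ 2 * Real.exp (-2 * L) <= ((WQ q).filter (fun g => g 1 1 = (d : ZMod q))).card := by
  set D := Nat.gcd d q with hDdef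
  have hD : 0 < D := Nat.gcd_pos_of_pos_left _ hd
  have h1 : ∑ p ∈ D.primeFactors, (1 / (p:Real)) <= L := by
    refine le_trans (sum_le_sum_of_subset_of_nonneg ?_ (fun _ _ _ => by positivity)) h
    exact Nat.primeFactors_mono (Nat.gcd_dvd_left _ _) hd.ne'
  have h2 := totient_lower D hD L h1
  have h3 := coprime_count q D (NeZero.pos q) (Nat.gcd_dvd_right _ _)
  have h4 : ((range q).filter (fun n => D.Coprime n)).card <=
      (univ.filter (fun c : ZMod q => ∃ x y, x * c + y * (d : ZMod q) = 1)).card := by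
    refine card_le_card_of_injOn (fun n => (n : ZMod q)) ?_ ?_
    . intro n hn
      simp only [mem_coe, mem_filter, mem_univ, true_and] at hn ⊢
      have ab := Nat.gcd_eq_gcd_ab d q
      have ac := Nat.gcd_eq_gcd_ab D n
      rw [<- hDdef] at ab
      rw [hn.2] at ac
      have e1' := congrArg (Int.cast : Int -> ZMod q) ab
      have e2' := congrArg (Int.cast : Int -> ZMod q) ac
      push_cast at e1' e2'
      simp only [CharP.cast_eq_zero, zero_mul, add_zero] at e1'
      exact ⟨(D.gcdB n : Int), (d.gcdA q : Int) * (D.gcdA n : Int), by rw [e2', e1']; ring⟩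
    . intro n hn m hm e
      simp only [mem_coe, mem_filter, mem_range] at hn hm
      simp only at e
      rw [ZMod.natCast_eq_natCast_iff'] at e
      rwa [Nat.mod_eq_of_lt hn.1, Nat.mod_eq_of_lt hm.1] at e
  have ay := WQ_lower q (d : ZMod q)
  have hq : (0:Real) < q := mod_cast NeZero.pos q
  calc (q:Real) ^ 2 * Real.exp (-2 * L) <= (q:Real) ^ 2 * ((D.totient : Real) / D) := by gcongr
    _ = q * ((D.totient : Real) / D * q) := by ring
    _ <= q * (univ.filter (fun c : ZMod q => ∃ x y, x * c + y * (d : ZMod q) = 1)).card := by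
        gcongr; exact h3.trans (mod_cast h4)
    _ <= _ := mod_cast ay
lemma markov (N : Nat) (L : Real) : L * ((Finset.Ioc 0 N).filter (fun d : Nat => L < ∑ p ∈ d.primeFactors, (1 / (p:Real)))).card <= N := by
  have h1 : L * ((Finset.Ioc 0 N).filter (fun d : Nat => L < ∑ p ∈ d.primeFactors, (1 / (p:Real)))).card <=
      ∑ d ∈ Finset.Ioc 0 N, ∑ p ∈ d.primeFactors, (1 / (p:Real)) := by
    rw [mul_comm, <- nsmul_eq_mul, <- sum_const]
    refine (sum_le_sum fun d hd => (mem_filter.1 hd).2.le).trans ?_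
    exact sum_le_sum_of_subset_of_nonneg (filter_subset _ _) (fun _ _ _ => sum_nonneg fun _ _ => by positivity)
  refine h1.trans ?_
  have h2 : ∀ d ∈ Finset.Ioc 0 N, ∑ p ∈ d.primeFactors, (1 / (p:Real)) <= ∑ e ∈ Finset.Ioc 1 N, if e ∣ d then (1 / (e:Real)) else 0 := by
    intro d hd
    rw [mem_Ioc] at hd
    rw [<- sum_filter]
    refine sum_le_sum_of_subset_of_nonneg ?_ (fun _ _ _ => by positivity)
    intro p hp
    have hp' := Nat.prime_of_mem_primeFactors hp
    have hpd := Nat.dvd_of_mem_primeFactors hp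
    have := Nat.le_of_dvd hd.1 hpd
    rw [mem_filter, mem_Ioc]
    exact ⟨⟨hp'.one_lt, by omega⟩, hpd⟩
  refine (sum_le_sum h2).trans ?_
  rw [sum_comm]
  have h3 : ∀ e ∈ Finset.Ioc 1 N, (∑ d ∈ Finset.Ioc 0 N, if e ∣ d then (1 / (e:Real)) else 0) <= N * ((e:Real) ^ 2)⁻¹ := by
    intro e he
    rw [mem_Ioc] at he
    have ku : (0:Real) < e := mod_cast (by omega : 0 < e)
    rw [<- sum_filter, sum_const, Nat.Ioc_filter_dvd_card_eq_div, nsmul_eq_mul]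
    have : ((N / e : Nat) : Real) <= N / e := Nat.cast_div_le
    calc ((N / e : Nat) : Real) * (1 / e) <= N / e * (1 / e) := by gcongr
      _ = _ := by field_simp
  refine (sum_le_sum h3).trans ?_
  rw [<- mul_sum]
  rcases Nat.lt_or_ge N 1 with h | h
  . interval_cases N; simp
  . have := sum_Ioc_inv_sq_le_sub (α := Real) one_ne_zero h
    have h4 : ∑ e ∈ Finset.Ioc 1 N, ((e:Real) ^ 2)⁻¹ <= 1 := by
      have ay : (0:Real) <= (N:Real)⁻¹ := by positivity
      simp only [Nat.cast_one, inv_one] at this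
      linarith
    calc (N:Real) * _ <= N * 1 := by gcongr
      _ = N := mul_one _
end ZD
namespace ZD
open scoped Pointwise
open Finset
lemma silver_pow (p : Nat) : ∃ a b : Int, 1 <= a ∧ 0 <= b ∧ (1 <= p -> 1 <= b) ∧ (1 + √2) ^ p = a + b * √2 := by
  induction p with
  | zero => exact ⟨1, 0, by norm_num, le_rfl, by simp, by simp⟩
  | succ p ih =>
    obtain ⟨a, b, ha, hb, -, e⟩ := ih
    refine ⟨a + 2 * b, a + b, by omega, by omega, fun _ => by omega, ?_⟩
    have h2 : √2 * √2 = 2 := Real.mul_self_sqrt (by norm_num)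
    rw [pow_succ, e]; push_cast; linear_combination (b:Real) * h2
lemma gs_ne (r p : Nat) (hr : 1 <= r) (hp : 1 <= p) : Real.goldenRatio ^ r ≠ (1 + √2) ^ p := by
  intro h
  obtain ⟨a, b, ha, -, hb, e⟩ := silver_pow p
  have hb := hb hp
  rw [e, <- Real.fib_succ_sub_goldenConj_mul_fib] at h
  have hF : (1:Int) <= (Nat.fib r : Int) := mod_cast Nat.fib_pos.2 hr
  set F : Int := (Nat.fib r : Int) with hFd
  set X : Int := 2 * a - 2 * (Nat.fib (r+1) : Int) + F with hX
  have hFR : (Nat.fib r : Real) = (F:Real) := by simp [hFd]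
  have h1 : (F:Real) * √5 = X + 2 * b * √2 := by
    rw [hX]; push_cast; rw [Real.goldenConj, hFR] at h; linear_combination 2 * h
  have ap : √2 * √2 = 2 := Real.mul_self_sqrt (by norm_num)
  have lb : √5 * √5 = 5 := Real.mul_self_sqrt (by norm_num)
  have h2 : (5 * F ^ 2 : Real) = X ^ 2 + 8 * b ^ 2 + 4 * b * X * √2 := by
    linear_combination ((F:Real) * √5 + X + 2 * b * √2) * h1 - (F:Real)^2 * lb + 4 * (b:Real)^2 * ap
  by_cases df : X = 0
  . rw [df] at h1
    have h3 : √((10:Nat):Real) = ((4 * b / F : Rat) : Real) := by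
      have hF0 : (0:Real) < F := mod_cast hF
      have fi : (0:Real) < b := mod_cast hb
      have h4 : ((10:Nat):Real) = (4 * b / F) ^ 2 := by
        rw [div_pow, eq_div_iff (by positivity)]
        rw [df] at h2; push_cast at h2 ⊢; linear_combination 2 * h2
      rw [h4, Real.sqrt_sq (by positivity)]; push_cast; rfl
    have h4 : Irrational √((10:Nat):Real) := by
      rw [irrational_sqrt_natCast_iff]
      rintro ⟨k, hk⟩
      have : k <= 3 := by nlinarith
      interval_cases k <;> omega
    exact h4 ⟨_, h3.symm⟩
  . have fi : (b:Real) ≠ 0 := mod_cast (by omega : b ≠ 0)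
    have hX0' : (X:Real) ≠ 0 := mod_cast df
    apply irrational_sqrt_two
    refine ⟨(5 * F^2 - X^2 - 8 * b^2) / (4 * b * X), ?_⟩
    push_cast
    rw [div_eq_iff (by positivity)]
    linear_combination h2
lemma log_irr : Irrational (Real.log Real.goldenRatio / Real.log (1 + √2)) := by
  rintro ⟨x, hx⟩
  have cf : 0 < Real.log Real.goldenRatio := Real.log_pos Real.one_lt_goldenRatio
  have h2 : (1:Real) < 1 + √2 := by have := Real.sqrt_pos.2 (two_pos : (0:Real) < 2); linarith
  have cp : 0 < Real.log (1 + √2) := Real.log_pos h2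
  have gs : 0 < (x:Real) := by rw [hx]; positivity
  have hxq : 0 < x := mod_cast gs
  have hnum : 0 < x.num := Rat.num_pos.2 hxq
  have hd := x.den_pos
  refine gs_ne x.den x.num.toNat hd (by omega) ?_
  apply Real.log_injOn_pos (Set.mem_Ioi.2 (pow_pos Real.goldenRatio_pos _)) (Set.mem_Ioi.2 (by positivity))
  rw [Real.log_pow, Real.log_pow]
  have h3 : ((x.num.toNat : Nat) : Real) = (x.num : Real) := by
    have : ((x.num.toNat : Nat) : Int) = x.num := Int.toNat_of_nonneg hnum.le
    exact_mod_cast congrArg (Int.cast : Int -> Real) this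
  have h4 : (x:Real) = x.num / x.den := mod_cast congrArg (Rat.cast : Rat -> Real) (Rat.num_div_den x).symm
  rw [h3]
  rw [h4, div_eq_div_iff (by positivity) cp.ne'] at hx
  linarith
lemma walk {α β δ : Real} (hα : 0 < α) (hβ : 0 < β) (hδ : 0 < δ) (hirr : Irrational (α / β)) (an : Nat) :
    ∃ cs : Real, ∀ x ≥ cs, ∃ k l : Nat, an <= k ∧ an <= l ∧ x - δ < k * α + l * β ∧ k * α + l * β <= x := by
  obtain ⟨θ, hθ, hθ1⟩ := (dense_addSubgroupClosure_pair_iff.2 hirr).exists_mem_open (isOpen_Ioo (a := 0) (b := δ))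
    ⟨δ/2, by constructor <;> linarith⟩
  obtain ⟨m, n, hmn⟩ := AddSubgroup.mem_closure_pair.1 hθ
  simp only [zsmul_eq_mul] at hmn
  obtain ⟨lc, hθδ⟩ := hθ1
  set s := ⌊α / θ⌋₊ with hs
  set bf : Nat := an + n.natAbs * s with gu
  set dw : Nat := an + m.natAbs * s with hm0
  refine ⟨bf * β + dw * α, fun x hx => ?_⟩
  set K := ⌊(x - bf * β) / α⌋₊ with hK
  have hKm : dw <= K := Nat.le_floor (by rw [le_div_iff₀ hα]; linarith)
  have hnn : 0 <= (x - bf * β) / α := by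
    have : 0 <= (dw:Real) * α := by positivity
    apply div_nonneg <;> linarith
  have hK1 : (K:Real) * α <= x - bf * β := by
    have := Nat.floor_le hnn
    rwa [le_div_iff₀ hα] at this
  have ly : x - bf * β < (K + 1) * α := by
    have := Nat.lt_floor_add_one ((x - bf * β) / α)
    rwa [div_lt_iff₀ hα] at this
  set y := x - bf * β - K * α with hy
  set t := ⌊y / θ⌋₊ with ht
  have eg : 0 <= y := by linarith
  have hts : t <= s := by
    apply Nat.floor_le_floor
    gcongr; linarith
  have lz : (t:Real) * θ <= y := by
    have := Nat.floor_le (div_nonneg eg lc.le)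
    rwa [le_div_iff₀ lc] at this
  have ht2 : y < (t + 1) * θ := by
    have := Nat.lt_floor_add_one (y / θ)
    rwa [div_lt_iff₀ lc] at this
  have bm : ∀ z : Int, -((z.natAbs * s : Nat) : Int) <= z * t := by
    intro z
    have h1 : |z * t| <= |z| * s := by
      rw [abs_mul, Nat.abs_cast]
      exact mul_le_mul_of_nonneg_left (mod_cast hts) (abs_nonneg z)
    push_cast
    linarith [neg_abs_le (z * t)]
  have bl := bm m
  have bx := bm n
  refine ⟨(K + m * t : Int).toNat, (bf + n * t : Int).toNat, by omega, by omega, ?_⟩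
  have bg : (((K + m * t : Int).toNat : Nat) : Real) = K + m * t := by
    have : (((K + m * t : Int).toNat : Nat) : Int) = K + m * t := Int.toNat_of_nonneg (by omega)
    exact_mod_cast congrArg (Int.cast : Int -> Real) this
  have dv : (((bf + n * t : Int).toNat : Nat) : Real) = bf + n * t := by
    have : (((bf + n * t : Int).toNat : Nat) : Int) = bf + n * t := Int.toNat_of_nonneg (by omega)
    exact_mod_cast congrArg (Int.cast : Int -> Real) this
  rw [bg, dv]
  have e : ((K:Real) + m * t) * α + (bf + n * t) * β = x - y + t * θ := by rw [hy, <- hmn]; ring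
  rw [e]
  constructor <;> linarith
lemma gen_pow (a : Nat) (l m : Real) (h1 : l + m = a) (h2 : l * m = -1) (k : Nat) :
    (l - m) * ((gen a ^ k) 0 0 : Real) = l ^ k * (-m) + m ^ k * l ∧
    (l - m) * ((gen a ^ k) 0 1 : Real) = l ^ k - m ^ k ∧
    (l - m) * ((gen a ^ k) 1 0 : Real) = l ^ k - m ^ k ∧
    (l - m) * ((gen a ^ k) 1 1 : Real) = l ^ k * l - m ^ k * m := by
  induction k with
  | zero => simp; ring
  | succ k ih =>
    obtain ⟨ef, dm, fu, mg⟩ := ih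
    rw [pow_succ]
    simp only [et, dg, cw, ao, dt, dh, du, di]
    push_cast
    refine ⟨?_, ?_, ?_, ?_⟩
    . linear_combination dm + (l ^ k - m ^ k) * h2
    . linear_combination ef + a * dm - (l ^ k - m ^ k) * h1
    . linear_combination mg
    . linear_combination fu + a * mg - (l^k*l - m^k*m) * h1 + (l^k - m^k) * h2
lemma gen_lim (a : Nat) (l m : Real) (h1 : l + m = a) (h2 : l * m = -1) (hl : 1 < l) : ∃ κ > 0, ∀ i j : Fin 2,
    Tendsto (fun k => ((gen a ^ k) i j : Real) / l ^ k) atTop (nhds (κ * (![1, l] i) * (![1, l] j))) := by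
  have hm : m = -(1/l) := by field_simp; linarith
  have gu : 0 < l := by linarith
  have hinv : 1/l < 1 := by rw [div_lt_one gu]; exact hl
  have hinv0 : 0 < 1/l := by positivity
  have hm0 : 0 < -m := by rw [hm]; linarith
  have hlm : 0 < l - m := by linarith
  have hr : Tendsto (fun k : Nat => (m / l) ^ k) atTop (nhds 0) := by
    apply tendsto_pow_atTop_nhds_zero_of_abs_lt_one
    rw [abs_div, abs_of_pos gu, div_lt_one gu, abs_of_neg (by linarith)]
    linarith
  refine ⟨-m / (l - m), by positivity, ?_⟩
  have key : ∀ (i j : Fin 2) (p r : Real), (∀ k : Nat, (l - m) * ((gen a ^ k) i j : Real) = l ^ k * p + m ^ k * r) ->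
      Tendsto (fun k => ((gen a ^ k) i j : Real) / l ^ k) atTop (nhds (p / (l - m))) := by
    intro i j p r h
    have e : (fun k : Nat => ((gen a ^ k) i j : Real) / l ^ k) = fun k => (p + (m / l) ^ k * r) / (l - m) := by
      funext k
      have := h k
      rw [div_pow, div_eq_div_iff (by positivity) hlm.ne', mul_comm, this]
      field_simp
    rw [e]
    have := ((hr.mul_const r).const_add p).div_const (l - m)
    simpa using this
  intro i j
  fin_cases i <;> fin_cases j
  . simpa using key 0 0 (-m) l (fun k => (gen_pow a l m h1 h2 k).1)
  . have := key 0 1 1 (-1) (fun k => by rw [(gen_pow a l m h1 h2 k).2.1]; ring)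
    have e : -m/(l-m)*1*l = 1/(l-m) := by rw [div_mul_eq_mul_div, div_mul_eq_mul_div]; congr 1; linear_combination -h2
    rw [<- e] at this; exact this
  . have := key 1 0 1 (-1) (fun k => by rw [(gen_pow a l m h1 h2 k).2.2.1]; ring)
    have e : -m/(l-m)*l*1 = 1/(l-m) := by rw [div_mul_eq_mul_div, div_mul_eq_mul_div]; congr 1; linear_combination -h2
    rw [<- e] at this; exact this
  . have := key 1 1 l (-m) (fun k => by rw [(gen_pow a l m h1 h2 k).2.2.2]; ring)
    have e : -m/(l-m)*l*l = l/(l-m) := by rw [div_mul_eq_mul_div, div_mul_eq_mul_div]; congr 1; linear_combination (-l) * h2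
    rw [<- e] at this; exact this
noncomputable def VV (a b : Fin 2) : Real := (![1, Real.goldenRatio] a) * (![1, 1 + √2] b)
lemma VV_pos (a b : Fin 2) : 0 < VV a b := by
  have := Real.goldenRatio_pos
  fin_cases a <;> fin_cases b <;> simp [VV] <;> positivity
lemma sandwich_lim (w : aa) (hw : ∀ i j, 0 <= w i j) (hw1 : 0 < w 1 1) : ∃ ρ > 0, ∀ a b : Fin 2,
    Tendsto (fun p : Nat × Nat => ((gen 1 ^ p.1 * w * gen 2 ^ p.2) a b : Real) /
      (Real.goldenRatio ^ p.1 * (1 + √2) ^ p.2)) (atTop ×ˢ atTop) (nhds (ρ * VV a b)) := by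
  have ap : √2 * √2 = 2 := Real.mul_self_sqrt (by norm_num)
  have s20 : 0 < √2 := Real.sqrt_pos.2 two_pos
  have hφ := Real.goldenRatio_pos
  obtain ⟨κ, hκ, h1⟩ := gen_lim 1 Real.goldenRatio Real.goldenConj (by simp [Real.goldenRatio_add_goldenConj])
    Real.goldenRatio_mul_goldenConj Real.one_lt_goldenRatio
  obtain ⟨κ', hκ', h2⟩ := gen_lim 2 (1 + √2) (1 - √2) (by push_cast; ring) (by linear_combination -ap) (by linarith)
  have hsum : 0 < ∑ i : Fin 2, ∑ j : Fin 2, (![1, Real.goldenRatio] i) * (w i j : Real) * (![1, 1 + √2] j) := by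
    simp only [Fin.sum_univ_two]
    have ab : (0:Real) <= w 0 0 := mod_cast hw 0 0
    have ac : (0:Real) <= w 0 1 := mod_cast hw 0 1
    have bv : (0:Real) <= w 1 0 := mod_cast hw 1 0
    have bz : (0:Real) < w 1 1 := mod_cast hw1
    simp
    positivity
  refine ⟨κ * κ' * ∑ i : Fin 2, ∑ j : Fin 2, (![1, Real.goldenRatio] i) * (w i j : Real) * (![1, 1 + √2] j), by positivity, ?_⟩
  intro a b
  have e : (fun p : Nat × Nat => ((gen 1 ^ p.1 * w * gen 2 ^ p.2) a b : Real) /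
      (Real.goldenRatio ^ p.1 * (1 + √2) ^ p.2)) = fun p : Nat × Nat => ∑ i : Fin 2, ∑ j : Fin 2,
      ((gen 1 ^ p.1) a i : Real) / Real.goldenRatio ^ p.1 * (w i j : Real) * (((gen 2 ^ p.2) j b : Real) / (1 + √2) ^ p.2) := by
    funext p
    simp only [Matrix.mul_apply, Fin.sum_univ_two]
    push_cast
    field_simp
    ring
  rw [e]
  have hh : Tendsto (fun p : Nat × Nat => ∑ i : Fin 2, ∑ j : Fin 2,
      ((gen 1 ^ p.1) a i : Real) / Real.goldenRatio ^ p.1 * (w i j : Real) * (((gen 2 ^ p.2) j b : Real) / (1 + √2) ^ p.2))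
      (atTop ×ˢ atTop) (nhds (∑ i : Fin 2, ∑ j : Fin 2, κ * (![1, Real.goldenRatio] a) * (![1, Real.goldenRatio] i) *
        (w i j : Real) * (κ' * (![1, 1 + √2] j) * (![1, 1 + √2] b)))) :=
    tendsto_finsetSum _ fun i _ => tendsto_finsetSum _ fun j _ =>
      ((((h1 a i).comp tendsto_fst).mul_const _).mul ((h2 j b).comp tendsto_snd))
  convert hh using 2
  simp only [VV, Fin.sum_univ_two]
  ring
lemma num_fam {η ε : Real} (cd : η <= 1) (hε : ε = η / 10) (hη : 0 < η) : 1 <= (1 + η) / (1 + ε) * (1 - ε) * Real.exp (-ε) := by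
  have h1 := Real.add_one_le_exp (-ε)
  have h0 : 0 < ε := by rw [hε]; positivity
  have h3 : ε <= 1/10 := by rw [hε]; linarith
  calc (1:Real) <= (1 + η) / (1 + ε) * (1 - ε) * (1 - ε) := by
        rw [div_mul_eq_mul_div, div_mul_eq_mul_div, le_div_iff₀ (by positivity)]
        have : η = 10 * ε := by rw [hε]; ring
        rw [this]; nlinarith [mul_pos h0 h0, mul_nonneg h0.le (sub_nonneg.2 h3), pow_pos h0 3]
    _ <= _ := by
        have : 0 <= (1 + η) / (1 + ε) * (1 - ε) := mul_nonneg (by positivity) (by linarith)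
        nlinarith
lemma family1 {A : Finset Nat} (hA : PA A) (h1 : 1 ∈ A) (h2 : 2 ∈ A) (q : Nat) [NeZero q] {η : Real}
    (hη : 0 < η) (cd : η <= 1) (g : Mq q) (hg : g ∈ WQ q) : ∃ T : Real, ∀ t ≥ T, ∃ n, 1 <= n ∧ ∃ f ∈ G A ^ n, red q f = g ∧
      ∀ a b, t * VV a b <= f a b ∧ (f a b : Real) <= (1 + η) * (t * VV a b) := by
  obtain ⟨n, w, hw, hwg⟩ := WS.all h1 h2 g (mem_WQ.1 hg)
  have hwn : (∀ i j, 0 <= w i j) ∧ 0 < w 1 1 := by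
    rcases Nat.eq_zero_or_pos n with rfl | hn
    . simp at hw; subst hw
      refine ⟨fun i j => ?_, by simp⟩
      fin_cases i <;> fin_cases j <;> simp
    . have := good_pow hA hn hw
      exact ⟨fun i j => by
        have bp := this.h0; have br := this.p01; have cy := this.p10; have ec := this.p11
        fin_cases i <;> fin_cases j <;> simp <;> omega, this.p11⟩
  obtain ⟨ρ, hρ, hlim⟩ := sandwich_lim w hwn.1 hwn.2
  set ε := η / 10 with hε
  have hε0 : 0 < ε := by positivity
  have hev : ∀ᶠ p : Nat × Nat in atTop ×ˢ atTop, ∀ a b : Fin 2,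
      (1 - ε) * (ρ * VV a b) <= ((gen 1 ^ p.1 * w * gen 2 ^ p.2) a b : Real) / (Real.goldenRatio ^ p.1 * (1 + √2) ^ p.2) ∧
      ((gen 1 ^ p.1 * w * gen 2 ^ p.2) a b : Real) / (Real.goldenRatio ^ p.1 * (1 + √2) ^ p.2) <= (1 + ε) * (ρ * VV a b) := by
    rw [eventually_all]; intro a
    rw [eventually_all]; intro b
    have hp : 0 < ρ * VV a b := mul_pos hρ (VV_pos a b)
    exact ((hlim a b).eventually_const_le (by nlinarith)).and ((hlim a b).eventually_le_const (by nlinarith))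
  rw [prod_atTop_atTop_eq, eventually_atTop] at hev
  obtain ⟨⟨ed, ee⟩, hev⟩ := hev
  obtain ⟨ab, mh, hp1⟩ := gen_order q 1
  obtain ⟨ac, mi, hp2⟩ := gen_order q 2
  have cf : 0 < Real.log Real.goldenRatio := Real.log_pos Real.one_lt_goldenRatio
  have s20 : 0 < √2 := Real.sqrt_pos.2 two_pos
  have cp : 0 < Real.log (1 + √2) := Real.log_pos (by linarith)
  have hE : (0:Real) < (ab * ac : Nat) := mod_cast Nat.mul_pos mh mi
  obtain ⟨cs, gs⟩ := walk (α := (ab * ac : Nat) * Real.log Real.goldenRatio) (β := (ab * ac : Nat) * Real.log (1 + √2))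
    (δ := ε) (by positivity) (by positivity) hε0 (by rw [mul_div_mul_left _ _ hE.ne']; exact log_irr) (ed + ee + 1)
  refine ⟨2 * ρ * Real.exp cs, fun t ht => ?_⟩
  have ht0 : 0 < t := lt_of_lt_of_le (by positivity) ht
  obtain ⟨k, l, hk, hl, fg, fv⟩ := gs (Real.log (t * (1 + η) / (ρ * (1 + ε)))) (by
    rw [ge_iff_le, Real.le_log_iff_exp_le (by positivity), le_div_iff₀ (by positivity)]
    have : Real.exp cs * (ρ * (1 + ε)) <= 2 * ρ * Real.exp cs := by
      have h3 : 0 < ρ * Real.exp cs := by positivity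
      have h4 : ε <= 1 := by rw [hε]; linarith
      nlinarith
    nlinarith)
  set X := Real.goldenRatio ^ (ab * ac * k) * (1 + √2) ^ (ab * ac * l) with hX
  have hφ := Real.goldenRatio_pos
  have df : 0 < X := by positivity
  have hXe : X = Real.exp (k * ((ab * ac : Nat) * Real.log Real.goldenRatio) + l * ((ab * ac : Nat) * Real.log (1 + √2))) := by
    rw [<- Real.exp_log df, hX, Real.log_mul (by positivity) (by positivity), Real.log_pow, Real.log_pow]
    congr 1; push_cast; ring
  have hZ : 0 < t * (1 + η) / (ρ * (1 + ε)) := by positivity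
  have hXu : X <= t * (1 + η) / (ρ * (1 + ε)) := by
    rw [hXe, <- Real.le_log_iff_exp_le hZ]; exact fv
  have hXl : t * (1 + η) / (ρ * (1 + ε)) * Real.exp (-ε) <= X := by
    rw [hXe, <- Real.exp_log hZ, <- Real.exp_add]
    exact Real.exp_le_exp.2 (by linarith)
  have hEk : 1 <= ab * ac := Nat.mul_pos mh mi
  have hkk : k <= ab * ac * k := Nat.le_mul_of_pos_left _ hEk
  have hll : l <= ab * ac * l := Nat.le_mul_of_pos_left _ hEk
  have hb := hev (ab * ac * k, ab * ac * l) (by constructor <;> simp <;> omega)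
  refine ⟨ab * ac * k + n + ab * ac * l, by omega, gen 1 ^ (ab * ac * k) * w * gen 2 ^ (ab * ac * l), ?_, ?_, ?_⟩
  . rw [pow_add, pow_add]
    refine mul_mem_mul (mul_mem_mul ?_ hw) ?_
    . exact pow_mem_pow (mem_image_of_mem _ h1)
    . exact pow_mem_pow (mem_image_of_mem _ h2)
  . rw [red_mul, red_mul, red_pow, red_pow, red_gen, red_gen, mul_assoc ab, pow_mul, hp1, one_pow, one_mul,
      mul_comm ab, mul_assoc ac, pow_mul, hp2, one_pow, mul_one, hwg]
  . intro a b
    obtain ⟨bg, dv⟩ := hb a b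
    simp only [<- hX] at bg dv
    rw [le_div_iff₀ df] at bg
    rw [div_le_iff₀ df] at dv
    have hV := VV_pos a b
    have ln : 0 <= 1 - ε := by rw [hε]; linarith
    constructor
    . refine le_trans ?_ bg
      calc t * VV a b = t * VV a b * 1 := by ring
        _ <= t * VV a b * ((1 + η) / (1 + ε) * (1 - ε) * Real.exp (-ε)) := by
            gcongr; exact num_fam cd hε hη
        _ = (1 - ε) * (ρ * VV a b) * (t * (1 + η) / (ρ * (1 + ε)) * Real.exp (-ε)) := by field_simp
        _ <= _ := by gcongr
    . refine dv.trans ?_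
      calc (1 + ε) * (ρ * VV a b) * X <= (1 + ε) * (ρ * VV a b) * (t * (1 + η) / (ρ * (1 + ε))) := by gcongr
        _ = _ := by field_simp
lemma family {A : Finset Nat} (hA : PA A) (h1 : 1 ∈ A) (h2 : 2 ∈ A) (q : Nat) [NeZero q] {η : Real}
    (hη : 0 < η) (cd : η <= 1) : ∃ T : Real, 1 <= T ∧ ∀ g ∈ WQ q, ∀ t ≥ T, ∃ n, 1 <= n ∧ ∃ f ∈ G A ^ n, red q f = g ∧
      ∀ a b, t * VV a b <= f a b ∧ (f a b : Real) <= (1 + η) * (t * VV a b) := by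
  have := fun g : WQ q => family1 hA h1 h2 q hη cd g.1 g.2
  choose T hT using this
  obtain ⟨M, hM⟩ := (Set.finite_range T).bddAbove
  refine ⟨max M 1, le_max_right _ _, fun g hg t ht => hT ⟨g, hg⟩ t ?_⟩
  exact (hM ⟨⟨g, hg⟩, rfl⟩).trans ((le_max_left _ _).trans ht)
end ZD
namespace ZD
open scoped Pointwise
open Finset
noncomputable def ES {ι : Type} (P : Nat) [NeZero P] (UI : Finset aa) (Fs : Finset ι) (f : ι -> aa) (co UJ : Finset aa)
    (k : ZMod P) : Complex :=
  ∑ u ∈ UI, ∑ a ∈ Fs, ∑ c ∈ co, ∑ z ∈ UJ,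
    ZMod.stdAddChar (k * (((u * f a * c * z.transpose) 1 1 : Int) : ZMod P))
structure Ens (A : Finset Nat) (P : Nat) (ho : Real) {ι : Type} (UI : Finset aa) (Fs : Finset ι) (f : ι -> aa)
    (co UJ : Finset aa) : Prop where
  fG : ∀ a ∈ Fs, ∃ n, 1 <= n ∧ f a ∈ G A ^ n
  uG : ∃ n, 1 <= n ∧ UI ⊆ G A ^ n
  cG : ∃ n, 1 <= n ∧ co ⊆ G A ^ n
  zG : ∃ n, 1 <= n ∧ UJ ⊆ G A ^ n
  hd : ∀ u ∈ UI, ∀ a ∈ Fs, ∀ c ∈ co, ∀ z ∈ UJ, ho * P <= ((u * f a * c * z.transpose) 1 1 : Real) ∧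
    (u * f a * c * z.transpose) 1 1 <= P
lemma fd (x g : aa) : (x * g.transpose) 1 1 = x 1 0 * g 1 0 + x 1 1 * g 1 1 := by
  rw [ao]; rfl
lemma memG_mul {A : Finset Nat} {n m : Nat} {x y : aa} (hx : x ∈ G A ^ n) (hy : y ∈ G A ^ m) : x * y ∈ G A ^ (n + m) := by
  rw [pow_add]; exact mul_mem_mul hx hy
lemma subG_mul {A : Finset Nat} {n m : Nat} {X Y : Finset aa} (hX : X ⊆ G A ^ n) (hY : Y ⊆ G A ^ m) :
    X * Y ⊆ G A ^ (n + m) := by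
  rw [pow_add]; exact mul_subset_mul hX hY
lemma chain_dec {A : Finset Nat} {U Z : Nat -> Finset aa} (hZ : ∀ j, ∃ n, 1 <= n ∧ Z j ⊆ G A ^ n)
    (hUZ : ∀ j, U (j + 1) = U j * Z j) (i I : Nat) (h : i <= I) : ∃ n, ∃ W ⊆ G A ^ n, U I = U i * W := by
  induction I, h using Nat.le_induction with
  | base => exact ⟨0, 1, by simp, (mul_one _).symm⟩
  | succ I _ ih =>
    obtain ⟨n, W, hW, e⟩ := ih
    obtain ⟨m, _, hm⟩ := hZ I
    exact ⟨n + m, W * Z I, subG_mul hW hm, by rw [hUZ, e, mul_assoc]⟩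
lemma lev_top {A : Finset Nat} (hA : PA A) {ho C al : Real} {P : Nat} [NeZero P] {ι : Type}
    {UI UJ co : Finset aa} {Fs : Finset ι} {f : ι -> aa} (E : Ens A P ho UI Fs f co UJ)
    (hR : en P ho C al)
    (c T : Nat) (V W : Finset aa) (a b : Nat) (ha : 1 <= a) (hV : V ⊆ G A ^ a) (hW : W ⊆ G A ^ b) (eU : UI = V * W)
    (bb : 6 <= c) (hcT : c <= T) (hTc : T <= c ^ 80) (hVc : ∀ v ∈ V, v 1 1 <= c)
    (hco : ∀ t ∈ co, (T : Int) <= t 1 1 ∧ (t 1 1 : Real) <= C * T) (hYc : ∀ g ∈ UJ, g 1 1 <= (c : Int) ^ 32)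
    (dz : (c:Real) ^ k49 <= V.card) (fw : (T:Real) ^ k49 <= co.card)
    (ea : ((c:Real) ^ 32) ^ k49 <= UJ.card) (K : Finset (ZMod P)) (hK : ∀ k ∈ K, InM P (c ^ 14) k ∧ ¬ InM P (c ^ 7) k) :
    ∑ k ∈ K, ‖ES P UI Fs f co UJ k‖ ^ 2 <= al * (c:Real) ^ nhf * (UI.card * Fs.card * co.card * UJ.card : Real) ^ 2 := by
  obtain ⟨nc, hnc, hc⟩ := E.cG
  obtain ⟨nz, hnz, hz⟩ := E.zG
  have hR' := hR (aa × ι) c T V co (W ×ˢ Fs) (fun r => r.1 * f r.2) UJ K bb hcT hTc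
    (fun v hv => ⟨good_pow hA ha (hV hv), hVc v hv⟩) (fun v hv w hw => row2_inj hA (hV hv) (hV hw))
    (fun t ht => ⟨good_pow hA hnc (hc ht), hco t ht⟩) (fun v hv w hw => row2_inj hA (hc hv) (hc hw))
    (by
      rintro ⟨w, x⟩ hr
      rw [mem_product] at hr
      obtain ⟨n, hn, hf⟩ := E.fG x hr.2
      exact good_pow hA (by omega) (memG_mul (hW hr.1) hf))
    (fun g hg => ⟨good_pow hA hnz (hz hg), hYc g hg⟩) (fun v hv w hw => row2_inj hA (hz hv) (hz hw)) dz fw ea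
    (by
      rintro v hv ⟨w, x⟩ hr t ht g hg
      rw [mem_product] at hr
      have := E.hd (v * w) (by rw [eU]; exact mul_mem_mul hv hr.1) x hr.2 t ht g hg
      rw [fd] at this
      rw [<- mul_assoc v w]; exact this) hK
  have ab : ∀ k, ES P UI Fs f co UJ k = ∑ i ∈ V ×ˢ (W ×ˢ Fs) ×ˢ co, ∑ g ∈ UJ,
      (ZMod.stdAddChar (k * (((i.1 * (i.2.1.1 * f i.2.1.2) * i.2.2) 1 0 * g 1 0 +
      (i.1 * (i.2.1.1 * f i.2.1.2) * i.2.2) 1 1 * g 1 1 : Int) : ZMod P)) : Complex) := by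
    intro k
    rw [ES, eU, sum_mul_eq hA hV hW]
    simp only [sum_product, <- fd, <- mul_assoc]
  simp only [<- ab] at hR'
  refine hR'.trans (le_of_eq ?_)
  rw [eU, card_mul_eq hA hV hW, card_product]
  push_cast; ring
lemma lev_mid {A : Finset Nat} (hA : PA A) {ho C al : Real} {P : Nat} [NeZero P] {ι : Type}
    {UI UJ co : Finset aa} {Fs : Finset ι} {f : ι -> aa} (E : Ens A P ho UI Fs f co UJ)
    (hR : en P ho C al)
    (c T : Nat) (V W Y Z Q : Finset aa) (a b y z q : Nat) (ha : 1 <= a) (hV : V ⊆ G A ^ a) (hW : W ⊆ G A ^ b) (eU : UI = V * W)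
    (hy : 1 <= y) (hY : Y ⊆ G A ^ y) (hz : 1 <= z) (hZ : Z ⊆ G A ^ z) (hQ : Q ⊆ G A ^ q) (eJ : UJ = Y * (Z * Q))
    (bb : 6 <= c) (hcT : c <= T) (hTc : T <= c ^ 80) (hVc : ∀ v ∈ V, v 1 1 <= c)
    (hS : ∀ t ∈ Z, (T : Int) <= t 1 1 ∧ (t 1 1 : Real) <= C * T) (hYc : ∀ g ∈ Y, g 1 1 <= (c : Int) ^ 32)
    (dz : (c:Real) ^ k49 <= V.card) (fw : (T:Real) ^ k49 <= Z.card)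
    (ea : ((c:Real) ^ 32) ^ k49 <= Y.card) (K : Finset (ZMod P)) (hK : ∀ k ∈ K, InM P (c ^ 14) k ∧ ¬ InM P (c ^ 7) k) :
    ∑ k ∈ K, ‖ES P UI Fs f co UJ k‖ ^ 2 <= al * (c:Real) ^ nhf * (UI.card * Fs.card * co.card * UJ.card : Real) ^ 2 := by
  obtain ⟨nc, hnc, hc⟩ := E.cG
  have tinj : Function.Injective (Matrix.transpose : aa -> aa) := Matrix.transpose_injective
  have hcZ : (Z.image Matrix.transpose).card = Z.card := card_image_of_injective _ tinj
  have hZt : ∀ t ∈ Z.image Matrix.transpose, t ∈ G A ^ z := by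
    intro t ht
    obtain ⟨s, hs, rfl⟩ := mem_image.1 ht
    exact transpose_mem (hZ hs)
  have tre : ∀ v w x d t g p : aa, v * (w * x * d * Matrix.transpose p) * Matrix.transpose t * Matrix.transpose g =
      v * w * x * d * (g * (t * p)).transpose := by
    intro v w x d t g p
    simp only [Matrix.transpose_mul, mul_assoc]
  have hR' := hR (aa × ι × aa × aa) c T V (Z.image Matrix.transpose) (W ×ˢ Fs ×ˢ co ×ˢ Q)
    (fun r => r.1 * f r.2.1 * r.2.2.1 * r.2.2.2.transpose) Y K bb hcT hTc
    (fun v hv => ⟨good_pow hA ha (hV hv), hVc v hv⟩) (fun v hv w hw => row2_inj hA (hV hv) (hV hw))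
    (by
      intro t ht
      refine ⟨good_pow hA hz (hZt t ht), ?_⟩
      obtain ⟨s, hs, rfl⟩ := mem_image.1 ht
      exact hS s hs) (fun v hv w hw => row2_inj hA (hZt v hv) (hZt w hw))
    (by
      rintro ⟨w, x, d, p⟩ hr
      simp only [mem_product] at hr
      obtain ⟨n, hn, hf⟩ := E.fG x hr.2.1
      exact good_pow hA (by omega) (memG_mul (memG_mul (memG_mul (hW hr.1) hf) (hc hr.2.2.1)) (transpose_mem (hQ hr.2.2.2))))
    (fun g hg => ⟨good_pow hA hy (hY hg), hYc g hg⟩) (fun v hv w hw => row2_inj hA (hY hv) (hY hw)) dz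
    (by rw [hcZ]; exact fw) ea
    (by
      rintro v hv ⟨w, x, d, p⟩ hr t' ht' g hg
      obtain ⟨t, ht, rfl⟩ := mem_image.1 ht'
      simp only [mem_product] at hr
      have := E.hd (v * w) (by rw [eU]; exact mul_mem_mul hv hr.1) x hr.2.1 d hr.2.2.1 (g * (t * p))
        (by rw [eJ]; exact mul_mem_mul hg (mul_mem_mul ht hr.2.2.2))
      rw [<- tre, fd] at this
      exact this) hK
  have ab : ∀ k, ES P UI Fs f co UJ k = ∑ i ∈ V ×ˢ (W ×ˢ Fs ×ˢ co ×ˢ Q) ×ˢ (Z.image Matrix.transpose), ∑ g ∈ Y,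
      (ZMod.stdAddChar (k * (((i.1 * (i.2.1.1 * f i.2.1.2.1 * i.2.1.2.2.1 * i.2.1.2.2.2.transpose) * i.2.2) 1 0 * g 1 0 +
      (i.1 * (i.2.1.1 * f i.2.1.2.1 * i.2.1.2.2.1 * i.2.1.2.2.2.transpose) * i.2.2) 1 1 * g 1 1 : Int) : ZMod P)) : Complex) := by
    intro k
    rw [ES, eU, sum_mul_eq hA hV hW]
    simp only [sum_product, <- fd, sum_image tinj.injOn, tre]
    refine sum_congr rfl fun v _ => sum_congr rfl fun w _ => sum_congr rfl fun x _ =>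
      sum_congr rfl fun d _ => ?_
    rw [eJ, sum_mul_eq hA hY (subG_mul hZ hQ)]
    simp only [sum_mul_eq hA hZ hQ]
    rw [sum_comm]
    conv_rhs => rw [sum_comm]
    exact sum_congr rfl fun _ _ => sum_comm
  simp only [<- ab] at hR'
  refine hR'.trans (le_of_eq ?_)
  rw [eU, eJ, card_mul_eq hA hV hW, card_mul_eq hA hY (subG_mul hZ hQ), card_mul_eq hA hZ hQ, hcZ]
  simp only [card_product]
  push_cast; ring
end ZD
namespace ZD
open scoped Pointwise
open Finset
lemma fx (B i : Nat) : B ^ (2 ^ (i + 5)) = (B ^ (2 ^ i)) ^ 32 := by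
  rw [<- pow_mul, pow_add]; norm_num
lemma levels {A : Finset Nat} (hA : PA A) {ho al : Real} {C : Nat} {P : Nat} [NeZero P] {ι : Type}
    {U Z : Nat -> Finset aa} {co : Finset aa} {Fs : Finset ι} {f : ι -> aa} {n B S : Nat}
    (hU : ∀ j, ChainU A B j (U j)) (hZ : ∀ j, ChainZ A C B j (Z j)) (hUZ : ∀ j, U (j + 1) = U j * Z j)
    (hB : 6 <= B) (hBC : 4 * C <= B)
    (E : Ens A P ho (U (n + 2)) Fs f co (U (n + 5))) (hR : en P ho C al)
    (ce : B ^ (2 ^ n) <= S) (ck : S <= (B ^ (2 ^ n)) ^ 80)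
    (hco : ∀ t ∈ co, (S : Int) <= t 1 1 ∧ t 1 1 <= C * S) (nco : (S:Real) ^ k49 <= co.card)
    (i : Nat) (hi : i <= n) (K : Finset (ZMod P))
    (hK : ∀ k ∈ K, InM P ((B ^ (2 ^ i) : Nat) ^ 14) k ∧ ¬ InM P ((B ^ (2 ^ i) : Nat) ^ 7) k) :
    ∑ k ∈ K, ‖ES P (U (n + 2)) Fs f co (U (n + 5)) k‖ ^ 2 <=
      al * ((B ^ (2 ^ i) : Nat) : Real) ^ nhf * ((U (n+2)).card * Fs.card * co.card * (U (n+5)).card : Real) ^ 2 := by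
  have hc : B <= B ^ (2 ^ i) := Nat.le_self_pow (by positivity) B
  obtain ⟨b, W, hW, eU⟩ := chain_dec (fun j => (hZ j).sub) hUZ i (n + 2) (by omega)
  obtain ⟨a, ha, hV⟩ := (hU i).sub
  have hVc : ∀ v ∈ U i, v 1 1 <= ((B ^ (2 ^ i) : Nat) : Int) := fun v hv => by
    have := (hU i).le v hv; exact_mod_cast this
  have hYc : ∀ v ∈ U (i+5), v 1 1 <= ((B ^ (2 ^ i) : Nat) : Int) ^ 32 := fun v hv => by
    have := (hU (i+5)).le v hv; rw [<- Nat.cast_pow, <- fx]; exact_mod_cast this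
  have dz : ((B ^ (2 ^ i) : Nat) : Real) ^ k49 <= (U i).card := by
    have := (hU i).card; exact_mod_cast this
  have ea : (((B ^ (2 ^ i) : Nat) : Real) ^ 32) ^ k49 <= (U (i+5)).card := by
    have := (hU (i+5)).card
    rw [<- Nat.cast_pow, <- fx]; push_cast; exact this
  rcases hi.eq_or_lt with rfl | hlt
  . exact lev_top hA E hR _ S _ W a b ha hV hW eU (by omega) ce ck hVc
      (fun t ht => ⟨(hco t ht).1, mod_cast (hco t ht).2⟩) hYc dz nco ea K hK
  . obtain ⟨q, Q, hQ, eJ⟩ := chain_dec (fun j => (hZ j).sub) hUZ (i + 6) (n + 5) (by omega)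
    rw [hUZ (i + 5), mul_assoc] at eJ
    obtain ⟨y, hy, hY⟩ := (hU (i+5)).sub
    obtain ⟨z, hz, hZs⟩ := (hZ (i+5)).sub
    obtain ⟨T, hT, fk, ky, hT3⟩ := (hZ (i+5)).size
    rw [fx] at fk ky
    set c := B ^ (2 ^ i) with hcdef
    have hcT : c <= T := by
      have h1 : c * c <= c ^ 32 := by
        rw [<- pow_two]; exact Nat.pow_le_pow_right (by omega) (by omega)
      have h2 : c * (4 * C) <= c * c := Nat.mul_le_mul_left _ (by omega)
      have h3 : (4 * C) * c <= (4 * C) * T := by rw [mul_comm (4 * C) c]; omega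
      have : 0 < 4 * C := by
        rcases Nat.eq_zero_or_pos (4 * C) with h | h
        . rw [h, zero_mul] at ky
          have : 0 < c ^ 32 := by positivity
          omega
        . exact h
      exact Nat.le_of_mul_le_mul_left h3 this
    exact lev_mid hA E hR c T _ W _ _ Q a b y z q ha hV hW eU hy hY hz hZs hQ eJ (by omega) hcT
      (fk.trans (Nat.pow_le_pow_right (by omega) (by omega))) hVc
      (fun t ht => ⟨(hT t ht).1, mod_cast (hT t ht).2⟩) hYc dz hT3 ea K hK
lemma mul11_le {g h : aa} (hg : Good g) (hh : Good h) : (g * h) 1 1 <= 2 * (g 1 1 * h 1 1) := by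
  rw [ao]
  have h1 := hg.h4; have h2 := hh.h2; have h3 := hg.p10; have h4 := hh.p01
  nlinarith [mul_le_mul h1 h2 (by omega) (by omega)]
lemma reg2_num {c S x y z : Real} (hc : 1 <= c) (fy : 1 <= S) (hS : S <= c ^ 80) (hx : (c ^ 4) ^ k49 <= x)
    (hy : S ^ k49 <= y) (hz : (c ^ 32) ^ k49 <= z) : S ^ 2 * c ^ 64 * c ^ 3 <= x * y * z := by
  have ho : 0 < c := by linarith
  have ml : 0 < S := by linarith
  have ab : S ^ 2 = S ^ k49 * S ^ (1/25 : Real) := by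
    rw [<- Real.rpow_add ml, <- Real.rpow_natCast]; norm_num
  have ac : S ^ (1/25 : Real) <= c ^ (16/5 : Real) := by
    calc S ^ (1/25 : Real) <= (c ^ 80) ^ (1/25 : Real) := Real.rpow_le_rpow ml.le hS (by norm_num)
      _ = c ^ (16/5 : Real) := by
        rw [<- Real.rpow_natCast, <- Real.rpow_mul ho.le]; norm_num
  have bv : c ^ (16/5 : Real) * c ^ 64 * c ^ 3 <= (c ^ 4) ^ k49 * (c ^ 32) ^ k49 := by
    simp only [<- Real.rpow_natCast, <- Real.rpow_mul ho.le, <- Real.rpow_add ho]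
    exact Real.rpow_le_rpow_of_exponent_le hc (by norm_num)
  have ba : 0 < S ^ k49 := by positivity
  calc S ^ 2 * c ^ 64 * c ^ 3 = S ^ k49 * (S ^ (1/25 : Real) * c ^ 64 * c ^ 3) := by rw [ab]; ring
    _ <= S ^ k49 * (c ^ (16/5 : Real) * c ^ 64 * c ^ 3) := by gcongr
    _ <= S ^ k49 * ((c ^ 4) ^ k49 * (c ^ 32) ^ k49) := by gcongr
    _ <= y * (x * z) := by
        have : 0 <= y := ba.le.trans hy
        have : 0 <= x := le_trans (by positivity) hx
        gcongr
    _ = x * y * z := by ring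
lemma cauchy_F {ι : Type} (Fs : Finset ι) (s : ι -> Complex) : ‖∑ a ∈ Fs, s a‖ ^ 2 <= Fs.card * ∑ a ∈ Fs, ‖s a‖ ^ 2 := by
  calc ‖∑ a ∈ Fs, s a‖ ^ 2 <= (∑ a ∈ Fs, ‖s a‖) ^ 2 := by
        gcongr; exact norm_sum_le _ _
    _ <= _ := sq_sum_le_card_mul_sum_sq
lemma ES_swap {ι : Type} (P : Nat) [NeZero P] (UI : Finset aa) (Fs : Finset ι) (f : ι -> aa) (co UJ : Finset aa) (k : ZMod P) :
    ES P UI Fs f co UJ k = ∑ a ∈ Fs, ∑ u ∈ UI, ∑ p ∈ co ×ˢ UJ,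
      (ZMod.stdAddChar (k * (((u * (f a * p.1 * p.2.transpose)) 1 1 : Int) : ZMod P)) : Complex) := by
  rw [ES, sum_comm]
  simp only [sum_product, mul_assoc]
lemma tail0 {A : Finset Nat} (hA : PA A) {ho Fm : Real} (ah : 0 < ho) {C : Nat} {P : Nat} [NeZero P] {ι : Type}
    {UI UJ co : Finset aa} {Fs : Finset ι} {f : ι -> aa} {c S : Nat}
    (h1c : 1 <= c) (hcc : 1 <= ho * c) (hPc : 2 * (c:Real) ^ 8 <= ho * P)
    (E : Ens A P ho UI Fs f co UJ) (hFm : ∀ a ∈ Fs, (f a 1 1 : Real) <= Fm)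
    (hle : ∀ g ∈ UI, g 1 1 <= (c:Int) ^ 4) (hge : ∀ g ∈ UI, 6 <= g 1 1) (gv : ∀ g ∈ UJ, g 1 1 <= (c:Int) ^ 32)
    (hcard : ((c:Real) ^ 4) ^ k49 <= UI.card) (hcard2 : ((c:Real) ^ 32) ^ k49 <= UJ.card)
    (ce : c <= S) (ck : S <= c ^ 80)
    (hco : ∀ t ∈ co, (S : Int) <= t 1 1 ∧ t 1 1 <= C * S) (nco : (S:Real) ^ k49 <= co.card)
    (K : Finset (ZMod P)) (hK : ∀ k ∈ K, ¬ InM P (c ^ 14) k) :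
    ∑ k ∈ K, ‖ES P UI Fs f co UJ k‖ ^ 2 <=
      2304 * (2 / ho + 1) * (16 * Fm ^ 2 * C ^ 2) / (c : Real) ^ 3 *
        (UI.card * Fs.card * co.card * UJ.card : Real) ^ 2 := by
  obtain ⟨nc, hnc, hc⟩ := E.cG
  obtain ⟨nz, hnz, hz⟩ := E.zG
  obtain ⟨nu, hnu, hu⟩ := E.uG
  have kz : (1:Real) <= c := mod_cast h1c
  have fy : (1:Real) <= S := mod_cast (h1c.trans ce)
  have hUne : UI.Nonempty := by
    rw [<- card_pos]
    have : (0:Real) < UI.card := lt_of_lt_of_le (by positivity) hcard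
    exact_mod_cast this
  set Mb : Real := 4 * Fm * (C * S) * c ^ 32 with hMb
  have per : ∀ a ∈ Fs, ∑ k ∈ K, ‖∑ u ∈ UI, ∑ p ∈ co ×ˢ UJ,
      (ZMod.stdAddChar (k * (((u * (f a * p.1 * p.2.transpose)) 1 1 : Int) : ZMod P)) : Complex)‖ ^ 2 <=
      2304 * (2 / ho + 1) * Mb ^ 2 * (UI).card * (co ×ˢ UJ).card := by
    intro a ha
    obtain ⟨nf, hnf, hf⟩ := E.fG a ha
    have dk := regime2 ah (c := c) hcc hPc UI (co ×ˢ UJ) (fun p : aa × aa => f a * p.1 * p.2.transpose) Mb K h1c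
      (fun v hv => ⟨good_pow hA hnu (hu hv), hle v hv⟩) hge
      (fun v hv w hw => row2_inj hA (hu hv) (hu hw)) hUne
    refine dk ?_ ?_ ?_ hK
    . rintro ⟨x, z⟩ hp
      rw [mem_product] at hp
      have bk := good_pow hA hnf hf
      have bw := good_pow hA hnc (hc hp.1)
      have gw := good_pow hA hnz (hz hp.2)
      refine ⟨(bk.mul bw).mul gw.transpose, ?_⟩
      have ef := mul11_le bk bw
      have dm := mul11_le (bk.mul bw) gw.transpose
      have fu : z.transpose 1 1 = z 1 1 := rfl
      rw [fu] at dm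
      have ew : ((f a * x) 1 1 : Real) <= 2 * ((f a 1 1 : Real) * x 1 1) := mod_cast ef
      have dk : ((f a * x * z.transpose) 1 1 : Real) <= 2 * (((f a * x) 1 1 : Real) * z 1 1) := mod_cast dm
      have gd : (x 1 1 : Real) <= C * S := mod_cast (hco x hp.1).2
      have r4 : (z 1 1 : Real) <= c ^ 32 := mod_cast gv z hp.2
      have r5 : (0:Real) <= z 1 1 := mod_cast gw.nonneg 1 1
      have r6 : (0:Real) <= x 1 1 := mod_cast bw.nonneg 1 1
      have r7 : (0:Real) <= f a 1 1 := mod_cast bk.nonneg 1 1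
      have r8 := hFm a ha
      calc ((f a * x * z.transpose) 1 1 : Real) <= 2 * ((2 * ((f a 1 1 : Real) * x 1 1)) * z 1 1) :=
            dk.trans (by gcongr)
        _ <= 2 * ((2 * (Fm * (C * S))) * c ^ 32) := by
            have : 0 <= Fm := r7.trans r8
            gcongr
        _ = Mb := by rw [hMb]; ring
    . rintro ⟨x, z⟩ hp ⟨x', z'⟩ hp' h1 h2
      rw [mem_product] at hp hp'
      have dl : f a * x * z.transpose ∈ G A ^ (nf + nc + nz) := memG_mul (memG_mul hf (hc hp.1)) (transpose_mem (hz hp.2))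
      have cm : f a * x' * z'.transpose ∈ G A ^ (nf + nc + nz) := memG_mul (memG_mul hf (hc hp'.1)) (transpose_mem (hz hp'.2))
      have h3 := row2_inj hA (transpose_mem dl) (transpose_mem cm) h1 h2
      have h4 := Matrix.transpose_injective h3
      obtain ⟨ay, bb⟩ := factor_inj hA (memG_mul hf (hc hp.1)) (memG_mul hf (hc hp'.1)) (transpose_mem (hz hp.2)) (transpose_mem (hz hp'.2)) h4
      have h7 := (factor_inj hA hf hf (hc hp.1) (hc hp'.1) ay).2
      have h8 := Matrix.transpose_injective bb
      exact Prod.ext h7 h8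
    . rintro v hv ⟨x, z⟩ hp
      rw [mem_product] at hp
      have := E.hd v hv a ha x hp.1 z hp.2
      simpa only [mul_assoc] using this
  have hnum := reg2_num kz fy (mod_cast ck) hcard nco hcard2
  set X : Real := (UI.card : Real)
  set Q : Real := (co.card : Real)
  set R : Real := (UJ.card : Real)
  have hXQR : 0 <= X * Q * R := by positivity
  calc ∑ k ∈ K, ‖ES P (UI) Fs f co (UJ) k‖ ^ 2
      <= ∑ k ∈ K, Fs.card * ∑ a ∈ Fs, ‖∑ u ∈ UI, ∑ p ∈ co ×ˢ UJ,
      (ZMod.stdAddChar (k * (((u * (f a * p.1 * p.2.transpose)) 1 1 : Int) : ZMod P)) : Complex)‖ ^ 2 :=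
        sum_le_sum fun k _ => by rw [ES_swap]; exact cauchy_F _ _
    _ = Fs.card * ∑ a ∈ Fs, ∑ k ∈ K, ‖∑ u ∈ UI, ∑ p ∈ co ×ˢ UJ,
      (ZMod.stdAddChar (k * (((u * (f a * p.1 * p.2.transpose)) 1 1 : Int) : ZMod P)) : Complex)‖ ^ 2 := by
        rw [<- mul_sum, sum_comm]
    _ <= Fs.card * ∑ a ∈ Fs, (2304 * (2 / ho + 1) * Mb ^ 2 * X * (co ×ˢ UJ).card) := by
        gcongr with a ha; exact per a ha
    _ = 2304 * (2 / ho + 1) * (16 * Fm ^ 2 * C ^ 2) / (c:Real) ^ 3 * (Fs.card ^ 2 * ((S ^ 2 * c ^ 64 * c ^ 3) * (X * Q * R))) := by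
        rw [sum_const, nsmul_eq_mul, card_product, hMb]
        push_cast
        field_simp
        ring
    _ <= 2304 * (2 / ho + 1) * (16 * Fm ^ 2 * C ^ 2) / (c:Real) ^ 3 * (Fs.card ^ 2 * ((X * Q * R) * (X * Q * R))) := by
        gcongr
    _ = _ := by ring
lemma tail {A : Finset Nat} (hA : PA A) {ho Fm : Real} (ah : 0 < ho) {C : Nat} {P : Nat} [NeZero P] {ι : Type}
    {U : Nat -> Finset aa} {co : Finset aa} {Fs : Finset ι} {f : ι -> aa} {n B S : Nat}
    (hU : ∀ j, ChainU A B j (U j))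
    (hB : 6 <= B) (hcc : 1 <= ho * (B ^ (2 ^ n) : Nat)) (hPc : 2 * ((B ^ (2 ^ n) : Nat):Real) ^ 8 <= ho * P)
    (E : Ens A P ho (U (n + 2)) Fs f co (U (n + 5))) (hFm : ∀ a ∈ Fs, (f a 1 1 : Real) <= Fm)
    (ce : B ^ (2 ^ n) <= S) (ck : S <= (B ^ (2 ^ n)) ^ 80)
    (hco : ∀ t ∈ co, (S : Int) <= t 1 1 ∧ t 1 1 <= C * S) (nco : (S:Real) ^ k49 <= co.card)
    (K : Finset (ZMod P)) (hK : ∀ k ∈ K, ¬ InM P ((B ^ (2 ^ n) : Nat) ^ 14) k) :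
    ∑ k ∈ K, ‖ES P (U (n + 2)) Fs f co (U (n + 5)) k‖ ^ 2 <=
      2304 * (2 / ho + 1) * (16 * Fm ^ 2 * C ^ 2) / ((B ^ (2 ^ n) : Nat) : Real) ^ 3 *
        ((U (n+2)).card * Fs.card * co.card * (U (n+5)).card : Real) ^ 2 := by
  have hcB : B <= B ^ (2 ^ n) := Nat.le_self_pow (by positivity) B
  have hcard := (hU (n+2)).card
  have hcard2 := (hU (n+5)).card
  have hle := (hU (n+2)).le
  have gv := (hU (n+5)).le
  have bz : B ^ (2 ^ (n + 2)) = (B ^ (2 ^ n)) ^ 4 := by rw [<- pow_mul, pow_add]; norm_num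
  have e4' : (B:Real) ^ (2 ^ (n + 2)) = ((B ^ (2 ^ n) : Nat):Real) ^ 4 := mod_cast bz
  have e4'' : (B:Int) ^ (2 ^ (n + 2)) = ((B ^ (2 ^ n) : Nat):Int) ^ 4 := mod_cast bz
  have e5' : (B:Real) ^ (2 ^ (n + 5)) = ((B ^ (2 ^ n) : Nat):Real) ^ 32 := mod_cast fx B n
  have e5'' : (B:Int) ^ (2 ^ (n + 5)) = ((B ^ (2 ^ n) : Nat):Int) ^ 32 := mod_cast fx B n
  rw [e4'] at hcard
  rw [e5'] at hcard2
  rw [e4''] at hle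
  rw [e5''] at gv
  generalize B ^ (2 ^ n) = c at *
  exact tail0 hA ah (by omega) hcc hPc E hFm hle (hU (n+2)).ge gv hcard hcard2 ce ck hco nco K hK
end ZD
namespace ZD
open scoped Pointwise
open Finset
open Classical in
lemma telesc {α : Type*} [Fintype α] (p : Nat -> α -> Prop) (f : α -> Real) (hf : ∀ x, 0 <= f x) (m : Nat) :
    ∑ x, f x <= ∑ x ∈ univ.filter (p 0), f x + ∑ i ∈ range m, ∑ x ∈ univ.filter (fun x => p (i+1) x ∧ ¬ p i x), f x
      + ∑ x ∈ univ.filter (fun x => ¬ p m x), f x := by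
  induction m with
  | zero =>
    rw [<- sum_filter_add_sum_filter_not univ (p 0)]; simp
  | succ m ih =>
    refine ih.trans ?_
    rw [sum_range_succ]
    have : ∑ x ∈ univ.filter (fun x => ¬ p m x), f x <= ∑ x ∈ univ.filter (fun x => p (m+1) x ∧ ¬ p m x), f x
      + ∑ x ∈ univ.filter (fun x => ¬ p (m+1) x), f x := by
      simp only [sum_filter]
      rw [<- sum_add_distrib]
      refine sum_le_sum fun x _ => ?_
      have := hf x
      by_cases h1 : p m x <;> by_cases h2 : p (m+1) x <;> simp [h1, h2, this]
    linarith
lemma geo {B : Nat} (hB : 4 <= B) (n : Nat) : ∑ i ∈ range n, ((B ^ (2 ^ i) : Nat) : Real) ^ nhf <= 2 * (B:Real) ^ nhf := by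
  have el : (0:Real) < B := mod_cast (show 0 < B by omega)
  have term : ∀ i : Nat, ((B ^ (2 ^ i) : Nat) : Real) ^ nhf <= (1/2) ^ i * (B:Real) ^ nhf := by
    intro i
    have h1 : (4:Real) ^ i * B <= ((B ^ (2 ^ i) : Nat) : Real) := by
      have : 4 ^ i * B <= B ^ (2 ^ i) := by
        calc 4 ^ i * B <= B ^ i * B := Nat.mul_le_mul_right _ (Nat.pow_le_pow_left hB i)
          _ = B ^ (i + 1) := (pow_succ _ _).symm
          _ <= B ^ (2 ^ i) := Nat.pow_le_pow_right (by omega) (Nat.lt_two_pow_self)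
      exact_mod_cast this
    calc ((B ^ (2 ^ i) : Nat) : Real) ^ nhf <= ((4:Real) ^ i * B) ^ nhf :=
          Real.rpow_le_rpow_of_nonpos (by positivity) h1 (by norm_num)
      _ = _ := by
        rw [Real.mul_rpow (by positivity) el.le]
        congr 1
        rw [show (4:Real) ^ i = ((2:Real) ^ i) ^ 2 by rw [<- pow_mul, mul_comm, pow_mul]; norm_num,
          <- Real.rpow_natCast ((2:Real) ^ i) 2, <- Real.rpow_mul (by positivity)]
        norm_num
        rw [Real.rpow_neg_one, one_div, inv_pow]
  calc _ <= ∑ i ∈ range n, (1/2 : Real) ^ i * (B:Real) ^ nhf := sum_le_sum fun i _ => term i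
    _ = (∑ i ∈ range n, (1/2 : Real) ^ i) * (B:Real) ^ nhf := by rw [sum_mul]
    _ <= _ := by
      gcongr
      exact (sum_geometric_two_le n)
lemma ES_le {ι : Type} (P : Nat) [NeZero P] (UI : Finset aa) (Fs : Finset ι) (f : ι -> aa) (co UJ : Finset aa) (k : ZMod P) :
    ‖ES P UI Fs f co UJ k‖ <= (UI.card * Fs.card * co.card * UJ.card : Real) := by
  have h1 : ∀ x : ZMod P, ‖(ZMod.stdAddChar x : Complex)‖ = 1 := fun x => by simp
  rw [ES]
  calc _ <= ∑ u ∈ UI, ∑ a ∈ Fs, ∑ c ∈ co, ∑ z ∈ UJ, (1:Real) := by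
        refine norm_sum_le_of_le _ fun u _ => norm_sum_le_of_le _ fun a _ => norm_sum_le_of_le _ fun c _ =>
          norm_sum_le_of_le _ fun z _ => (h1 _).le
    _ = _ := by simp [mul_assoc]
set_option maxHeartbeats 400000 in
open Classical in
lemma energy {A : Finset Nat} (hA : PA A) {ho al Fm : Real} (ah : 0 < ho) (eb : 0 < al) {C : Nat} {P : Nat} [Fact P.Prime]
    [NeZero P] {ι : Type}
    {U Z : Nat -> Finset aa} {co : Finset aa} {Fs : Finset ι} {f : ι -> aa} {n B S : Nat}
    (hU : ∀ j, ChainU A B j (U j)) (hZ : ∀ j, ChainZ A C B j (Z j)) (hUZ : ∀ j, U (j + 1) = U j * Z j)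
    (hB : 6 <= B) (hBC : 4 * C <= B) (hcc : 1 <= ho * (B ^ (2 ^ n) : Nat)) (hPc : 2 * ((B ^ (2 ^ n) : Nat):Real) ^ 8 <= ho * P)
    (E : Ens A P ho (U (n + 2)) Fs f co (U (n + 5))) (hR : en P ho C al)
    (hFm : ∀ a ∈ Fs, (f a 1 1 : Real) <= Fm) (hBP : B ^ 7 < P)
    (ce : B ^ (2 ^ n) <= S) (ck : S <= (B ^ (2 ^ n)) ^ 80)
    (hco : ∀ t ∈ co, (S : Int) <= t 1 1 ∧ t 1 1 <= C * S) (nco : (S:Real) ^ k49 <= co.card)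
    (W : ZMod P -> Real) (ε : Real) (hε : 0 <= ε) (ld : ∀ k, 0 <= W k) (hW4 : ∀ k, W k <= 4) (hWm : ∀ k, InM P ((B ^ 7 : Nat) : Int) k -> W k <= ε) :
    ∑ k : ZMod P, ‖ES P (U (n + 2)) Fs f co (U (n + 5)) k‖ ^ 2 * W k <=
      (ε * (3 * ((B:Real) ^ 7) ^ 2) + 4 * (al * (2 * (B:Real) ^ nhf)) +
        4 * (2304 * (2 / ho + 1) * (16 * Fm ^ 2 * C ^ 2) / ((B ^ (2 ^ n) : Nat) : Real) ^ 3)) *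
        ((U (n+2)).card * Fs.card * co.card * (U (n+5)).card : Real) ^ 2 := by
  set Om : Real := ((U (n+2)).card * Fs.card * co.card * (U (n+5)).card : Real) with hOm
  have hOm0 : 0 <= Om := by positivity
  have h1 := telesc (fun i k => InM P ((B ^ (2 ^ i) : Nat) ^ 7 : Int) k)
    (fun k : ZMod P => ‖ES P (U (n + 2)) Fs f co (U (n + 5)) k‖ ^ 2 * W k) (fun k => mul_nonneg (by positivity) (ld k)) (n+1)
  have up : ∀ K : Finset (ZMod P), ∑ k ∈ K, ‖ES P (U (n + 2)) Fs f co (U (n + 5)) k‖ ^ 2 * W k <=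
      4 * ∑ k ∈ K, ‖ES P (U (n + 2)) Fs f co (U (n + 5)) k‖ ^ 2 := by
    intro K
    rw [mul_sum]
    refine sum_le_sum fun k _ => ?_
    rw [mul_comm]
    exact mul_le_mul_of_nonneg_right (hW4 k) (by positivity)
  have mm : ∀ i, ((B ^ (2 ^ (i+1)) : Nat) ^ 7 : Int) = ((B ^ (2 ^ i) : Nat) ^ 14 : Int) := by
    intro i
    push_cast
    rw [<- pow_mul, <- pow_mul, pow_succ, mul_assoc]; norm_num
  have cv : ∑ k ∈ univ.filter (fun k : ZMod P => InM P ((B ^ (2 ^ 0) : Nat) ^ 7 : Int) k),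
      ‖ES P (U (n + 2)) Fs f co (U (n + 5)) k‖ ^ 2 * W k <= ε * (3 * ((B:Real) ^ 7) ^ 2) * Om ^ 2 := by
    set K := univ.filter (fun k : ZMod P => InM P ((B ^ (2 ^ 0) : Nat) ^ 7 : Int) k)
    have hK : ∀ k ∈ K, InM P ((B ^ 7 : Nat) : Int) k := fun k hk => by
      have := (mem_filter.1 hk).2
      push_cast; simpa using this
    have hcard := card_major (Nat.one_le_pow _ _ (by omega)) hBP K hK
    calc _ <= ∑ k ∈ K, Om ^ 2 * ε := sum_le_sum fun k hk =>
          mul_le_mul (pow_le_pow_left₀ (norm_nonneg _) (ES_le _ _ _ _ _ _ _) 2) (hWm k (hK k hk)) (ld k) (by positivity)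
      _ = K.card * (Om ^ 2 * ε) := by rw [sum_const, nsmul_eq_mul]
      _ <= (3 * ((B:Real) ^ 7) ^ 2) * (Om ^ 2 * ε) :=
          mul_le_mul_of_nonneg_right (mod_cast hcard) (mul_nonneg (sq_nonneg _) hε)
      _ = _ := by ring
  have ch : ∀ i ∈ range (n+1), ∑ k ∈ univ.filter (fun k : ZMod P => InM P ((B ^ (2 ^ (i+1)) : Nat) ^ 7 : Int) k ∧
      ¬ InM P ((B ^ (2 ^ i) : Nat) ^ 7 : Int) k), ‖ES P (U (n + 2)) Fs f co (U (n + 5)) k‖ ^ 2 * W k <=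
      4 * (al * ((B ^ (2 ^ i) : Nat) : Real) ^ nhf * Om ^ 2) := by
    intro i hi
    refine (up _).trans (mul_le_mul_of_nonneg_left ?_ zero_le_four)
    refine levels hA hU hZ hUZ hB hBC E hR ce ck hco nco i (by have := mem_range.1 hi; omega) _ fun k hk => ?_
    have := (mem_filter.1 hk).2
    rw [mm] at this
    exact this
  have t3 : ∑ k ∈ univ.filter (fun k : ZMod P => ¬ InM P ((B ^ (2 ^ (n+1)) : Nat) ^ 7 : Int) k),
      ‖ES P (U (n + 2)) Fs f co (U (n + 5)) k‖ ^ 2 * W k <=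
      4 * (2304 * (2 / ho + 1) * (16 * Fm ^ 2 * C ^ 2) / ((B ^ (2 ^ n) : Nat) : Real) ^ 3 * Om ^ 2) := by
    refine (up _).trans (mul_le_mul_of_nonneg_left ?_ zero_le_four)
    refine tail hA ah hU hB hcc hPc E hFm ce ck hco nco _ fun k hk => ?_
    have := (mem_filter.1 hk).2
    rw [mm] at this
    exact this
  have t2' := (sum_le_sum ch).trans (le_of_eq (by
    rw [<- mul_sum, <- sum_mul, <- mul_sum] :
    _ = 4 * (al * (∑ i ∈ range (n+1), ((B ^ (2 ^ i) : Nat) : Real) ^ nhf) * Om ^ 2)))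
  have t4 : 4 * (al * (∑ i ∈ range (n+1), ((B ^ (2 ^ i) : Nat) : Real) ^ nhf) * Om ^ 2) <=
      4 * (al * (2 * (B:Real) ^ nhf) * Om ^ 2) :=
    mul_le_mul_of_nonneg_left (mul_le_mul_of_nonneg_right (mul_le_mul_of_nonneg_left (geo (by omega) _) eb.le) (sq_nonneg _)) zero_le_four
  refine h1.trans ?_
  calc _ <= ε * (3 * ((B:Real) ^ 7) ^ 2) * Om ^ 2 + 4 * (al * (2 * (B:Real) ^ nhf) * Om ^ 2) +
      4 * (2304 * (2 / ho + 1) * (16 * Fm ^ 2 * C ^ 2) / ((B ^ (2 ^ n) : Nat) : Real) ^ 3 * Om ^ 2) :=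
        add_le_add (add_le_add cv (t2'.trans t4)) t3
    _ = _ := by ring
end ZD
namespace ZD
open scoped Pointwise
open Finset
lemma WQ_mul {q : Nat} [NeZero q] {x y : Mq q} (hx : x ∈ WQ q) (hy : y ∈ WQ q) : x * y ∈ WQ q := by
  rw [mem_WQ] at *
  rw [Matrix.det_mul]
  rcases hx with h | h <;> rcases hy with h' | h' <;> simp [h, h']
lemma WQ_inv {q : Nat} [NeZero q] {x : Mq q} (hx : x ∈ WQ q) : ∃ y ∈ WQ q, x * y = 1 ∧ y * x = 1 := by
  rw [mem_WQ] at hx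
  have h2 : x.det * x.det = 1 := by rcases hx with h | h <;> simp [h]
  refine ⟨x.det • x.adjugate, ?_, ?_, ?_⟩
  . rw [mem_WQ, Matrix.det_smul, Matrix.det_adjugate]
    simp only [Fintype.card_fin, Nat.add_one_sub_one, pow_one]
    rw [sq, h2, one_mul]; exact hx
  . rw [Matrix.mul_smul, Matrix.mul_adjugate, smul_smul, h2, one_smul]
  . rw [Matrix.smul_mul, Matrix.adjugate_mul, smul_smul, h2, one_smul]
lemma red_WQ {q : Nat} [NeZero q] {g : aa} (hg : Good g) : red q g ∈ WQ q := by
  have h1 : (red q g).det = ((g.det : Int) : ZMod q) := by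
    rw [red, Matrix.det_fin_two, Matrix.det_fin_two]; simp
  have h2 : g.det = 1 ∨ g.det = -1 := by
    have := hg.hd
    rw [Matrix.det_fin_two]
    rw [sq] at this
    exact mul_self_eq_one_iff.1 this
  rw [mem_WQ, h1]
  rcases h2 with h | h <;> simp [h]
open Classical in
lemma count_g {q : Nat} [NeZero q] {x y : Mq q} (hx : x ∈ WQ q) (hy : y ∈ WQ q) (d : ZMod q) :
    ((WQ q).filter (fun g => g 1 1 = d)).card <= ((WQ q).filter (fun g => (x * g * y) 1 1 = d)).card := by
  obtain ⟨x', hx', ab, ac⟩ := WQ_inv hx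
  obtain ⟨y', hy', bv, bz⟩ := WQ_inv hy
  have key : ∀ g : Mq q, x * (x' * g * y') * y = g := by
    intro g
    calc x * (x' * g * y') * y = (x * x') * g * (y' * y) := by simp only [mul_assoc]
      _ = g := by rw [ab, bz, one_mul, mul_one]
  refine card_le_card_of_injOn (fun g => x' * g * y') ?_ ?_
  . intro g hg
    simp only [coe_filter, Set.mem_ofPred_eq] at hg ⊢
    exact ⟨WQ_mul (WQ_mul hx' hg.1) hy', by rw [key]; exact hg.2⟩
  . intro g _ h _ e
    simp only at e
    rw [<- key g, <- key h, e]
noncomputable def XX (u w : aa) : Real := ((u 1 0 : Real) + Real.goldenRatio * u 1 1) * ((w 0 1 : Real) + (1 + √2) * w 1 1)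
lemma D_sandwich {u w f : aa} (hu : Good u) (hw : Good w) {t η : Real}
    (hf : ∀ a b, t * VV a b <= f a b ∧ (f a b : Real) <= (1 + η) * (t * VV a b)) :
    t * XX u w <= ((u * f * w) 1 1 : Int) ∧ (((u * f * w) 1 1 : Int) : Real) <= (1 + η) * (t * XX u w) := by
  have ep : (0:Real) <= u 1 0 := by have := hu.p10; exact_mod_cast (by omega : (0:Int) <= u 1 0)
  have lw : (0:Real) <= u 1 1 := by have := hu.p11; exact_mod_cast (by omega : (0:Int) <= u 1 1)
  have w0 : (0:Real) <= w 0 1 := by have := hw.p01; exact_mod_cast (by omega : (0:Int) <= w 0 1)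
  have cn : (0:Real) <= w 1 1 := by have := hw.p11; exact_mod_cast (by omega : (0:Int) <= w 1 1)
  have eu := hf 0 0
  have kb := hf 0 1
  have kc := hf 1 0
  have ke := hf 1 1
  have e : (((u * f * w) 1 1 : Int) : Real) = u 1 0 * w 0 1 * f 0 0 + u 1 0 * w 1 1 * f 0 1 + u 1 1 * w 0 1 * f 1 0
      + u 1 1 * w 1 1 * f 1 1 := by
    rw [ao, cw, ao]; push_cast; ring
  have ac : ∀ s : Real, s * XX u w = u 1 0 * w 0 1 * (s * VV 0 0) + u 1 0 * w 1 1 * (s * VV 0 1) + u 1 1 * w 0 1 * (s * VV 1 0)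
      + u 1 1 * w 1 1 * (s * VV 1 1) := by
    intro s; simp [XX, VV]; ring
  rw [e]
  constructor
  . rw [ac]; gcongr
    . exact eu.1
    . exact kb.1
    . exact kc.1
    . exact ke.1
  . rw [<- mul_assoc, ac]
    simp only [mul_assoc (1 + η)]
    gcongr
    . exact eu.2
    . exact kb.2
    . exact kc.2
    . exact ke.2
lemma XX_bd {u c z : aa} (hu : Good u) (hc : Good c) (hz : Good z) :
    3 * (u 1 1 * c 1 1 * z 1 1 : Real) <= XX u (c * z.transpose) ∧ XX u (c * z.transpose) <= 20 * (u 1 1 * c 1 1 * z 1 1) := by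
  have hw := hc.mul hz.transpose
  have bk : Real.goldenRatio <= 1.62 := by
    rw [Real.goldenRatio]; have : √5 <= 2.24 := Real.sqrt_le_iff.2 ⟨by norm_num, by norm_num⟩; linarith
  have bw : 1.6 <= Real.goldenRatio := by
    rw [Real.goldenRatio]; have : 2.2 <= √5 := Real.le_sqrt_of_sq_le (by norm_num); linarith
  have av : √2 <= 1.42 := Real.sqrt_le_iff.2 ⟨by norm_num, by norm_num⟩
  have ap : 1.4 <= √2 := Real.le_sqrt_of_sq_le (by norm_num)
  have wl : c 1 1 * z 1 1 <= (c * z.transpose) 1 1 := by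
    rw [fd]; have := mul_nonneg (zero_le_one.trans hc.p10) (zero_le_one.trans hz.p10); linarith
  have wu : (c * z.transpose) 1 1 <= 2 * (c 1 1 * z 1 1) := by
    rw [fd]; have := mul_le_mul hc.h4 hz.h4 (zero_le_one.trans hz.p10) (zero_le_one.trans hc.p11); linarith
  have w01 := hw.h2
  have w01' := hw.p01
  have u10 := hu.h4
  have u10' := hu.p10
  have u11 := hu.p11
  have c11 := hc.p11
  have z11 := hz.p11
  rw [XX]
  generalize (c * z.transpose) 1 1 = w at *
  generalize (c * z.transpose) 0 1 = w' at *
  have wl' : (c 1 1 * z 1 1 : Real) <= w := mod_cast wl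
  have wu' : (w:Real) <= 2 * (c 1 1 * z 1 1) := mod_cast wu
  have w01r : (w':Real) <= w := mod_cast w01
  have w01r' : (1:Real) <= w' := mod_cast w01'
  have ur : (u 1 0:Real) <= u 1 1 := mod_cast u10
  have ur' : (1:Real) <= u 1 0 := mod_cast u10'
  have cr : (1:Real) <= c 1 1 := mod_cast c11
  have zr : (1:Real) <= z 1 1 := mod_cast z11
  generalize (u 1 0 : Real) = a at *
  generalize (u 1 1 : Real) = b at *
  rw [mul_assoc b]
  have cz : (0:Real) <= (c 1 1 : Real) * z 1 1 := by positivity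
  generalize (c 1 1 : Real) * z 1 1 = s at *
  have hb : 0 <= b := by linarith
  have ba : 1.6 * b <= a + Real.goldenRatio * b := by nlinarith
  have cg : a + Real.goldenRatio * b <= 2.62 * b := by nlinarith
  have ex : 2.4 * s <= w' + (1 + √2) * w := by nlinarith
  have go : w' + (1 + √2) * w <= 6.84 * s := by nlinarith
  have bs : 0 <= b * s := by positivity
  constructor
  . calc 3 * (b * s) <= (1.6 * b) * (2.4 * s) := by nlinarith
      _ <= _ := mul_le_mul ba ex (by positivity) (by linarith)
  . calc _ <= (2.62 * b) * (6.84 * s) := mul_le_mul cg go (by linarith) (by linarith)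
      _ <= _ := by nlinarith
end ZD
namespace ZD
open scoped Pointwise
open Finset
lemma pick_i {η ae D N d : Real} {K : Nat} (hη : 0 < η) (hN : 0 < N) (bo : 0 < ae) (hK : ae <= η * K) (gx : N / ae <= D) (hD2 : D <= N / 2)
    (hd1 : N / 2 <= d) (hd2 : d <= N) : ∃ i : Nat, i < K + 1 ∧ ∀ x : Real, (1 + i * η) * D <= x -> x <= (1 + η) * ((1 + i * η) * D) ->
      |d - x| <= η * N := by
  have hD : 0 < D := lt_of_lt_of_le (by positivity) gx
  set y := (d / D - 1) / η with hy
  have hdD : 1 <= d / D := by rw [le_div_iff₀ hD]; linarith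
  have au : 0 <= y := div_nonneg (by linarith) hη.le
  have ey : d = (1 + y * η) * D := by rw [hy]; field_simp; ring
  have h1 := Nat.floor_le au
  have h2 := Nat.lt_floor_add_one y
  refine ⟨⌊y⌋₊, ?_, ?_⟩
  . rw [Nat.lt_add_one_iff]
    have : y <= K := by
      rw [hy, div_le_iff₀ hη]
      have : d / D <= ae := by
        rw [div_le_iff₀ hD]
        rw [div_le_iff₀ bo] at gx
        linarith
      linarith
    exact Nat.floor_le_of_le this
  . intro x fg fv
    generalize (⌊y⌋₊ : Real) = i at *
    have bp : (1 + i * η) * D <= d := by rw [ey]; gcongr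
    have br : d <= (1 + i * η) * D + η * D := by
      rw [ey]; nlinarith [mul_pos hη hD]
    have cy : η * D <= η * N := by gcongr; linarith
    have ec : η * ((1 + i * η) * D) <= η * N := by gcongr; linarith
    rw [abs_le]; constructor <;> linarith
lemma red11 (q : Nat) (g : aa) : (red q g) 1 1 = ((g 1 1 : Int) : ZMod q) := rfl
open Classical in
lemma lower_R {P q : Nat} [NeZero q] {UI co UJ : Finset aa} {f : Mq q × Nat -> aa} {K hm d : Nat} {M R : Real}
    (hu : ∀ u ∈ UI, Good u) (hc : ∀ u ∈ co, Good u) (hz : ∀ u ∈ UJ, Good u)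
    (hf : ∀ g ∈ WQ q, ∀ i < K + 1, red q (f (g, i)) = g)
    (hi : ∀ u ∈ UI, ∀ c ∈ co, ∀ z ∈ UJ, ∃ i < K + 1, ∀ g ∈ WQ q, |(d:Real) - ((u * f (g, i) * c * z.transpose) 1 1 : Int)| <= R)
    (dr : R < q * (hm + 1)) (hM : M <= ((WQ q).filter (fun g => g 1 1 = (d : ZMod q))).card) :
    UI.card * co.card * UJ.card * M <= (((UI ×ˢ (WQ q ×ˢ range (K+1)) ×ˢ co ×ˢ UJ) ×ˢ Finset.Icc (-(hm:Int)) hm).filter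
      (fun p => (((p.1.1 * f p.1.2.1 * p.1.2.2.1 * p.1.2.2.2.transpose) 1 1 : Int) : ZMod P) + (((q:Int) * p.2 : Int) : ZMod P) = (d : ZMod P))).card := by
  have hi' : ∀ t : aa × aa × aa, ∃ i, t ∈ UI ×ˢ co ×ˢ UJ -> i < K + 1 ∧ ∀ g ∈ WQ q,
      |(d:Real) - ((t.1 * f (g, i) * t.2.1 * t.2.2.transpose) 1 1 : Int)| <= R := by
    rintro ⟨u, c, z⟩
    by_cases h : (u, c, z) ∈ UI ×ˢ co ×ˢ UJ
    . simp only [mem_product] at h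
      obtain ⟨i, h1, h2⟩ := hi u h.1 c h.2.1 z h.2.2
      exact ⟨i, fun _ => ⟨h1, h2⟩⟩
    . exact ⟨0, fun h' => absurd h' h⟩
  choose I hI using hi'
  have hq : (0:Int) < q := mod_cast NeZero.pos q
  set S : Finset (Σ _ : aa × aa × aa, Mq q) := (UI ×ˢ co ×ˢ UJ).sigma (fun t => (WQ q).filter
    (fun g => (red q t.1 * g * red q (t.2.1 * t.2.2.transpose)) 1 1 = (d : ZMod q))) with hS
  have hScard : UI.card * co.card * UJ.card * M <= (S.card : Real) := by
    rw [hS, card_sigma]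
    push_cast
    calc UI.card * co.card * UJ.card * M = ∑ t ∈ UI ×ˢ co ×ˢ UJ, M := by
          rw [sum_const, nsmul_eq_mul, card_product, card_product]; push_cast; ring
      _ <= _ := by
          refine sum_le_sum fun t ht => hM.trans ?_
          simp only [mem_product] at ht
          exact_mod_cast count_g (red_WQ (hu _ ht.1)) (red_WQ ((hc _ ht.2.1).mul (hz _ ht.2.2).transpose)) _
  refine hScard.trans ?_
  let D : (Σ _ : aa × aa × aa, Mq q) -> Int := fun s => (s.1.1 * f (s.2, I s.1) * s.1.2.1 * s.1.2.2.transpose) 1 1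
  have hdvd : ∀ s ∈ S, (q:Int) * (((d:Int) - D s) / q) = (d:Int) - D s := by
    intro s hs
    rw [hS, mem_sigma, mem_filter] at hs
    refine Int.mul_ediv_cancel' ?_
    rw [<- ZMod.intCast_zmod_eq_zero_iff_dvd]
    push_cast
    have e := hs.2.2
    rw [<- hf s.2 hs.2.1 (I s.1) (hI s.1 hs.1).1, <- red_mul, <- red_mul, red11, <- mul_assoc] at e
    rw [<- e]; exact sub_self _
  have := card_le_card_of_injOn (s := S) (t := (((UI ×ˢ (WQ q ×ˢ range (K+1)) ×ˢ co ×ˢ UJ) ×ˢ Finset.Icc (-(hm:Int)) hm).filter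
      (fun p => (((p.1.1 * f p.1.2.1 * p.1.2.2.1 * p.1.2.2.2.transpose) 1 1 : Int) : ZMod P) + (((q:Int) * p.2 : Int) : ZMod P) = (d : ZMod P))))
    (fun s => ((s.1.1, (s.2, I s.1), s.1.2.1, s.1.2.2), ((d:Int) - D s) / q)) ?_ ?_
  . exact_mod_cast this
  . intro s hs
    have hs' := hs
    have hdv := hdvd s hs
    rw [mem_coe, hS, mem_sigma, mem_filter] at hs'
    have h1 := mem_product.1 hs'.1
    have h2 := mem_product.1 h1.2
    have h3 := hI s.1 hs'.1
    rw [mem_coe, mem_filter]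
    refine ⟨?_, ?_⟩
    . simp only [mem_product, mem_range, mem_Icc]
      refine ⟨⟨h1.1, ⟨hs'.2.1, h3.1⟩, h2.1, h2.2⟩, ?_⟩
      have h4 : |((d:Int) - D s : Real)| <= R := by simpa using h3.2 s.2 hs'.2.1
      have ay : |(d:Int) - D s| < q * (hm + 1) := by
        have := lt_of_le_of_lt h4 dr
        exact_mod_cast this
      rw [<- hdv, abs_mul, abs_of_pos hq] at ay
      have bb := lt_of_mul_lt_mul_left ay hq.le
      exact abs_le.1 (Int.lt_add_one_iff.1 bb)
    . show ((D s : Int) : ZMod P) + _ = _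
      rw [hdv]; push_cast; ring
  . rintro ⟨⟨u, c, z⟩, g⟩ _ ⟨⟨u', c', z'⟩, g'⟩ _ e
    simp only [Prod.mk.injEq] at e
    obtain ⟨⟨rfl, ⟨rfl, _⟩, rfl, rfl⟩, _⟩ := e
    rfl
end ZD
namespace ZD
open scoped Pointwise
open Finset
lemma Ens.mem {A : Finset Nat} {P : Nat} {ho : Real} {ι : Type} {UI co UJ : Finset aa} {Fs : Finset ι} {f : ι -> aa}
    (E : Ens A P ho UI Fs f co UJ) {u c z : aa} {a : ι} (hu : u ∈ UI) (ha : a ∈ Fs) (hc : c ∈ co) (hz : z ∈ UJ) :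
    ∃ n, 2 <= n ∧ u * f a * c * z.transpose ∈ G A ^ n := by
  obtain ⟨dz, h1, av⟩ := E.uG
  obtain ⟨fw, h2, ap⟩ := E.fG a ha
  obtain ⟨ea, h3, lf⟩ := E.cG
  obtain ⟨n4, h4, lg⟩ := E.zG
  exact ⟨dz + fw + ea + n4, by omega, memG_mul (memG_mul (memG_mul (av hu) ap) (lf hc)) (transpose_mem (lg hz))⟩
lemma ES_prod {ι : Type} {P : Nat} [NeZero P] {UI co UJ : Finset aa} {Fs : Finset ι} {f : ι -> aa} (k : ZMod P) :
    ES P UI Fs f co UJ k = ∑ w ∈ UI ×ˢ Fs ×ˢ co ×ˢ UJ,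
      ZMod.stdAddChar (k * (((w.1 * f w.2.1 * w.2.2.1 * w.2.2.2.transpose) 1 1 : Int) : ZMod P)) := by
  rw [ES, sum_product]
  refine sum_congr rfl fun u _ => ?_
  rw [sum_product]
  refine sum_congr rfl fun a _ => ?_
  rw [sum_product]
lemma not_hit {A : Finset Nat} (hA : PA A) {P : Nat} {ho : Real} (ah : 0 < ho) (hP : 0 < P) {ι : Type} {UI co UJ : Finset aa} {Fs : Finset ι} {f : ι -> aa}
    (E : Ens A P ho UI Fs f co UJ) {u c z : aa} {a : ι} (hu : u ∈ UI) (ha : a ∈ Fs) (hc : c ∈ co) (hz : z ∈ UJ)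
    {d : Nat} (mc : 0 < d) (hdP : d < P) (hd : ¬ memD (A : Set Nat) d) :
    (((u * f a * c * z.transpose) 1 1 : Int) : ZMod P) ≠ (d : ZMod P) := by
  obtain ⟨n, hn, hmem⟩ := E.mem hu ha hc hz
  have h := E.hd u hu a ha c hc z hz
  have hpos : (0:Real) < ((u * f a * c * z.transpose) 1 1 : Int) := lt_of_lt_of_le (by positivity) h.1
  have hpos' : 0 < (u * f a * c * z.transpose) 1 1 := mod_cast hpos
  have hle := h.2
  intro e
  refine hd (memD_of hA hn hmem ?_)
  generalize (u * f a * c * z.transpose) 1 1 = D at *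
  have e' : ((D : Int) : ZMod P) = ((d : Int) : ZMod P) := by rw [e]; push_cast; rfl
  rw [ZMod.intCast_eq_intCast_iff, Int.ModEq] at e'
  rw [Int.emod_eq_of_lt (b := (P:Int)) (a := (d:Int)) (by omega) (by omega)] at e'
  rcases hle.lt_or_eq with h1 | h1
  . rwa [Int.emod_eq_of_lt (by omega) h1] at e'
  . rw [h1, Int.emod_self] at e'; omega
open Classical in
lemma bad_count {A : Finset Nat} (hA : PA A) {P q : Nat} [NeZero q] [NeZero P] {ho : Real} (ah : 0 < ho)
    {UI co UJ : Finset aa} {f : Mq q × Nat -> aa} {K hm N : Nat} {L η ae T : Real}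
    (E : Ens A P ho UI (WQ q ×ˢ range (K+1)) f co UJ)
    (hf : ∀ g ∈ WQ q, ∀ i < K + 1, red q (f (g, i)) = g ∧
      ∀ a b, ((1 + i * η) * T) * VV a b <= f (g, i) a b ∧ (f (g, i) a b : Real) <= (1 + η) * (((1 + i * η) * T) * VV a b))
    (hX : ∀ u ∈ UI, ∀ c ∈ co, ∀ z ∈ UJ, N / ae <= T * XX u (c * z.transpose) ∧ T * XX u (c * z.transpose) <= N / 2)
    (hη : 0 < η) (hN : 0 < N) (bo : 0 < ae) (hK : ae <= η * K) (hNP : N < P) (dr : η * N < q * (hm + 1))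
    (Bd : Finset Nat) (hBd : ∀ d ∈ Bd, N < 2 * d ∧ d <= N ∧ ∑ p ∈ d.primeFactors, (1 / (p:Real)) <= L ∧ ¬ memD (A : Set Nat) d) :
    Bd.card * (UI.card * co.card * UJ.card * ((q:Real) ^ 2 * Real.exp (-2 * L)) / (2 * hm + 1 : Real)) ^ 2 * P <=
      ∑ k : ZMod P, ‖ES P UI (WQ q ×ˢ range (K+1)) f co UJ k‖ ^ 2 *
        ‖1 - (1 / ((Finset.Icc (-(hm:Int)) hm).card : Complex)) * ∑ t ∈ Finset.Icc (-(hm:Int)) hm, ZMod.stdAddChar (k * (((q:Int) * t : Int) : ZMod P))‖ ^ 2 := by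
  have hu : ∀ u ∈ UI, Good u := by obtain ⟨n, h1, h2⟩ := E.uG; exact fun u hu => good_pow hA h1 (h2 hu)
  have hc : ∀ u ∈ co, Good u := by obtain ⟨n, h1, h2⟩ := E.cG; exact fun u hu => good_pow hA h1 (h2 hu)
  have hz : ∀ u ∈ UJ, Good u := by obtain ⟨n, h1, h2⟩ := E.zG; exact fun u hu => good_pow hA h1 (h2 hu)
  have hcard : ((Finset.Icc (-(hm:Int)) hm).card : Real) = 2 * hm + 1 := by
    rw [Int.card_Icc]
    have : ((hm:Int) + 1 - -(hm:Int)).toNat = 2 * hm + 1 := by omega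
    rw [this]; push_cast; ring
  have hBc : (Bd.image (fun d : Nat => (d : ZMod P))).card = Bd.card := by
    refine card_image_of_injOn fun a ha b hb e => ?_
    have h1 := hBd a ha
    have h2 := hBd b hb
    rw [ZMod.natCast_eq_natCast_iff'] at e
    rwa [Nat.mod_eq_of_lt (by omega), Nat.mod_eq_of_lt (by omega)] at e
  have hFB := fourier_bad (UI ×ˢ (WQ q ×ˢ range (K+1)) ×ˢ co ×ˢ UJ)
    (fun w => (((w.1 * f w.2.1 * w.2.2.1 * w.2.2.2.transpose) 1 1 : Int) : ZMod P)) (Finset.Icc (-(hm:Int)) hm)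
    (fun t : Int => (((q:Int) * t : Int) : ZMod P)) (nonempty_Icc.2 (by omega)) (Bd.image (fun d : Nat => (d : ZMod P)))
    (UI.card * co.card * UJ.card * ((q:Real) ^ 2 * Real.exp (-2 * L)) / (2 * hm + 1 : Real)) (by positivity) ?_ ?_
  . rw [hBc] at hFB
    simp only [ES_prod]
    exact hFB
  . intro x hx w hw
    obtain ⟨d, hd, rfl⟩ := mem_image.1 hx
    simp only [mem_product] at hw
    have h := hBd d hd
    exact not_hit hA ah (by omega) E hw.1 (mem_product.2 ⟨hw.2.1.1, hw.2.1.2⟩) hw.2.2.1 hw.2.2.2 (by omega) (by omega) h.2.2.2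
  . intro x hx
    obtain ⟨d, hd, rfl⟩ := mem_image.1 hx
    have h := hBd d hd
    rw [hcard, div_mul_cancel₀ _ (by positivity)]
    have hlow := N_lower q d (by omega) L h.2.2.1
    refine lower_R hu hc hz (fun g hg i hi => (hf g hg i hi).1) ?_ dr hlow
    intro u huU c hcU z hzU
    have fv := hX u huU c hcU z hzU
    obtain ⟨i, hi, hh⟩ := pick_i (d := (d:Real)) hη (mod_cast hN) bo hK fv.1 fv.2
      (by have : (N:Real) < 2 * d := mod_cast h.1
          linarith) (mod_cast h.2.1)
    refine ⟨i, hi, fun g hg => ?_⟩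
    have hs := D_sandwich (hu u huU) ((hc c hcU).mul (hz z hzU).transpose) (hf g hg i hi).2
    rw [<- mul_assoc (u * f (g, i))] at hs
    refine hh _ ?_ ?_
    . rw [<- mul_assoc]; exact hs.1
    . rw [<- mul_assoc (1 + i * η)]; exact hs.2
end ZD
namespace ZD
open scoped Pointwise
open Finset
lemma bad_num {Bd X W az h e q P η er ae : Real} (hX : 0 < X) (ld : 0 <= W) (hW : W <= 2 * q ^ 3) (eb : 0 <= az) (hK : az * η <= ae + 2)
    (hh0 : 0 < h) (hh : h * q <= 3 * η * P) (hq : 0 < q) (hP : 0 < P) (hE : 0 <= er)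
    (H : Bd * (X * (q ^ 2 * e) / h) ^ 2 * P <= er * (X * (W * az)) ^ 2) :
    Bd * e ^ 2 <= er * (36 * (ae + 2) ^ 2) * P := by
  have h1 : W * az * h <= 6 * q ^ 2 * (ae + 2) * P := by
    calc W * az * h <= (2 * q ^ 3) * az * h := by gcongr
      _ = 2 * q ^ 2 * az * (h * q) := by ring
      _ <= 2 * q ^ 2 * az * (3 * η * P) := by gcongr
      _ = 6 * q ^ 2 * (az * η) * P := by ring
      _ <= _ := by gcongr
  have h2 : (W * az * h) ^ 2 <= (6 * q ^ 2 * (ae + 2) * P) ^ 2 := pow_le_pow_left₀ (by positivity) h1 2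
  have h3 : (Bd * e ^ 2) * (X ^ 2 * q ^ 4 * P) <= (er * (36 * (ae + 2) ^ 2) * P) * (X ^ 2 * q ^ 4 * P) := by
    calc (Bd * e ^ 2) * (X ^ 2 * q ^ 4 * P) = (Bd * (X * (q ^ 2 * e) / h) ^ 2 * P) * h ^ 2 := by field_simp
      _ <= (er * (X * (W * az)) ^ 2) * h ^ 2 := by gcongr
      _ = er * X ^ 2 * (W * az * h) ^ 2 := by ring
      _ <= er * X ^ 2 * (6 * q ^ 2 * (ae + 2) * P) ^ 2 := by gcongr
      _ = _ := by ring
  exact le_of_mul_le_mul_right h3 (by positivity)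
lemma scale {B : Nat} (hB : 2 <= B) {N : Nat} (hN : B ^ 40 <= N) : ∃ n, (B ^ (2 ^ n)) ^ 40 <= N ∧ N < (B ^ (2 ^ n)) ^ 80 := by
  have hex : ∃ n, N < (B ^ (2 ^ n)) ^ 80 := by
    refine ⟨N, ?_⟩
    calc N < 2 ^ N := Nat.lt_two_pow_self
      _ <= B ^ N := Nat.pow_le_pow_left hB _
      _ <= B ^ (2 ^ N) := Nat.pow_le_pow_right (by omega) Nat.lt_two_pow_self.le
      _ <= _ := Nat.le_self_pow (by norm_num) _
  classical
  refine ⟨Nat.find hex, ?_, Nat.find_spec hex⟩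
  rcases Nat.eq_zero_or_eq_succ_pred (Nat.find hex) with h | h
  . rw [h]; simpa using hN
  . rw [h]
    have := Nat.find_min hex (m := (Nat.find hex).pred) (by omega)
    rw [not_lt] at this
    refine le_trans (le_of_eq ?_) this
    rw [<- pow_mul, <- pow_mul, Nat.succ_eq_add_one, pow_succ, mul_assoc]; norm_num
lemma choose_S {C T mI mJ c N : Real} (hC : 1 <= C) (hT : 1 <= T) (hI : 1 <= mI) (hJ : 1 <= mJ) (hI2 : mI <= c ^ 4) (hJ2 : mJ <= c ^ 32)
    (hc : 320 * C * T <= c) (gy : c ^ 40 <= N) (hN2 : N < c ^ 80) : ∃ S : Nat, c <= S ∧ (S:Real) <= c ^ 80 ∧ 1 <= S ∧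
      160 * C * T * mI * mJ * S <= N ∧ N <= 320 * C * T * mI * mJ * S := by
  have hCT : 1 <= C * T := by nlinarith
  have kz : 320 <= c := by nlinarith
  set Dn := 160 * C * T * mI * mJ with hDn
  have hIJ : 1 <= mI * mJ := by nlinarith
  have gx : 1 <= Dn := by
    have : Dn = 160 * ((C * T) * (mI * mJ)) := by rw [hDn]; ring
    rw [this]; nlinarith
  have hD2 : Dn * c ^ 2 <= N := by
    calc Dn * c ^ 2 = (160 * C * T) * (mI * mJ) * c ^ 2 := by rw [hDn]; ring
      _ <= c * (c ^ 4 * c ^ 32) * c ^ 2 := by gcongr; nlinarith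
      _ = c ^ 39 := by ring
      _ <= c ^ 40 := pow_le_pow_right₀ (by linarith) (by norm_num)
      _ <= N := gy
  have hDp : 0 < Dn := by linarith
  have hq : c ^ 2 <= N / Dn := by rw [le_div_iff₀ hDp]; linarith
  have fz : 0 <= N := le_trans (by positivity) gy
  have ct := Nat.floor_le (div_nonneg fz hDp.le)
  have cu := Nat.lt_floor_add_one (N / Dn)
  set S := ⌊N / Dn⌋₊
  have hcS : c <= S := by nlinarith
  have ce : (1:Real) <= S := by linarith
  refine ⟨S, hcS, ?_, mod_cast ce, ?_, ?_⟩
  . refine ct.trans ((div_le_self fz gx).trans hN2.le)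
  . rw [le_div_iff₀ hDp] at ct; linarith
  . rw [div_lt_iff₀ hDp] at cu
    have : 320 * C * T * mI * mJ * S = 2 * Dn * S := by rw [hDn]; ring
    rw [this]; nlinarith
lemma minU {A : Finset Nat} {B j : Nat} {U : Finset aa} (h : ChainU A B j U) (hB : 1 <= B) :
    ∃ m : Real, 1 <= m ∧ m <= (B:Real) ^ (2 ^ j) ∧ ∀ u ∈ U, m <= u 1 1 ∧ (u 1 1 : Real) <= 2 * m := by
  have hne : U.Nonempty := by
    rw [<- card_pos]
    have h1 := h.card
    have : (0:Real) < U.card := lt_of_lt_of_le (Real.rpow_pos_of_pos (by positivity) _) h1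
    exact_mod_cast this
  obtain ⟨ep, lh, hmin⟩ := exists_min_image U (fun u => u 1 1) hne
  have bb := h.ge ep lh
  have hle := h.le ep lh
  have h6' : (6:Real) <= ep 1 1 := mod_cast bb
  refine ⟨ep 1 1, by linarith, mod_cast hle, fun u hu => ⟨mod_cast hmin u hu, ?_⟩⟩
  refine (h.spr u hu ep lh 1 1).trans ?_
  have : (0:Real) <= (1/2) ^ (j+1) := by positivity
  nlinarith
lemma TX_bd {C T mI mJ S N es bg ds X : Real} (hC : 1 <= C) (hT : 1 <= T) (hI : 1 <= mI) (hJ : 1 <= mJ) (fy : 1 <= S)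
    (ce : 160 * C * T * mI * mJ * S <= N) (ck : N <= 320 * C * T * mI * mJ * S)
    (hu : mI <= es ∧ es <= 2 * mI) (hc : S <= bg ∧ bg <= C * S) (hz : mJ <= ds ∧ ds <= 2 * mJ)
    (hX1 : 3 * (es * bg * ds) <= X) (hX2 : X <= 20 * (es * bg * ds)) : N / (120 * C) <= T * X ∧ T * X <= N / 2 := by
  have ep : 0 < es := by linarith [hu.1]
  have ho : 0 < bg := by linarith [hc.1]
  have z0 : 0 < ds := by linarith [hz.1]
  have h1 : mI * S * mJ <= es * bg * ds := by
    have := hu.1; have := hc.1; have := hz.1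
    gcongr
  have h2 : es * bg * ds <= (2 * mI) * (C * S) * (2 * mJ) := by
    have := hu.2; have := hc.2; have := hz.2
    gcongr
  constructor
  . rw [div_le_iff₀ (by positivity)]
    calc N <= 320 * C * T * mI * mJ * S := ck
      _ <= 360 * C * T * mI * mJ * S := by gcongr; norm_num
      _ = T * (3 * (mI * S * mJ)) * (120 * C) := by ring
      _ <= T * X * (120 * C) := by gcongr; linarith
  . calc T * X <= T * (20 * ((2 * mI) * (C * S) * (2 * mJ))) := by gcongr; linarith
      _ = (160 * C * T * mI * mJ * S) / 2 := by ring
      _ <= _ := by linarith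
end ZD
namespace ZD
open scoped Pointwise
open Finset
lemma mk_ens {A : Finset Nat} (hA : PA A) {P q : Nat} [NeZero q] {ho : Real}
    {UI co UJ : Finset aa} {f : Mq q × Nat -> aa} {K N : Nat} {η ae T : Real} (ah : ho = 1 / (2 * ae * (ae + 3)))
    (hf : ∀ g ∈ WQ q, ∀ i < K + 1, (∃ n, 1 <= n ∧ f (g, i) ∈ G A ^ n) ∧ red q (f (g, i)) = g ∧
      ∀ a b, ((1 + i * η) * T) * VV a b <= f (g, i) a b ∧ (f (g, i) a b : Real) <= (1 + η) * (((1 + i * η) * T) * VV a b))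
    (hX : ∀ u ∈ UI, ∀ c ∈ co, ∀ z ∈ UJ, N / ae <= T * XX u (c * z.transpose) ∧ T * XX u (c * z.transpose) <= N / 2)
    (hU : ∃ n, 1 <= n ∧ UI ⊆ G A ^ n) (hco : ∃ n, 1 <= n ∧ co ⊆ G A ^ n) (hJ : ∃ n, 1 <= n ∧ UJ ⊆ G A ^ n)
    (hη : 0 < η) (cd : η <= 1) (bo : 0 < ae) (hK : η * K <= ae) (gz : (ae + 3) * N <= P) (mn : (P:Real) <= 2 * (ae + 3) * N) :
    Ens A P ho UI (WQ q ×ˢ range (K+1)) f co UJ := by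
  have hu' : ∀ u ∈ UI, Good u := by obtain ⟨n, h1, h2⟩ := hU; exact fun u hu => good_pow hA h1 (h2 hu)
  have hc' : ∀ u ∈ co, Good u := by obtain ⟨n, h1, h2⟩ := hco; exact fun u hu => good_pow hA h1 (h2 hu)
  have hz' : ∀ u ∈ UJ, Good u := by obtain ⟨n, h1, h2⟩ := hJ; exact fun u hu => good_pow hA h1 (h2 hu)
  refine ⟨?_, hU, hco, hJ, ?_⟩
  . rintro ⟨g, i⟩ ha
    simp only [mem_product, mem_range] at ha
    exact (hf g ha.1 i ha.2).1
  . rintro u hu ⟨g, i⟩ ha c hc z hz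
    simp only [mem_product, mem_range] at ha
    have hs := D_sandwich (hu' u hu) ((hc' c hc).mul (hz' z hz).transpose) (hf g ha.1 i ha.2).2.2
    rw [<- mul_assoc (u * f (g, i))] at hs
    have hx := hX u hu c hc z hz
    generalize (u * f (g, i) * c * z.transpose) 1 1 = D at *
    rw [mul_assoc (1 + (i:Real) * η)] at hs
    generalize T * XX u (c * z.transpose) = X at *
    have fz : (0:Real) <= N := Nat.cast_nonneg N
    have df : 0 <= X := le_trans (by positivity) hx.1
    have hi : (i:Real) * η <= ae := by
      have : (i:Real) <= K := mod_cast Nat.lt_add_one_iff.1 ha.2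
      nlinarith
    have ar : 0 <= (i:Real) * η := by positivity
    constructor
    . calc ho * P <= ho * (2 * (ae + 3) * N) := by rw [ah]; gcongr
        _ = N / ae := by rw [ah]; field_simp
        _ <= X := hx.1
        _ <= (1 + i * η) * X := by nlinarith
        _ <= _ := hs.1
    . have : (D:Real) <= P := by
        calc (D:Real) <= _ := hs.2
          _ <= (1 + 1) * ((1 + ae) * (N / 2)) := by
            have := hx.2
            gcongr
          _ <= (ae + 3) * N := by nlinarith
          _ <= P := gz
      exact_mod_cast this
lemma fact_dvd (H q : Nat) (h1 : 1 <= q) (h2 : q <= H) : q ∣ H.factorial := Nat.dvd_factorial h1 h2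
lemma eps_num {B : Nat} (hB : 6 <= B) {η : Real} (hη : η = 1 / ((B:Real) ^ 7) ^ 3) :
    (2 * Real.pi * η * ((B ^ 7 : Nat) : Real)) ^ 2 * (3 * ((B:Real) ^ 7) ^ 2) <= 120 * (B:Real) ^ nhf := by
  have fe : (1:Real) <= B := mod_cast (by omega : 1 <= B)
  have hp : Real.pi ^ 2 <= 10 := by nlinarith [Real.pi_lt_d2, Real.pi_pos]
  have e : (2 * Real.pi * η * ((B ^ 7 : Nat) : Real)) ^ 2 * (3 * ((B:Real) ^ 7) ^ 2) = 12 * Real.pi ^ 2 * (1 / (B:Real) ^ 14) := by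
    rw [hη]; push_cast; field_simp; ring
  have h2 : 1 / (B:Real) ^ 14 <= (B:Real) ^ nhf := by
    rw [one_div, <- Real.rpow_natCast, <- Real.rpow_neg (by linarith)]
    exact Real.rpow_le_rpow_of_exponent_le fe (by norm_num)
  rw [e]
  calc 12 * Real.pi ^ 2 * (1 / (B:Real) ^ 14) <= 12 * 10 * (B:Real) ^ nhf := by gcongr
    _ = _ := by ring
lemma tail_num {B c Q : Real} (hB : 1 <= B) (hc : 1 <= c) (hQ : 0 <= Q) (h : Q * B <= c) : Q / c ^ 3 <= B ^ nhf := by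
  have h1 : Q / c ^ 3 <= B ^ (-1 : Real) := by
    rw [Real.rpow_neg_one, div_le_iff₀ (by positivity), <- div_eq_inv_mul, le_div_iff₀ (by positivity)]
    exact h.trans (le_self_pow₀ hc (by norm_num))
  exact h1.trans (Real.rpow_le_rpow_of_exponent_le hB (by norm_num))
lemma kernel4 {P : Nat} [NeZero P] (Hs : Finset Int) (hH : Hs.Nonempty) (s : Int -> ZMod P) (k : ZMod P) :
    ‖1 - (1 / (Hs.card : Complex)) * ∑ t ∈ Hs, ZMod.stdAddChar (k * s t)‖ ^ 2 <= 4 := by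
  have := avg_le Hs hH (fun t => (ZMod.stdAddChar (k * s t) : Complex)) 2 fun t _ => by
    refine (norm_sub_le _ _).trans ?_
    simp; norm_num
  nlinarith [norm_nonneg (1 - (1 / (Hs.card : Complex)) * ∑ t ∈ Hs, ZMod.stdAddChar (k * s t))]
set_option maxHeartbeats 400000 in
lemma step {A : Finset Nat} (hA : PA A) {ho al Fm : Real} (ah : 0 < ho) (eb : 0 < al) {C : Nat} {P q : Nat} [Fact P.Prime]
    [NeZero P] [NeZero q] {U Z : Nat -> Finset aa} {co : Finset aa} {f : Mq q × Nat -> aa} {n B S K N : Nat} {η ae T L : Real}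
    (hU : ∀ j, ChainU A B j (U j)) (hZ : ∀ j, ChainZ A C B j (Z j)) (hUZ : ∀ j, U (j + 1) = U j * Z j)
    (hB : 6 <= B) (hBC : 4 * C <= B) (hcc : 1 <= ho * (B ^ (2 ^ n) : Nat)) (hPc : 2 * ((B ^ (2 ^ n) : Nat):Real) ^ 8 <= ho * P)
    (E : Ens A P ho (U (n + 2)) (WQ q ×ˢ range (K+1)) f co (U (n + 5))) (hR : en P ho C al)
    (hFm : ∀ a ∈ WQ q ×ˢ range (K+1), (f a 1 1 : Real) <= Fm) (hBP : B ^ 7 < P)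
    (ce : B ^ (2 ^ n) <= S) (ck : S <= (B ^ (2 ^ n)) ^ 80)
    (hco : ∀ t ∈ co, (S : Int) <= t 1 1 ∧ t 1 1 <= C * S) (nco : (S:Real) ^ k49 <= co.card)
    (hf : ∀ g ∈ WQ q, ∀ i < K + 1, red q (f (g, i)) = g ∧
      ∀ a b, ((1 + i * η) * T) * VV a b <= f (g, i) a b ∧ (f (g, i) a b : Real) <= (1 + η) * (((1 + i * η) * T) * VV a b))
    (hX : ∀ u ∈ U (n+2), ∀ c ∈ co, ∀ z ∈ U (n+5), N / ae <= T * XX u (c * z.transpose) ∧ T * XX u (c * z.transpose) <= N / 2)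
    (hη : η = 1 / ((B:Real) ^ 7) ^ 3) (hN : 0 < N) (bo : 0 < ae) (hK : η * K = ae) (hNP : N < P)
    (hq : ∀ r : Nat, 1 <= r -> r <= B ^ 7 -> r ∣ q) (hqP : (q:Real) <= η * P)
    (htail : 4 * (2304 * (2 / ho + 1) * (16 * Fm ^ 2 * C ^ 2) / ((B ^ (2 ^ n) : Nat) : Real) ^ 3) <= (B:Real) ^ nhf)
    (Bd : Finset Nat) (hBd : ∀ d ∈ Bd, N < 2 * d ∧ d <= N ∧ ∑ p ∈ d.primeFactors, (1 / (p:Real)) <= L ∧ ¬ memD (A : Set Nat) d) :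
    Bd.card * (Real.exp (-2 * L)) ^ 2 <= ((121 + 8 * al) * (B:Real) ^ nhf) * (36 * (ae + 2) ^ 2) * P := by
  have el : (0:Real) < B := mod_cast (by omega : 0 < B)
  have fe : (1:Real) <= B := mod_cast (by omega : 1 <= B)
  have ff : 0 < η := by rw [hη]; positivity
  have cd : η <= 1 := by rw [hη]; exact div_le_one_of_le₀ (one_le_pow₀ (one_le_pow₀ fe)) (by positivity)
  have ek : (0:Real) < P := mod_cast NeZero.pos P
  have em : (0:Real) < q := mod_cast NeZero.pos q
  have ct := Nat.floor_le (show 0 <= η * P / q by positivity)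
  have cu := Nat.lt_floor_add_one (η * P / q)
  set hm := ⌊η * P / q⌋₊ with hhm
  rw [le_div_iff₀ em] at ct
  rw [div_lt_iff₀ em] at cu
  have hNP' : (N:Real) <= P := mod_cast hNP.le
  have bl := bad_count (L := L) hA ah E hf hX ff hN bo hK.ge hNP
    (lt_of_le_of_lt (mul_le_mul_of_nonneg_left hNP' ff.le) (by rw [mul_comm (q:Real)]; exact cu)) Bd hBd
  have hne : (Finset.Icc (-(hm:Int)) hm).Nonempty := nonempty_Icc.2 (by omega)
  have bx := energy hA ah eb hU hZ hUZ hB hBC hcc hPc E hR hFm hBP ce ck hco nco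
    (fun k => ‖1 - (1 / ((Finset.Icc (-(hm:Int)) hm).card : Complex)) * ∑ t ∈ Finset.Icc (-(hm:Int)) hm, ZMod.stdAddChar (k * (((q:Int) * t : Int) : ZMod P))‖ ^ 2)
    ((2 * Real.pi * η * ((B ^ 7 : Nat) : Real)) ^ 2) (sq_nonneg _) (fun k => sq_nonneg _)
    (fun k => kernel4 _ hne (fun t : Int => (((q:Int) * t : Int) : ZMod P)) k)
    (fun k hk => pow_le_pow_left₀ (norm_nonneg _) (kernel_major hk hq _ hne η (fun t ht => by
      have h := abs_le.2 (mem_Icc.1 ht)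
      have h' : |(t:Real)| <= hm := mod_cast h
      calc (q:Real) * |(t:Real)| <= q * hm := by gcongr
        _ <= η * P := by linarith)) 2)
  have ab := eps_num hB hη
  have dp := bl.trans bx
  have cpos : ∀ j, (0:Real) < (U j).card := fun j => lt_of_lt_of_le (Real.rpow_pos_of_pos (by positivity) _) (hU j).card
  have fy : (0:Real) < S := by
    have : 0 < B ^ (2 ^ n) := Nat.pow_pos (by omega)
    exact_mod_cast (by omega : 0 < S)
  have copos : (0:Real) < co.card := lt_of_lt_of_le (Real.rpow_pos_of_pos fy _) nco
  refine bad_num (Bd := (Bd.card : Real)) (X := (U (n+2)).card * co.card * (U (n+5)).card) (W := (WQ q).card) (az := (K + 1 : Nat)) (h := 2 * hm + 1)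
    (e := Real.exp (-2 * L)) (q := q) (P := P) (η := η) (ae := ae)
    (mul_pos (mul_pos (cpos _) copos) (cpos _)) (by positivity) (mod_cast WQ_card q) (by positivity) ?_ (by positivity) ?_ em ek
    (by positivity) ?_
  . push_cast; linarith
  . linarith
  . refine dp.trans ?_
    rw [card_product, card_range]
    have : ((U (n+2)).card * (((WQ q).card * (K+1) : Nat) : Real) * co.card * (U (n+5)).card : Real) =
      (U (n+2)).card * co.card * (U (n+5)).card * ((WQ q).card * ((K+1 : Nat) : Real)) := by push_cast; ring
    rw [this]
    refine mul_le_mul_of_nonneg_right ?_ (sq_nonneg _)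
    linarith
end ZD
namespace ZD
open scoped Pointwise
open Finset
lemma VV11_le : VV 1 1 <= 4 := by
  have bk : Real.goldenRatio <= 1.62 := by
    rw [Real.goldenRatio]; have : √5 <= 2.24 := Real.sqrt_le_iff.2 ⟨by norm_num, by norm_num⟩; linarith
  have av : √2 <= 1.42 := Real.sqrt_le_iff.2 ⟨by norm_num, by norm_num⟩
  have := Real.goldenRatio_pos
  simp only [VV, Matrix.cons_val_one, Matrix.cons_val_fin_one]
  nlinarith [Real.sqrt_nonneg 2]
lemma fam_f {A : Finset Nat} (hA : PA A) (h1 : 1 ∈ A) (h2 : 2 ∈ A) (q : Nat) [NeZero q] {η : Real}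
    (hη : 0 < η) (cd : η <= 1) : ∃ T : Real, 1 <= T ∧ ∃ f : Mq q × Nat -> aa, ∀ g ∈ WQ q, ∀ i : Nat,
      (∃ n, 1 <= n ∧ f (g, i) ∈ G A ^ n) ∧ red q (f (g, i)) = g ∧
      ∀ a b, ((1 + i * η) * T) * VV a b <= f (g, i) a b ∧ (f (g, i) a b : Real) <= (1 + η) * (((1 + i * η) * T) * VV a b) := by
  obtain ⟨T, hT, h⟩ := family hA h1 h2 q hη cd
  have : ∀ p : Mq q × Nat, ∃ F : aa, p.1 ∈ WQ q -> (∃ n, 1 <= n ∧ F ∈ G A ^ n) ∧ red q F = p.1 ∧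
      ∀ a b, ((1 + p.2 * η) * T) * VV a b <= F a b ∧ (F a b : Real) <= (1 + η) * (((1 + p.2 * η) * T) * VV a b) := by
    rintro ⟨g, i⟩
    by_cases hg : g ∈ WQ q
    . have hi : 0 <= (i:Real) * η := by positivity
      obtain ⟨n, hn, F, hF, e, hb⟩ := h g hg ((1 + i * η) * T) (by nlinarith)
      exact ⟨F, fun _ => ⟨⟨n, hn, hF⟩, e, hb⟩⟩
    . exact ⟨1, fun h => absurd h hg⟩
  choose f hf using this
  exact ⟨T, hT, f, fun g hg i => hf (g, i) hg⟩
lemma Fm_bd {η ae T F : Real} {i K : Nat} (hη : 0 < η) (cd : η <= 1) (hT : 1 <= T) (hi : i < K + 1) (hK : η * K = ae)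
    (hF : F <= (1 + η) * (((1 + i * η) * T) * VV 1 1)) : F <= 8 * (1 + ae) * T := by
  have hi' : (i:Real) * η <= ae := by
    have : (i:Real) <= K := mod_cast Nat.lt_add_one_iff.1 hi
    nlinarith
  have ar : 0 <= (i:Real) * η := by positivity
  have := VV11_le
  have := VV_pos 1 1
  have hC0 : 0 <= ae := ar.trans hi'
  have hp : 0 <= (1 + ae) * T := by positivity
  calc F <= _ := hF
    _ <= (1 + 1) * (((1 + ae) * T) * 4) := by gcongr
    _ = _ := by ring
lemma main_bound {A : Finset Nat} (hA : PA A) (hdimA : hdim (A : Set Nat) > 1 - 5 / 312) (h1 : 1 ∈ A) (h2 : 2 ∈ A)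
    {C : Nat} (ei : 1 <= C) (hC : ∀ a ∈ A, a + 1 <= C) {ho al ae : Real} (bo : ae = 120 * C) (ah : ho = 1 / (2 * ae * (ae + 3))) (eb : 0 < al)
    (hR : ∀ (P : Nat) [NeZero P], en P ho C al) {B : Nat} (hB : 6 <= B) (hBC : 4 * C <= B) {U Z : Nat -> Finset aa}
    (hU : ∀ j, ChainU A B j (U j)) (hZ : ∀ j, ChainZ A C B j (Z j)) (hUZ : ∀ j, U (j + 1) = U j * Z j) (L : Real) :
    ∃ bi : Nat, ∀ N ≥ bi, ∀ Bd : Finset Nat,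
      (∀ d ∈ Bd, N < 2 * d ∧ d <= N ∧ ∑ p ∈ d.primeFactors, (1 / (p:Real)) <= L ∧ ¬ memD (A : Set Nat) d) ->
      Bd.card * (Real.exp (-2 * L)) ^ 2 <= ((121 + 8 * al) * (B:Real) ^ nhf) * (36 * (ae + 2) ^ 2) * (2 * (ae + 3) * N) := by
  have hC1' : (1:Real) <= C := mod_cast ei
  have li : 0 < ae := by rw [bo]; linarith
  have ka : 0 < ho := by rw [ah]; positivity
  have fe : (1:Real) <= B := mod_cast (by omega : 1 <= B)
  have el : (0:Real) < B := by linarith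
  set q := (B ^ 7).factorial with hq
  have : NeZero q := ⟨Nat.factorial_ne_zero _⟩
  set η : Real := 1 / ((B:Real) ^ 7) ^ 3 with hη
  have ff : 0 < η := by rw [hη]; positivity
  have cd : η <= 1 := by rw [hη]; exact div_le_one_of_le₀ (one_le_pow₀ (one_le_pow₀ fe)) (by positivity)
  obtain ⟨T, hT, f, hf⟩ := fam_f hA h1 h2 q ff cd
  set K : Nat := 120 * C * (B ^ 7) ^ 3 with hKdef
  have hK : η * K = ae := by rw [hη, hKdef, bo]; push_cast; field_simp
  obtain ⟨bn, fh⟩ := pinned hA hC hdimA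
  set Q := 4 * (2304 * (2 / ho + 1) * (16 * (8 * (1 + ae) * T) ^ 2 * C ^ 2)) with hQ
  have hQ0 : 0 <= Q := by positivity
  set M := ⌈(bn:Real) + 320 * C * T + 2 / ho + Q * B + 1⌉₊ with hM
  have hMl := Nat.le_ceil ((bn:Real) + 320 * C * T + 2 / ho + Q * B + 1)
  rw [<- hM] at hMl
  have bk : 0 <= 320 * C * T := by positivity
  have bw : 0 <= 2 / ho := by positivity
  have gw : 0 <= Q * B := by positivity
  have g4 : (0:Real) <= bn := by positivity
  refine ⟨M ^ 80 + B ^ 40 + q * (B ^ 7) ^ 3, fun N hN Bd hBd => ?_⟩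
  obtain ⟨n, db, ki⟩ := scale (by omega : 2 <= B) (show B ^ 40 <= N by omega)
  have hcM : M <= B ^ (2 ^ n) := by
    have : M ^ 80 < (B ^ (2 ^ n)) ^ 80 := by omega
    exact (lt_of_pow_lt_pow_left₀ 80 (by positivity) this).le
  have hBc : B <= B ^ (2 ^ n) := Nat.le_self_pow (by positivity) B
  have eI : (B:Real) ^ (2 ^ (n+2)) = ((B ^ (2 ^ n) : Nat) : Real) ^ 4 := by push_cast; rw [<- pow_mul, pow_add]; norm_num
  have eJ : (B:Real) ^ (2 ^ (n+5)) = ((B ^ (2 ^ n) : Nat) : Real) ^ 32 := by push_cast; rw [<- pow_mul, pow_add]; norm_num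
  obtain ⟨mI, ef, dm, fu⟩ := minU (hU (n+2)) (by omega)
  obtain ⟨mJ, mo, mp, j3⟩ := minU (hU (n+5)) (by omega)
  rw [eI] at dm
  rw [eJ] at mp
  generalize hcdef : B ^ (2 ^ n) = c at *
  have hcM' : (M:Real) <= c := mod_cast hcM
  have hcr : (1:Real) <= c := by linarith
  obtain ⟨S, av, ap, lf, lg, lb⟩ := choose_S (C := C) (T := T) (mI := mI) (mJ := mJ) (c := c) (N := N) hC1' hT ef mo dm mp
    (by linarith) (mod_cast db) (mod_cast ki)
  obtain ⟨m, dr, co, hcoG, hco, nco, -⟩ := fh S (by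
    have : (bn:Real) <= S := by linarith
    exact_mod_cast this)
  have hS1r : (1:Real) <= S := mod_cast lf
  have nco' : (S:Real) ^ k49 <= co.card := (Real.rpow_le_rpow_of_exponent_le hS1r (by norm_num)).trans nco
  have hNpos : 0 < N := lt_of_lt_of_le (Nat.pow_pos (by omega)) db
  obtain ⟨P, hPp, gz, mn⟩ := Nat.exists_prime_lt_and_le_two_mul ((120 * C + 3) * N) (by positivity)
  have : Fact P.Prime := ⟨hPp⟩
  have : NeZero P := ⟨hPp.ne_zero⟩
  have hP1' : (ae + 3) * N <= P := by rw [bo]; exact_mod_cast gz.le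
  have hP2' : (P:Real) <= 2 * (ae + 3) * N := by rw [bo, mul_assoc]; exact_mod_cast mn
  have hNP : N < P := lt_of_le_of_lt (Nat.le_mul_of_pos_left _ (by omega)) gz
  have hX : ∀ u ∈ U (n+2), ∀ t ∈ co, ∀ z ∈ U (n+5), N / ae <= T * XX u (t * z.transpose) ∧ T * XX u (t * z.transpose) <= N / 2 := by
    intro u hu t ht z hz
    obtain ⟨_, ed, ee⟩ := (hU (n+2)).sub
    obtain ⟨_, lk, gc⟩ := (hU (n+5)).sub
    have hb := XX_bd (good_pow hA ed (ee hu)) (good_pow hA dr (hcoG ht)) (good_pow hA lk (gc hz))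
    have ht' := hco t ht
    rw [bo]
    exact TX_bd hC1' hT ef mo hS1r lg lb (fu u hu) ⟨mod_cast ht'.1, mod_cast ht'.2⟩ (j3 z hz) hb.1 hb.2
  have E := mk_ens (P := P) hA ah (fun g hg i _ => hf g hg i) hX (hU (n+2)).sub ⟨m, dr, hcoG⟩ (hU (n+5)).sub ff cd li hK.le hP1' hP2'
  have hcc : 2 <= ho * c := by
    have : 2 / ho <= c := by linarith
    rw [div_le_iff₀ ka] at this; linarith
  have hcP : (c:Real) ^ 40 <= P := mod_cast db.trans hNP.le
  have hfin := step (Fm := 8 * (1 + ae) * T) (ho := ho) (K := K) (n := n) (S := S) (η := η) (ae := ae) (T := T) hA ka eb hU hZ hUZ hB hBC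
    (by rw [hcdef]; linarith)
    (by rw [hcdef]
        calc 2 * (c:Real) ^ 8 <= (ho * c) * c ^ 8 := by gcongr
          _ = ho * c ^ 9 := by ring
          _ <= ho * c ^ 40 := by gcongr; norm_num
          _ <= ho * P := by gcongr) E (hR P)
    (by rintro ⟨g, i⟩ ha
        simp only [mem_product, mem_range] at ha
        exact Fm_bd ff cd hT ha.2 hK ((hf g ha.1 i).2.2 1 1).2)
    (by calc B ^ 7 <= c ^ 7 := Nat.pow_le_pow_left hBc 7
          _ <= c ^ 40 := Nat.pow_le_pow_right (by omega) (by norm_num)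
          _ < P := lt_of_le_of_lt db hNP)
    (by rw [hcdef]; exact_mod_cast av) (by rw [hcdef]; exact_mod_cast ap) hco nco' (fun g hg i _ => (hf g hg i).2) hX rfl hNpos li hK hNP
    (fact_dvd _)
    (by
      have : q * (B ^ 7) ^ 3 <= P := by omega
      have : (q:Real) * ((B:Real) ^ 7) ^ 3 <= P := mod_cast this
      rw [hη, one_div, <- div_eq_inv_mul, le_div_iff₀ (by positivity)]; exact this)
    (by
      rw [hcdef, <- mul_div_assoc, <- hQ]
      exact tail_num fe hcr hQ0 (by linarith)) Bd hBd
  refine hfin.trans ?_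
  gcongr
end ZD
namespace ZD
open scoped Pointwise
open Finset
open Classical in
lemma half_bound {A : Finset Nat} (hA : PA A) (hdimA : hdim (A : Set Nat) > 1 - 5 / 312) {ε : Real} (hε : 0 < ε) :
    ∃ bi : Nat, ∀ N ≥ bi, (((Finset.Ioc 0 N).filter (fun d => N < 2 * d ∧ ¬ memD (A : Set Nat) d)).card : Real) <= 2 * ε * N := by
  obtain ⟨h1, h2⟩ := one_two_mem hA hdimA
  obtain ⟨C, ei, hC⟩ : ∃ C : Nat, 1 <= C ∧ ∀ a ∈ A, a + 1 <= C :=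
    ⟨A.sup id + 1, by omega, fun a ha => Nat.succ_le_succ (le_sup (f := id) ha)⟩
  have hC1' : (1:Real) <= C := mod_cast ei
  obtain ⟨ae, bo⟩ : ∃ ae : Real, ae = 120 * C := ⟨_, rfl⟩
  obtain ⟨ho, ah⟩ : ∃ ho : Real, ho = 1 / (2 * ae * (ae + 3)) := ⟨_, rfl⟩
  have li : 0 < ae := by rw [bo]; linarith
  have ka : 0 < ho := by rw [ah]; positivity
  obtain ⟨al, eb, hR⟩ := regime1 ka hC1'
  obtain ⟨km, el⟩ := chain hA ei hC hdimA
  set D := (121 + 8 * al) * (36 * (ae + 2) ^ 2) * (2 * (ae + 3)) with hD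
  have ft : 0 < D := by positivity
  set X := (Real.exp (-2 * (1 / ε))) ^ 2 with hX
  have df : 0 < X := by positivity
  have ht : Tendsto (fun B : Nat => (B:Real) ^ nhf) atTop (nhds 0) :=
    (tendsto_rpow_neg_atTop (by norm_num : (0:Real) < 1/2)).comp tendsto_natCast_atTop_atTop
  have hev := ht.eventually (gt_mem_nhds (show 0 < ε * X / D by positivity))
  obtain ⟨B, hBl, hBB⟩ := (hev.and (eventually_ge_atTop (km + 6 + 4 * C))).exists
  obtain ⟨U, Z, hU, hZ, hUZ⟩ := el B (by omega)
  obtain ⟨bi, fz⟩ := main_bound hA hdimA h1 h2 ei hC bo ah eb (fun P _ => hR P) (B := B) (by omega) (by omega) hU hZ hUZ (1 / ε)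
  refine ⟨bi, fun N hN => ?_⟩
  set s := (Finset.Ioc 0 N).filter (fun d => N < 2 * d ∧ ¬ memD (A : Set Nat) d) with hs
  set a := s.filter (fun d : Nat => ∑ p ∈ d.primeFactors, (1 / (p:Real)) <= 1 / ε) with ha
  set b := (Finset.Ioc 0 N).filter (fun d : Nat => 1 / ε < ∑ p ∈ d.primeFactors, (1 / (p:Real))) with hb
  have hsub : s ⊆ a ∪ b := by
    intro d hd
    rw [mem_union]
    rcases le_or_gt (∑ p ∈ d.primeFactors, (1 / (p:Real))) (1 / ε) with h | h
    . exact Or.inl (mem_filter.2 ⟨hd, h⟩)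
    . exact Or.inr (mem_filter.2 ⟨(mem_filter.1 hd).1, h⟩)
  have hcard : (s.card : Real) <= a.card + b.card := by
    exact_mod_cast (card_le_card hsub).trans (card_union_le _ _)
  have hbc : (b.card : Real) <= ε * N := by
    have := markov N (1 / ε)
    rw [<- hb, one_div, inv_mul_le_iff₀ hε] at this
    exact this
  have hac : (a.card : Real) <= ε * N := by
    have h := fz N hN a (by
      intro d hd
      rw [ha, hs, mem_filter, mem_filter, mem_Ioc] at hd
      exact ⟨hd.1.2.1, hd.1.1.2, hd.2, hd.1.2.2⟩)
    rw [<- hX] at h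
    rw [lt_div_iff₀ ft] at hBl
    have h3 : (a.card : Real) * X <= (ε * N) * X := by
      calc (a.card : Real) * X <= _ := h
        _ = ((B:Real) ^ nhf * D) * N := by rw [hD]; ring
        _ <= (ε * X) * N := by gcongr
        _ = _ := by ring
    exact le_of_mul_le_mul_right h3 df
  linarith
open Classical in
lemma full_bound {A : Finset Nat} (hA : PA A) (hdimA : hdim (A : Set Nat) > 1 - 5 / 312) {ε : Real} (hε : 0 < ε) :
    ∃ bi : Nat, ∀ N, (((Finset.Ioc 0 N).filter (fun d => ¬ memD (A : Set Nat) d)).card : Real) <= 4 * ε * N + bi := by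
  obtain ⟨bi, h⟩ := half_bound hA hdimA hε
  refine ⟨bi, fun N => ?_⟩
  induction N using Nat.strong_induction_on with
  | _ N ih =>
    rcases lt_or_ge N (bi + 1) with hN | hN
    . have h1 : ((Finset.Ioc 0 N).filter (fun d => ¬ memD (A : Set Nat) d)).card <= bi :=
        (card_filter_le _ _).trans (by rw [Nat.card_Ioc]; omega)
      have h2 : (((Finset.Ioc 0 N).filter (fun d => ¬ memD (A : Set Nat) d)).card : Real) <= bi := mod_cast h1
      have : 0 <= 4 * ε * N := by positivity
      linarith
    . have h1 := ih (N / 2) (by omega)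
      have h2 := h N (by omega)
      have hsub : (Finset.Ioc 0 N).filter (fun d => ¬ memD (A : Set Nat) d) ⊆
          (Finset.Ioc 0 (N / 2)).filter (fun d => ¬ memD (A : Set Nat) d) ∪
          (Finset.Ioc 0 N).filter (fun d => N < 2 * d ∧ ¬ memD (A : Set Nat) d) := by
        intro d hd
        simp only [mem_union, mem_filter, mem_Ioc] at hd ⊢
        rcases lt_or_ge N (2 * d) with h | h
        . exact Or.inr ⟨hd.1, h, hd.2⟩
        . exact Or.inl ⟨⟨hd.1.1, by omega⟩, hd.2⟩
      have hcard := (card_le_card hsub).trans (card_union_le _ _)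
      have hcard' : (((Finset.Ioc 0 N).filter (fun d => ¬ memD (A : Set Nat) d)).card : Real) <=
        ((Finset.Ioc 0 (N / 2)).filter (fun d => ¬ memD (A : Set Nat) d)).card +
          ((Finset.Ioc 0 N).filter (fun d => N < 2 * d ∧ ¬ memD (A : Set Nat) d)).card := mod_cast hcard
      have h3 : ((N / 2 : Nat) : Real) <= N / 2 := Nat.cast_div_le
      have h4 : 4 * ε * ((N / 2 : Nat) : Real) <= 4 * ε * (N / 2) := by gcongr
      linarith
open Classical in
lemma Dcount_eq (A : Set Nat) (N : Nat) :
    (Dcount A N : Real) = N - ((Finset.Ioc 0 N).filter (fun d => ¬ memD A d)).card := by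
  have h1 : Dcount A N = ((Finset.Ioc 0 N).filter (fun d => memD A d)).card := by
    rw [Dcount, <- Set.ncard_coe_finset]
    congr 1
    ext d
    simp only [Set.mem_ofPred_eq, coe_filter, mem_Ioc]
    exact ⟨fun h => ⟨⟨h.2.1, h.1⟩, h.2⟩, fun h => ⟨h.1.2, h.2⟩⟩
  have h2 := card_filter_add_card_filter_not (s := Finset.Ioc 0 N) (fun d => memD A d)
  rw [Nat.card_Ioc, <- h1, Nat.sub_zero] at h2
  have h3 : (Dcount A N : Real) + ((Finset.Ioc 0 N).filter (fun d => ¬ memD A d)).card = N := mod_cast h2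
  linarith
end ZD


theorem zaremba_density_one (A : Finset ℕ) (hA : ∀ a ∈ A, 0 < a)
    (hdimA : hdim (A : Set ℕ) > 1 - 5 / 312) :
    Tendsto (fun N : ℕ => (Dcount (A : Set ℕ) N : ℝ) / (N : ℝ)) atTop (nhds 1) := by
  classical
  rw [Metric.tendsto_atTop]
  intro ε hε
  obtain ⟨bi, h⟩ := ZD.full_bound hA hdimA (ε := ε / 8) (by positivity)
  refine ⟨⌈4 * bi / ε⌉₊ + 1, fun N hN => ?_⟩
  have gy : 0 < N := by omega
  have hNr : (0:ℝ) < N := by exact_mod_cast gy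
  have hle : 4 * bi / ε ≤ N := (Nat.le_ceil _).trans (by exact_mod_cast (by omega : ⌈4 * bi / ε⌉₊ ≤ N))
  rw [div_le_iff₀ hε] at hle
  rw [ZD.Dcount_eq, Real.dist_eq]
  have hb := h N
  set f : ℝ := (((Finset.Ioc 0 N).filter (fun d => ¬ memD (A : Set ℕ) d)).card : ℝ) with hf
  have hf0 : 0 ≤ f := Nat.cast_nonneg _
  have e : (N - f) / N - 1 = -(f / N) := by field_simp; ring
  rw [e, abs_neg, abs_of_nonneg (by positivity), div_lt_iff₀ hNr]
  nlinarith
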